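/- arXiv:math/0208006 — 7 statements merged into one kernel-verified Lean document; each statement's English description precedes it below -/
import Mathlib

section
/- For all n ≥ 1 and k ≥ 3, the number of permutations of {1,…,n} that avoid both the pattern 132 and the decreasing pattern k(k−1)⋯1 equals (1/n) · Σ_{i=1}^{k−1} C(n,i)·C(n,i−1). -/
def Contains {n k : ℕ} (π : Equiv.Perm (Fin n)) (τ : Equiv.Perm (Fin k)) : Prop :=
  ∃ f : Fin k → Fin n, (∀ a b : Fin k, a < b → f a < f b) ∧
    ∀ a b : Fin k, τ a < τ b ↔ π (f a) < π (f b)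

instance {n k : ℕ} (π : Equiv.Perm (Fin n)) (τ : Equiv.Perm (Fin k)) : Decidable (Contains π τ) := by
  unfold Contains; infer_instance

def Avoids {n k : ℕ} (π : Equiv.Perm (Fin n)) (τ : Equiv.Perm (Fin k)) : Prop := ¬ Contains π τ

instance {n k : ℕ} (π : Equiv.Perm (Fin n)) (τ : Equiv.Perm (Fin k)) : Decidable (Avoids π τ) := by
  unfold Avoids; infer_instance

/-- The pattern 132 as a permutation of `Fin 3` (0-indexed values 0,2,1). -/
def pat132 : Equiv.Perm (Fin 3) := Equiv.swap 1 2

/-- The pattern 321 as a permutation of `Fin 3`. -/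
def pat321 : Equiv.Perm (Fin 3) := Fin.revPerm


open Finset

namespace S13

def app {n : ℕ} (σ : Equiv.Perm (Fin n)) (v : Fin (n+1)) : Equiv.Perm (Fin (n+1)) :=
  (finSuccEquivLast.trans (Equiv.optionCongr σ)).trans (finSuccEquiv' v).symm

lemma app_last {n : ℕ} (σ : Equiv.Perm (Fin n)) (v : Fin (n+1)) : app σ v (Fin.last n) = v := by
  simp [app]

lemma app_cs {n : ℕ} (σ : Equiv.Perm (Fin n)) (v : Fin (n+1)) (i : Fin n) :
    app σ v i.castSucc = v.succAbove (σ i) := by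
  simp [app]

lemma app_val {n : ℕ} (σ : Equiv.Perm (Fin n)) (v : Fin (n+1)) (i : Fin n) :
    (app σ v i.castSucc : ℕ) = if (σ i : ℕ) < v then (σ i : ℕ) else σ i + 1 := by
  rw [app_cs, Fin.succAbove]
  simp only [Fin.lt_def, Fin.val_castSucc]
  split_ifs <;> simp

lemma app_bij (n : ℕ) : Function.Bijective
    (fun p : Equiv.Perm (Fin n) × Fin (n+1) => app p.1 p.2) := by
  rw [Fintype.bijective_iff_injective_and_card]
  constructor
  · rintro ⟨σ, v⟩ ⟨τ, w⟩ h
    simp only at h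
    have hv : v = w := by rw [← app_last σ v, h, app_last]
    subst hv
    congr 1
    ext i : 1
    have := app_cs σ v i
    rw [h, app_cs] at this
    exact (Fin.succAbove_right_injective this).symm
  · simp [Fintype.card_perm, Nat.factorial_succ, mul_comm]

def Av {n : ℕ} (π : Equiv.Perm (Fin n)) : Prop :=
  ∀ i j k : Fin n, i < j → j < k → ¬ ((π i : ℕ) < π k ∧ (π k : ℕ) < π j)

instance {n : ℕ} (π : Equiv.Perm (Fin n)) : Decidable (Av π) := by
  unfold Av; infer_instance

def S {n : ℕ} (σ : Equiv.Perm (Fin n)) : Finset ℕ :=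
  (range (n+1)).filter (fun w => ∀ i j : Fin n, i < j → (σ i : ℕ) < w → (σ j : ℕ) < w)

lemma mem_S {n : ℕ} (σ : Equiv.Perm (Fin n)) (w : ℕ) : w ∈ S σ ↔
    w < n + 1 ∧ ∀ i j : Fin n, i < j → (σ i : ℕ) < w → (σ j : ℕ) < w := by
  simp [S]

lemma zero_mem {n : ℕ} (σ : Equiv.Perm (Fin n)) : 0 ∈ S σ := by simp [mem_S]

lemma av_app {n : ℕ} (σ : Equiv.Perm (Fin n)) (v : Fin (n+1)) :
    Av (app σ v) ↔ Av σ ∧ (v : ℕ) ∈ S σ := by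
  rw [mem_S]
  constructor
  · intro h
    refine ⟨fun i j k hij hjk hh => ?_, v.2, fun i j hij hi => ?_⟩
    · apply h i.castSucc j.castSucc k.castSucc hij hjk
      simp only [app_val]
      split_ifs <;> omega
    · by_contra hj
      apply h i.castSucc j.castSucc (Fin.last n) hij (Fin.castSucc_lt_last j)
      simp only [app_val, app_last]
      split_ifs <;> omega
  · rintro ⟨h, -, hs⟩ i j k hij hjk
    induction k using Fin.lastCases with
    | last =>
      induction j using Fin.lastCases with
      | last => exact absurd hjk (lt_irrefl _)
      | cast j =>
      induction i using Fin.lastCases with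
      | last => exact absurd (hij.trans hjk) (lt_irrefl _)
      | cast i =>
      have := hs i j hij
      simp only [app_val, app_last]
      split_ifs <;> omega
    | cast k =>
      induction j using Fin.lastCases with
      | last => exact absurd hjk (not_lt.2 (Fin.le_last _))
      | cast j =>
      induction i using Fin.lastCases with
      | last => exact absurd hij (not_lt.2 (Fin.le_last _))
      | cast i =>
      have := h i j k hij hjk
      have h3 : (σ i : ℕ) ≠ σ k := by
        intro h; have := σ.injective (Fin.ext h); subst this
        exact absurd (hij.trans hjk) (lt_irrefl _)
      simp only [app_val]
      split_ifs <;> omega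

lemma S_app {n : ℕ} (σ : Equiv.Perm (Fin n)) (v : Fin (n+1)) :
    S (app σ v) = insert 0 (((S σ).filter (fun u => (v : ℕ) ≤ u)).image (· + 1)) := by
  ext w
  simp only [mem_insert, mem_image, mem_filter]
  constructor
  · intro h
    rcases Nat.eq_zero_or_pos w with h0 | h0
    · exact Or.inl h0
    right
    rw [mem_S] at h
    obtain ⟨hw, h⟩ := h
    have hvw : (v : ℕ) < w := by
      by_contra hvw
      let p := (app σ v).symm ⟨0, by omega⟩
      have hp : app σ v p = ⟨0, by omega⟩ := by simp [p]
      have hpl : p < Fin.last n := by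
        rw [Fin.lt_last_iff_ne_last]
        intro h'
        rw [h', app_last] at hp
        have := congrArg Fin.val hp
        change (v:ℕ) = 0 at this
        omega
      have := h p (Fin.last n) hpl (by rw [hp]; exact h0)
      rw [app_last] at this
      omega
    refine ⟨w - 1, ⟨?_, by omega⟩, by omega⟩
    rw [mem_S]
    refine ⟨by omega, fun i j hij hi => ?_⟩
    have := h i.castSucc j.castSucc hij
    simp only [app_val] at this
    split_ifs at this <;> omega
  · rintro (rfl | ⟨u, ⟨hu, hvu⟩, rfl⟩)
    · exact zero_mem _
    rw [mem_S] at hu ⊢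
    obtain ⟨hu1, hu⟩ := hu
    refine ⟨by omega, fun i j hij => ?_⟩
    induction j using Fin.lastCases with
    | last => intro _; rw [app_last]; omega
    | cast j =>
    induction i using Fin.lastCases with
    | last => exact absurd hij (not_lt.2 (Fin.le_last _))
    | cast i =>
    have := hu i j hij
    simp only [app_val]
    split_ifs <;> omega

def cc {n : ℕ} (σ : Equiv.Perm (Fin n)) : ℕ := (S σ).card - 1

lemma card_S {n : ℕ} (σ : Equiv.Perm (Fin n)) : (S σ).card = cc σ + 1 := by
  have := Finset.card_pos.2 ⟨0, zero_mem σ⟩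
  unfold cc; omega

lemma cc_app {n : ℕ} (σ : Equiv.Perm (Fin n)) (v : Fin (n+1)) :
    cc (app σ v) = ((S σ).filter (fun u => (v : ℕ) ≤ u)).card := by
  unfold cc
  rw [S_app, card_insert_of_notMem (by simp), card_image_of_injective _ (add_left_injective 1)]
  simp

def Dec {n : ℕ} (π : Equiv.Perm (Fin n)) (s : Finset (Fin n)) : Prop :=
  ∀ i ∈ s, ∀ j ∈ s, i < j → (π j : ℕ) < π i

instance {n : ℕ} (π : Equiv.Perm (Fin n)) (s) : Decidable (Dec π s) := by
  unfold Dec; infer_instance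

def lds {n : ℕ} (π : Equiv.Perm (Fin n)) : ℕ := (univ.filter (Dec π)).sup card

lemma le_lds {n : ℕ} {π : Equiv.Perm (Fin n)} {s : Finset (Fin n)} (h : Dec π s) :
    s.card ≤ lds π := Finset.le_sup (f := card) (by simpa using h)

lemma exists_lds {n : ℕ} (π : Equiv.Perm (Fin n)) : ∃ s, Dec π s ∧ s.card = lds π := by
  obtain ⟨s, hs, h⟩ := Finset.exists_mem_eq_sup (univ.filter (Dec π)) ⟨∅, by simp [Dec]⟩ card
  exact ⟨s, by simpa using hs, h.symm⟩

lemma lds_le {n : ℕ} {π : Equiv.Perm (Fin n)} {m : ℕ} (h : ∀ s, Dec π s → s.card ≤ m) :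
    lds π ≤ m := by
  obtain ⟨s, hs, e⟩ := exists_lds π
  rw [← e]; exact h s hs

/-- preimage of a set under castSucc -/
def low {n : ℕ} (s : Finset (Fin (n+1))) : Finset (Fin n) := univ.filter (fun i => i.castSucc ∈ s)

lemma low_dec {n : ℕ} {σ : Equiv.Perm (Fin n)} {v : Fin (n+1)} {s : Finset (Fin (n+1))}
    (h : Dec (app σ v) s) : Dec σ (low s) := by
  intro i hi j hj hij
  simp only [low, mem_filter, mem_univ, true_and] at hi hj
  have := h _ hi _ hj hij
  simp only [app_val] at this
  split_ifs at this <;> omega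

lemma card_low {n : ℕ} (s : Finset (Fin (n+1))) :
    s.card = (low s).card + if Fin.last n ∈ s then 1 else 0 := by
  have e : ∀ s : Finset (Fin (n+1)), s.card = ∑ i, if i ∈ s then 1 else 0 := by intro s; simp
  rw [e, Fin.sum_univ_castSucc, low, card_filter]

lemma map_dec {n : ℕ} {σ : Equiv.Perm (Fin n)} {v : Fin (n+1)} {s : Finset (Fin n)}
    (h : Dec σ s) : Dec (app σ v) (s.map Fin.castSuccEmb) := by
  intro i hi j hj hij
  simp only [mem_map, Fin.coe_castSuccEmb] at hi hj
  obtain ⟨i, hi, rfl⟩ := hi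
  obtain ⟨j, hj, rfl⟩ := hj
  have := h _ hi _ hj hij
  simp only [app_val]
  split_ifs <;> omega

lemma lds_app_zero {n : ℕ} (σ : Equiv.Perm (Fin n)) (v : Fin (n+1)) (hv : (v : ℕ) = 0) :
    lds (app σ v) = lds σ + 1 := by
  apply le_antisymm
  · apply lds_le
    intro s hs
    have := le_lds (low_dec hs)
    rw [card_low]
    split_ifs <;> omega
  · obtain ⟨s, hs, e⟩ := exists_lds σ
    have hd : Dec (app σ v) (insert (Fin.last n) (s.map Fin.castSuccEmb)) := by
      intro i hi j hj hij
      rw [mem_insert] at hi hj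
      rcases hi with rfl | hi
      · exact absurd hij (not_lt.2 (Fin.le_last _))
      rcases hj with rfl | hj
      · simp only [mem_map, Fin.coe_castSuccEmb] at hi
        obtain ⟨i, hi, rfl⟩ := hi
        simp only [app_val, app_last]
        split_ifs <;> omega
      · exact map_dec hs i hi j hj hij
    have := le_lds hd
    rw [card_insert_of_notMem (by simp), card_map] at this
    omega

lemma lds_app_pos {n : ℕ} (σ : Equiv.Perm (Fin n)) (v : Fin (n+1)) (hv : (v : ℕ) ≠ 0)
    (hS : (v : ℕ) ∈ S σ) : lds (app σ v) = lds σ := by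
  apply le_antisymm
  · apply lds_le
    intro s hs
    rw [card_low]
    split_ifs with hl
    · have hn : 0 < n := by omega
      let p := σ.symm ⟨0, hn⟩
      have hp : (σ p : ℕ) = 0 := by simp [p]
      rw [mem_S] at hS
      have hlt : ∀ i ∈ low s, i < p := by
        intro i hi
        simp only [low, mem_filter, mem_univ, true_and] at hi
        have h1 := hs _ hi _ hl (Fin.castSucc_lt_last i)
        simp only [app_val, app_last] at h1
        have h2 : (v : ℕ) ≤ σ i := by split_ifs at h1 <;> omega
        by_contra hc
        rcases lt_or_eq_of_le (not_lt.1 hc) with h3 | h3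
        · have := hS.2 p i h3 (by omega)
          omega
        · rw [← h3] at h2; omega
      have hd : Dec σ (insert p (low s)) := by
        intro i hi j hj hij
        rw [mem_insert] at hi hj
        rcases hi with rfl | hi
        · rcases hj with rfl | hj
          · exact absurd hij (lt_irrefl _)
          · exact absurd (hlt j hj) (lt_asymm hij)
        rcases hj with rfl | hj
        · have : σ i ≠ σ p := fun h => hij.ne (σ.injective h)
          have := Fin.val_ne_of_ne this
          omega
        · exact low_dec hs i hi j hj hij
      have := le_lds hd
      rw [card_insert_of_notMem (fun h => lt_irrefl _ (hlt p h))] at this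
      exact this
    · exact le_lds (low_dec hs)
  · obtain ⟨s, hs, e⟩ := exists_lds σ
    have := le_lds (map_dec (v := v) hs)
    rw [card_map] at this
    omega

lemma sum_rank (T : Finset ℕ) (g : ℕ → ℤ) :
    ∑ v ∈ T, g ((T.filter (fun u => v ≤ u)).card) = ∑ t ∈ range T.card, g (t+1) := by
  induction T using Finset.induction_on_min with
  | empty => simp
  | insert a s ha ih =>
    have hn : a ∉ s := fun h => lt_irrefl _ (ha a h)
    rw [sum_insert hn, card_insert_of_notMem hn, sum_range_succ, add_comm, ← ih]
    congr 1
    · apply sum_congr rfl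
      intro v hv
      rw [filter_insert, if_neg (not_le.2 (ha v hv))]
    · rw [filter_true_of_mem, card_insert_of_notMem hn]
      intro x hx
      rw [mem_insert] at hx
      rcases hx with rfl | hx
      · exact le_rfl
      · exact (ha x hx).le

def E (n : ℕ) (F : ℕ → ℕ → ℤ) : ℤ :=
  ∑ π : Equiv.Perm (Fin n), if Av π then F (cc π) (lds π) else 0

lemma E_zero (F : ℕ → ℕ → ℤ) : E 0 F = F 0 0 := by
  unfold E
  rw [Fintype.sum_unique]
  have h1 : Av (default : Equiv.Perm (Fin 0)) := fun i => i.elim0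
  have h2 : cc (default : Equiv.Perm (Fin 0)) = 0 := by
    unfold cc S
    have := card_filter_le (range (0+1)) (fun w => ∀ i j : Fin 0, i < j → ((default : Equiv.Perm (Fin 0)) i : ℕ) < w → ((default : Equiv.Perm (Fin 0)) j : ℕ) < w)
    simp at this ⊢
  have h3 : lds (default : Equiv.Perm (Fin 0)) = 0 := by
    apply Nat.le_zero.1
    apply lds_le
    intro s _
    simp [Finset.eq_empty_of_isEmpty s]
  rw [if_pos h1, h2, h3]

lemma E_succ (n : ℕ) (F : ℕ → ℕ → ℤ) :
    E (n+1) F = E n (fun c d => F (c+1) (d+1) + ∑ t ∈ range c, F (t+1) d) := by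
  unfold E
  rw [← (app_bij n).sum_comp, Fintype.sum_prod_type]
  apply Fintype.sum_congr
  intro σ
  by_cases hσ : Av σ
  swap
  · simp [av_app, hσ]
  simp only [av_app, hσ, true_and, if_true]
  have key : ∀ v : Fin (n+1), (if (v : ℕ) ∈ S σ then F (cc (app σ v)) (lds (app σ v)) else 0)
      = (fun w : ℕ => if w ∈ S σ then F ((S σ).filter (fun u => w ≤ u)).card
        (if w = 0 then lds σ + 1 else lds σ) else 0) v := by
    intro v
    simp only
    split_ifs with h1 h2
    · rw [cc_app, lds_app_zero _ _ h2]
    · rw [cc_app, lds_app_pos _ _ h2 h1]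
    · rfl
  rw [Fintype.sum_congr _ _ key, Fin.sum_univ_eq_sum_range (fun w : ℕ => if w ∈ S σ then F ((S σ).filter (fun u => w ≤ u)).card
        (if w = 0 then lds σ + 1 else lds σ) else 0), ← sum_filter]
  have hf : (range (n+1)).filter (fun w => w ∈ S σ) = S σ := by
    ext w; simp only [mem_filter, mem_range, mem_S]; tauto
  rw [hf, ← add_sum_erase _ _ (zero_mem σ)]
  congr 1
  · simp [card_S]
  · have hc : cc σ = ((S σ).erase 0).card := by
      rw [card_erase_of_mem (zero_mem σ)]; rfl
    rw [hc, ← sum_rank _ (fun t => F t (lds σ))]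
    apply sum_congr rfl
    intro v hv
    have h0 : v ≠ 0 := (mem_erase.1 hv).1
    rw [if_neg h0]
    congr 2
    ext u
    simp only [mem_filter, mem_erase]
    constructor
    · rintro ⟨a, b⟩; exact ⟨⟨by omega, a⟩, b⟩
    · rintro ⟨⟨_, a⟩, b⟩; exact ⟨a, b⟩

lemma E_add (n : ℕ) (F G : ℕ → ℕ → ℤ) : E n (fun c d => F c d + G c d) = E n F + E n G := by
  unfold E
  rw [← sum_add_distrib]
  apply Fintype.sum_congr
  intro π
  split_ifs <;> simp

lemma E_sub (n : ℕ) (F G : ℕ → ℕ → ℤ) : E n (fun c d => F c d - G c d) = E n F - E n G := by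
  unfold E
  rw [← sum_sub_distrib]
  apply Fintype.sum_congr
  intro π
  split_ifs <;> simp

def g (n c d : ℕ) : ℤ := E n (fun c' d' => if c ≤ c' ∧ d' = d then 1 else 0)

lemma cc_le_lds : ∀ (n : ℕ) (F : ℕ → ℕ → ℤ), (∀ c d, c ≤ d → F c d = 0) → E n F = 0 := by
  intro n
  induction n with
  | zero => intro F h; rw [E_zero]; exact h 0 0 le_rfl
  | succ n ih =>
    intro F h
    rw [E_succ]
    apply ih
    intro c d hcd
    rw [h _ _ (by omega), sum_eq_zero, add_zero]
    intro t ht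
    rw [mem_range] at ht
    exact h _ _ (by omega)

lemma g_zero_of_lt (n c d : ℕ) (h : d < c) : g n c d = 0 := by
  apply cc_le_lds
  intro c' d' h'
  rw [if_neg]; omega

lemma g_rec (n c d : ℕ) : g (n+1) (c+1) (d+1) =
    g (n+1) (c+2) (d+1) + (g n c d - g n (c+1) d) + g n (c+1) (d+1) := by
  have : g (n+1) (c+1) (d+1) - g (n+1) (c+2) (d+1) =
      (g n c d - g n (c+1) d) + g n (c+1) (d+1) := by
    unfold g
    rw [← E_sub, E_succ, ← E_sub, ← E_add]
    congr 1
    funext c' d'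
    congr 1
    · split_ifs <;> first | rfl | omega
    · rw [sum_congr rfl (g := fun t => if t = c then (if d' = d + 1 then (1:ℤ) else 0) else 0)]
      · rw [sum_ite_eq']
        simp only [mem_range]
        split_ifs <;> first | rfl | omega
      · intro t _
        split_ifs <;> first | rfl | omega
  linarith

lemma g_c0 (n d : ℕ) : g (n+1) 0 d = g (n+1) 1 d := by
  unfold g
  rw [E_succ, E_succ]
  simp

lemma g_zero (c d : ℕ) : g 0 c d = if c = 0 ∧ d = 0 then 1 else 0 := by
  unfold g
  rw [E_zero]
  split_ifs <;> first | rfl | omega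

def h (n c e : ℕ) : ℤ :=
  (n+1).choose (c+e) * (n+1-c).choose e - n.choose (c+e) * (n+2-c).choose e

lemma h_c0 (n : ℕ) (hh : ∀ c e, g (n+1) (c+1) (c+1+e) = h n (c+1) e) (c e : ℕ) :
    g (n+1) c (c+e) = h n c e := by
  rcases c with _ | c
  · rw [g_c0]
    rcases e with _ | e
    · rw [g_zero_of_lt _ _ _ (by omega)]
      simp [h]
    · have := hh 0 e
      rw [show 0 + (e+1) = 0 + 1 + e by ring, this]
      unfold h
      rw [show 0 + 1 + e = e + 1 by ring, show 0 + (e+1) = e + 1 by ring,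
        show n + 1 - (0+1) = n by omega, show n + 2 - (0+1) = n+1 by omega,
        show n + 1 - 0 = n + 1 by omega, show n + 2 - 0 = n+1+1 by omega,
        Nat.choose_succ_succ (n+1) e, Nat.choose_succ_succ n e]
      push_cast
      ring
  · exact hh c e

lemma h_zero (n c e : ℕ) (hc : n + 1 < c + e) : h n c e = 0 := by
  unfold h
  rw [Nat.choose_eq_zero_of_lt hc, Nat.choose_eq_zero_of_lt (show n < c + e by omega)]
  simp

lemma h_rec (n c e : ℕ) : h (n+1) (c+1) (e+1) =
    h (n+1) (c+2) e + (h n c (e+1) - h n (c+1) e) + h n (c+1) (e+1) := by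
  rcases Nat.lt_or_ge n c with hc | hc
  · iterate 5 rw [h_zero _ _ _ (by omega)]
    simp
  · obtain ⟨m, rfl⟩ := Nat.exists_eq_add_of_le hc
    unfold h
    rw [show c + 1 + (e+1) = c + e + 1 + 1 by ring, show c + 2 + e = c + e + 1 + 1 by ring,
      show c + (e+1) = c + e + 1 by ring, show c + 1 + e = c + e + 1 by ring,
      show c + m + 1 + 1 - (c+1) = m + 1 by omega, show c + m + 1 + 2 - (c+1) = m + 1 + 1 by omega,
      show c + m + 1 + 1 - (c+2) = m by omega, show c + m + 1 + 2 - (c+2) = m + 1 by omega,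
      show c + m + 1 - c = m + 1 by omega, show c + m + 2 - c = m + 1 + 1 by omega,
      show c + m + 1 - (c+1) = m by omega,
      Nat.choose_succ_succ (c+m+1) (c+e+1), Nat.choose_succ_succ (c+m) (c+e+1),
      Nat.choose_succ_succ (c+m) (c+e),
      Nat.choose_succ_succ (m+1) e, Nat.choose_succ_succ m e]
    push_cast
    ring

lemma h_rec0 (n c : ℕ) : h (n+1) (c+1) 0 = h n c 0 + h n (c+1) 0 := by
  unfold h
  simp only [add_zero, Nat.choose_zero_right]
  rw [Nat.choose_succ_succ (n+1) c, Nat.choose_succ_succ n c]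
  push_cast
  ring

lemma g_eq_h (n c e : ℕ) : g (n+1) c (c+e) = h n c e := by
  induction n generalizing c e with
  | zero =>
    apply h_c0
    intro c e
    induction e generalizing c with
    | zero =>
      rw [add_zero, g_rec, g_zero_of_lt _ _ _ (by omega), g_zero, g_zero, g_zero]
      rcases c with _ | c
      · simp [h]
      · rw [h_zero _ _ _ (by omega)]; simp
    | succ e ih =>
      rw [show c + 1 + (e+1) = c + 1 + e + 1 by ring, g_rec,
        show c + 1 + e + 1 = c + 1 + 1 + e by ring, ih, g_zero, g_zero, g_zero,
        h_zero _ _ _ (by omega), h_zero _ _ _ (by omega)]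
      simp
  | succ n ih =>
    apply h_c0
    intro c e
    induction e generalizing c with
    | zero =>
      rw [add_zero, g_rec, g_zero_of_lt _ (c+2) _ (by omega), g_zero_of_lt _ (c+1) c (by omega)]
      have h1 := ih c 0
      have h2 := ih (c+1) 0
      rw [add_zero] at h1 h2
      rw [h1, h2, h_rec0]
      ring
    | succ e ih2 =>
      have h0 := ih2 (c+1)
      have h1 := ih c (e+1)
      have h2 := ih (c+1) e
      have h3 := ih (c+1) (e+1)
      rw [h_rec, ← h1, ← h2, ← h3]
      have h4 := g_rec (n+1) c (c+1+e)
      rw [show c + 1 + 1 + e = c + 1 + e + 1 by ring] at h0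
      rw [show c + 1 + (e+1) = c + 1 + e + 1 by ring, show c + (e+1) = c + 1 + e by ring, h4, h0]

lemma total (n d : ℕ) : ((n:ℤ)+1) * g (n+1) 0 (d+1) = (n+1).choose (d+1) * (n+1).choose d := by
  have := g_eq_h n 1 d
  rw [g_c0, add_comm d 1, this]
  unfold h
  rw [add_comm 1 d, show n + 1 - 1 = n by omega, show n + 2 - 1 = n + 1 by omega]
  have e1 : ((n:ℤ)+1) * n.choose d = (n+1).choose (d+1) * (d+1) := by
    exact_mod_cast Nat.add_one_mul_choose_eq n d
  have e2 : ((n:ℤ)+1) * n.choose d = (n+1).choose d * (n+1-d) := by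
    rcases Nat.lt_or_ge (n+1) d with hd | hd
    · rw [Nat.choose_eq_zero_of_lt hd, Nat.choose_eq_zero_of_lt (by omega : n < d)]; simp
    · have := congrArg (Nat.cast : ℕ → ℤ) (Nat.choose_mul_succ_eq n d)
      push_cast [Nat.cast_sub hd] at this
      linarith
  have e3 : ((n+1).choose (d+1) : ℤ) = n.choose d + n.choose (d+1) := by
    exact_mod_cast Nat.choose_succ_succ n d
  have e4 : (n.choose (d+1) : ℤ) = (n+1).choose (d+1) - n.choose d := by linarith
  rw [e4]
  linear_combination (((n+1).choose (d+1) : ℤ)) * e2 + ((n+1).choose d : ℤ) * e1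

lemma av_iff {n : ℕ} (π : Equiv.Perm (Fin n)) : Avoids π pat132 ↔ Av π := by
  unfold Avoids
  rw [not_iff_comm]
  unfold Av
  push Not
  constructor
  · rintro ⟨i, j, k, hij, hjk, h1, h2⟩
    refine ⟨![i, j, k], ?_, ?_⟩
    · intro a b
      fin_cases a <;> fin_cases b <;> simp [hij, hjk, hij.trans hjk]
    · have h1' : π i < π k := h1
      have h2' : π k < π j := h2
      intro a b
      have p0 : pat132 0 = 0 := by decide
      have p1 : pat132 1 = 2 := by decide
      have p2 : pat132 2 = 1 := by decide
      fin_cases a <;> fin_cases b <;>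
        simp [p0, p1, p2, h1', h2', h1'.trans h2', h1'.le, h2'.le, (h1'.trans h2').le]
  · rintro ⟨f, hf, h⟩
    refine ⟨f 0, f 1, f 2, hf 0 1 (by decide), hf 1 2 (by decide), ?_, ?_⟩
    · exact (h 0 2).1 (by decide)
    · exact (h 2 1).1 (by decide)

lemma dec_iff {n : ℕ} (k : ℕ) (π : Equiv.Perm (Fin n)) :
    Avoids π (Fin.revPerm : Equiv.Perm (Fin k)) ↔ lds π < k := by
  unfold Avoids
  rw [not_iff_comm, not_lt]
  constructor
  · intro hk
    obtain ⟨s, hs, e⟩ := exists_lds π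
    obtain ⟨t, hts, ht⟩ := Finset.exists_subset_card_eq (s := s) (n := k) (by omega)
    have hm := (t.orderEmbOfFin ht).strictMono
    have hd : ∀ a b : Fin k, a < b → π (t.orderEmbOfFin ht b) < π (t.orderEmbOfFin ht a) := by
      intro a b hab
      exact hs _ (hts (orderEmbOfFin_mem t ht a)) _ (hts (orderEmbOfFin_mem t ht b)) (hm hab)
    refine ⟨t.orderEmbOfFin ht, fun a b hab => hm hab, ?_⟩
    intro a b
    simp only [Fin.revPerm_apply, Fin.rev_lt_rev]
    constructor
    · exact hd b a
    · intro hlt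
      by_contra hc
      rcases lt_or_eq_of_le (not_lt.1 hc) with h1 | h1
      · exact lt_asymm hlt (hd a b h1)
      · rw [h1] at hlt; exact lt_irrefl _ hlt
  · rintro ⟨f, hf, h⟩
    have hm : StrictMono f := fun a b => hf a b
    have : Dec π (univ.image f) := by
      intro i hi j hj hij
      simp only [mem_image, mem_univ, true_and] at hi hj
      obtain ⟨a, rfl⟩ := hi
      obtain ⟨b, rfl⟩ := hj
      have := hm.lt_iff_lt.1 hij
      exact (h b a).1 (by simpa using this)
    have := le_lds this
    rwa [card_image_of_injective _ hm.injective, card_univ, Fintype.card_fin] at this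

lemma count (n k : ℕ) : ((univ.filter (fun π : Equiv.Perm (Fin n) =>
    Avoids π pat132 ∧ Avoids π (Fin.revPerm : Equiv.Perm (Fin k)))).card : ℤ)
    = ∑ d ∈ range k, g n 0 d := by
  unfold g E
  rw [sum_comm, card_filter]
  push_cast
  apply Fintype.sum_congr
  intro π
  simp only [av_iff, dec_iff]
  by_cases hA : Av π
  · simp [hA]
  · simp [hA]

end S13

/-- The number of permutations of {1,…,n} avoiding both 132 and the decreasing
pattern k(k−1)⋯1 equals (1/n)·Σ_{i=1}^{k−1} C(n,i)·C(n,i−1). -/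
theorem stmt13 (n k : ℕ) (hn : 1 ≤ n) (hk : 3 ≤ k) :
    ((Finset.univ.filter (fun π : Equiv.Perm (Fin n) =>
        Avoids π pat132 ∧ Avoids π (Fin.revPerm : Equiv.Perm (Fin k)))).card : ℚ)
      = (1 / n) * ∑ i ∈ Finset.Icc 1 (k - 1),
          (Nat.choose n i : ℚ) * Nat.choose n (i - 1) := by
  obtain ⟨n, rfl⟩ : ∃ m, n = m + 1 := ⟨n - 1, by omega⟩
  obtain ⟨k, rfl⟩ : ∃ m, k = m + 1 := ⟨k - 1, by omega⟩
  have h1 := S13.count (n+1) (k+1)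
  rw [Finset.sum_range_succ', S13.g_c0, S13.g_zero_of_lt _ 1 0 (by omega), add_zero] at h1
  have h2 := congrArg (Int.cast : ℤ → ℚ) h1
  rw [Int.cast_natCast] at h2
  rw [h2, Int.cast_sum, Nat.add_sub_cancel, ← Finset.Ico_add_one_right_eq_Icc,
    Finset.sum_Ico_eq_sum_range, Finset.mul_sum, Nat.add_sub_cancel]
  apply Finset.sum_congr rfl
  intro d _
  have h3 := congrArg (Int.cast : ℤ → ℚ) (S13.total n d)
  push_cast at h3
  rw [add_comm 1 d, Nat.add_sub_cancel, ← h3]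
  have : (n:ℚ) + 1 ≠ 0 := by positivity
  push_cast
  field_simp
end

section
/- For all n ≥ 1 and k ≥ 3, the number of permutations of {1,…,n} avoiding both the pattern 132 and the increasing pattern 1 2 ⋯ k equals the number of permutations of {1,…,n} avoiding both 132 and the pattern 2 1 3 4 ⋯ k (the permutation of S_k sending 1↦2, 2↦1, and j↦j for j ≥ 3). -/
namespace P14

def C (r : ℕ → ℕ → Prop) (k : ℕ) (l : List ℕ) : Prop :=
  ∃ a b t, List.Sublist (a :: b :: t) l ∧ r a b ∧ t.length + 2 = k ∧
    (a :: t).Pairwise (· < ·) ∧ (b :: t).Pairwise (· < ·)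

def C132 (l : List ℕ) : Prop :=
  ∃ a c b, List.Sublist [a, c, b] l ∧ a < b ∧ b < c

open Classical in
noncomputable def S (r : ℕ → ℕ → Prop) (k m n : ℕ) : Finset (List ℕ) :=
  (List.range' m n).permutations.toFinset.filter (fun l => ¬ C132 l ∧ ¬ C r k l)

theorem mem_S {r k m n l} : l ∈ S r k m n ↔ l.Perm (List.range' m n) ∧ ¬ C132 l ∧ ¬ C r k l := by
  simp [S, List.mem_permutations]

theorem sub_split {s' : List ℕ} {y x : ℕ} {L R : List ℕ}
    (h : List.Sublist (s' ++ [y]) (L ++ x :: R)) : List.Sublist s' L ∨ y ∈ R := by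
  rw [List.sublist_append_iff] at h
  obtain ⟨s1, s2, he, h1, h2⟩ := h
  rcases List.eq_nil_or_concat s2 with rfl | ⟨s2', z, rfl⟩
  · left
    simp at he
    exact (List.sublist_append_left _ _).trans (he ▸ h1)
  · rw [List.concat_eq_append] at he h2
    rw [← List.append_assoc] at he
    obtain ⟨rfl, hz⟩ := List.append_inj' he rfl
    simp at hz
    subst hz
    rcases s2' with _ | ⟨c, u⟩
    · left; simpa using h1
    · right
      have : List.Sublist (u ++ [y]) R := by
        have := h2.tail
        simpa using this
      exact this.subset (by simp)

theorem C_iff {r k L R x} (hk : 2 ≤ k) (hLR : ∀ a ∈ L, ∀ b ∈ R, b < a)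
    (hL : ∀ a ∈ L, a < x) (hR : ∀ a ∈ R, a < x) :
    C r (k+1) (L ++ x :: R) ↔ C r k L ∨ C r (k+1) R := by
  constructor
  · rintro ⟨a, b, t, hs, hr, ht, h1, h2⟩
    rcases List.eq_nil_or_concat t with rfl | ⟨t', y, rfl⟩
    · simp at ht; omega
    · rw [List.concat_eq_append] at hs ht h1 h2
      have hs' : List.Sublist ((a :: b :: t') ++ [y]) (L ++ x :: R) := by simpa using hs
      rcases sub_split hs' with h | h
      · left
        refine ⟨a, b, t', h, hr, by simp at ht; omega, ?_, ?_⟩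
        · exact h1.sublist (by simp)
        · exact h2.sublist (by simp)
      · right
        have hay : a < y := by
          rw [List.pairwise_cons] at h1; exact h1.1 _ (by simp)
        have hx := hR _ h
        refine ⟨a, b, t' ++ [y], ?_, hr, ht, h1, h2⟩
        rw [List.sublist_append_iff] at hs
        obtain ⟨s1, s2, he, g1, g2⟩ := hs
        rcases s1 with _ | ⟨c, u⟩
        · simp at he
          subst he
          rcases g2 with _ | _
          · simpa using ‹_›
          · omega
        · simp at he
          have hc : a ∈ L := g1.subset (by simp [he.1])
          have := hLR _ hc _ h
          omega
  · rintro (⟨a, b, t, hs, hr, ht, h1, h2⟩ | ⟨a, b, t, hs, hr, ht, h1, h2⟩)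
    · refine ⟨a, b, t ++ [x], ?_, hr, by simp; omega, ?_, ?_⟩
      · have : List.Sublist ((a :: b :: t) ++ [x]) (L ++ x :: R) :=
          hs.append (by simp)
        simpa using this
      · have : ((a :: t) ++ [x]).Pairwise (· < ·) := by
          rw [List.pairwise_append]
          refine ⟨h1, by simp, ?_⟩
          intro c hc d hd
          simp at hd; subst hd
          apply hL; apply hs.subset; simp at hc ⊢; tauto
        simpa using this
      · have : ((b :: t) ++ [x]).Pairwise (· < ·) := by
          rw [List.pairwise_append]
          refine ⟨h2, by simp, ?_⟩
          intro c hc d hd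
          simp at hd; subst hd
          apply hL; apply hs.subset; simp at hc ⊢; tauto
        simpa using this
    · exact ⟨a, b, t, hs.trans ((List.sublist_cons_self _ _).trans
        (List.sublist_append_right _ _)), hr, ht, h1, h2⟩

theorem C132_mono {l l'} (h : List.Sublist l l') (hc : C132 l) : C132 l' := by
  obtain ⟨a, c, b, hs, h1⟩ := hc
  exact ⟨a, c, b, hs.trans h, h1⟩

theorem C132_of {L R x} (hLR : ∀ a ∈ L, ∀ b ∈ R, b < a)
    (hL : ∀ a ∈ L, a < x) (hR : ∀ a ∈ R, a < x) (h : C132 (L ++ x :: R)) :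
    C132 L ∨ C132 R := by
  obtain ⟨a, c, b, hs, hab, hbc⟩ := h
  have hs' : List.Sublist ([a, c] ++ [b]) (L ++ x :: R) := by simpa using hs
  have hcx : c ≤ x := by
    have : c ∈ L ++ x :: R := hs.subset (by simp)
    simp at this
    rcases this with h | h | h
    · exact (hL _ h).le
    · exact h.le
    · exact (hR _ h).le
  rw [List.sublist_append_iff] at hs
  obtain ⟨s1, s2, he, g1, g2⟩ := hs
  rcases s1 with _ | ⟨a', u⟩
  · simp at he
    subst he
    right
    rcases g2 with _ | _
    · exact ⟨a, c, b, ‹_›, hab, hbc⟩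
    · omega
  · simp at he
    obtain ⟨rfl, he⟩ := he
    have haL : a ∈ L := g1.subset (by simp)
    rcases List.eq_nil_or_concat s2 with rfl | ⟨s2', z, rfl⟩
    · left
      simp at he; subst he
      exact ⟨a, c, b, g1, hab, hbc⟩
    · have : [c] ++ [b] = (u ++ s2') ++ [z] := by simpa using he
      have hz := (List.append_inj' this rfl).2
      simp at hz
      subst hz
      have : b ∈ x :: R := g2.subset (by simp)
      simp at this
      rcases this with h | h
      · omega
      · have := hLR _ haL _ h; omega

theorem perm_split {L R : List ℕ} {m : ℕ} (hLR : ∀ a ∈ L, ∀ b ∈ R, b < a)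
    (h : (L ++ R).Perm (List.range' m (R.length + L.length))) :
    R.Perm (List.range' m R.length) ∧ L.Perm (List.range' (m + R.length) L.length) := by
  have e : R.insertionSort (· ≤ ·) ++ L.insertionSort (· ≤ ·)
      = List.range' m R.length ++ List.range' (m + R.length) L.length := by
    have h2 : List.range' m R.length ++ List.range' (m + R.length) L.length
      = List.range' m (R.length + L.length) := by simpa using List.range'_append_1 (s := m) (m := R.length) (n := L.length)
    rw [h2]
    apply List.Perm.eq_of_pairwise (le := (· ≤ ·))
    · intros; omega
    · rw [List.pairwise_append]
      refine ⟨List.pairwise_insertionSort _ _, List.pairwise_insertionSort _ _, ?_⟩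
      intro a ha b hb
      rw [List.mem_insertionSort] at ha hb
      exact (hLR _ hb _ ha).le
    · exact (List.pairwise_lt_range' (s := m) (n := R.length + L.length)).imp le_of_lt
    · refine List.Perm.trans ?_ h
      exact ((List.perm_insertionSort _ _).append (List.perm_insertionSort _ _)).trans
        List.perm_append_comm
  obtain ⟨e1, e2⟩ := List.append_inj e (by simp)
  exact ⟨e1 ▸ (List.perm_insertionSort _ _).symm, e2 ▸ (List.perm_insertionSort _ _).symm⟩

theorem range'_top (m n : ℕ) : (List.range' m (n+1)).Perm ((m+n) :: List.range' m n) := by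
  rw [List.range'_1_concat]
  exact List.perm_append_singleton _ _

theorem S_rec {r k m n} (hk : 2 ≤ k) :
    (S r (k+1) m (n+1)).card =
      ∑ p ∈ Finset.HasAntidiagonal.antidiagonal n, (S r k (m + p.2) p.1).card * (S r (k+1) m p.2).card := by
  classical
  have : S r (k+1) m (n+1) = (Finset.HasAntidiagonal.antidiagonal n).biUnion
      (fun p => ((S r k (m + p.2) p.1) ×ˢ (S r (k+1) m p.2)).image
        (fun q => q.1 ++ (m+n) :: q.2)) := by
    ext l
    simp only [Finset.mem_biUnion, Finset.mem_image, Finset.mem_product, mem_S,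
      Finset.HasAntidiagonal.mem_antidiagonal, Prod.exists]
    constructor
    · rintro ⟨hp, h1, h2⟩
      have hm : m + n ∈ l := hp.mem_iff.2 (by simp)
      obtain ⟨L, R, rfl⟩ := List.append_of_mem hm
      have hp' : (L ++ R).Perm (List.range' m n) := by
        have := (List.perm_middle.symm.trans hp).trans (range'_top m n)
        exact (List.perm_cons _).1 this
      have hlt : ∀ a ∈ L ++ R, a < m + n := by
        intro a ha
        have := hp'.mem_iff.1 ha
        simp at this; omega
      have hL : ∀ a ∈ L, a < m + n := fun a ha => hlt a (by simp [ha])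
      have hR : ∀ a ∈ R, a < m + n := fun a ha => hlt a (by simp [ha])
      have hnd : (L ++ R).Nodup := hp'.nodup_iff.2 (List.nodup_range' )
      have hLR : ∀ a ∈ L, ∀ b ∈ R, b < a := by
        intro a ha b hb
        by_contra hlt
        have hne : a ≠ b := fun h => (List.nodup_append.1 hnd).2.2 a ha b hb h
        apply h1
        refine ⟨a, m+n, b, ?_, by omega, hR _ hb⟩
        have : List.Sublist ([a] ++ [m+n, b]) (L ++ (m+n) :: R) :=
          (List.singleton_sublist.2 ha).append ((List.singleton_sublist.2 hb).cons_cons _)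
        simpa using this
      have hlen : R.length + L.length = n := by
        have := hp'.length_eq; simp at this; omega
      obtain ⟨q1, q2⟩ := perm_split hLR (hlen ▸ hp')
      rw [C_iff hk hLR hL hR] at h2
      refine ⟨L.length, R.length, by omega, L, R, ⟨⟨q2, ?_, ?_⟩, q1, ?_, ?_⟩, rfl⟩
      · exact fun h => h1 (C132_mono (List.sublist_append_left _ _) h)
      · tauto
      · exact fun h => h1 (C132_mono ((List.sublist_cons_self _ _).trans
          (List.sublist_append_right _ _)) h)
      · tauto
    · rintro ⟨i, j, hij, L, R, ⟨⟨a1, a2, a3⟩, b1, b2, b3⟩, rfl⟩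
      have hL : ∀ a ∈ L, m + j ≤ a ∧ a < m + n := by
        intro a ha
        have := a1.mem_iff.1 ha
        simp at this; omega
      have hR : ∀ a ∈ R, a < m + j := by
        intro a ha
        have := b1.mem_iff.1 ha
        simp at this; omega
      have hL' : ∀ a ∈ L, a < m + n := fun a ha => (hL a ha).2
      have hR' : ∀ a ∈ R, a < m + n := fun a ha => by have := hR a ha; omega
      have hLR : ∀ a ∈ L, ∀ b ∈ R, b < a := fun a ha b hb => by
        have := hL a ha; have := hR b hb; omega
      refine ⟨?_, ?_, ?_⟩
      · refine List.perm_middle.trans (List.Perm.trans ?_ (range'_top m n).symm)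
        apply List.Perm.cons
        refine (a1.append b1).trans (List.perm_append_comm.trans ?_)
        have := List.range'_append_1 (s := m) (m := j) (n := i)
        rw [this, Nat.add_comm j i, hij]
      · intro h; rcases C132_of hLR hL' hR' h with h | h <;> tauto
      · rw [C_iff hk hLR hL' hR']; tauto
  rw [this, Finset.card_biUnion]
  · apply Finset.sum_congr rfl
    rintro ⟨i, j⟩ hij
    rw [Finset.card_image_of_injOn, Finset.card_product]
    rintro ⟨L, R⟩ h ⟨L', R'⟩ h' he
    simp only [Finset.coe_product, Set.mem_prod, Finset.mem_coe, mem_S] at h h'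
    obtain ⟨e1, e2⟩ := List.append_inj he (by rw [h.1.1.length_eq, h'.1.1.length_eq])
    simp at e2
    have e1 : L = L' := e1
    rw [e1, e2]
  · rintro ⟨i, j⟩ hij ⟨i', j'⟩ hij' hne
    rw [Function.onFun, Finset.disjoint_left]
    intro l hl hl'
    simp only [Finset.mem_image, Finset.mem_product, mem_S, Prod.exists] at hl hl'
    obtain ⟨L, R, ⟨⟨a1, -⟩, b1, -⟩, rfl⟩ := hl
    obtain ⟨L', R', ⟨⟨a1', -⟩, b1', -⟩, he⟩ := hl'
    simp at hij hij'
    have n1 : m + n ∉ L := fun h => by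
      have := a1.mem_iff.1 h; simp at this; omega
    have n2 : m + n ∉ R := fun h => by
      have := b1.mem_iff.1 h; simp at this; omega
    have n1' : m + n ∉ L' := fun h => by
      have := a1'.mem_iff.1 h; simp at this; omega
    have n2' : m + n ∉ R' := fun h => by
      have := b1'.mem_iff.1 h; simp at this; omega
    have hl : L'.length = L.length := by
      have := congrArg (List.idxOf (m+n)) he
      simpa [List.idxOf_append, n1, n1'] using this
    rw [a1.length_eq, a1'.length_eq] at hl
    simp at hl
    apply hne
    ext <;> simp <;> omega

theorem S_zero {r k m} : S r k m 0 = {[]} := by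
  ext l
  rw [mem_S]
  simp only [List.range'_zero, List.perm_nil, Finset.mem_singleton]
  constructor
  · exact fun h => h.1
  · rintro rfl
    refine ⟨rfl, ?_, ?_⟩
    · rintro ⟨a, c, b, h, -⟩; simp at h
    · rintro ⟨a, c, b, h, -⟩; simp at h

theorem notC2 {r : ℕ → ℕ → Prop} {l} : ¬ C r 2 l ↔ l.Pairwise (fun a b => ¬ r a b) := by
  rw [List.pairwise_iff_forall_sublist]
  constructor
  · intro h a b hs hr
    exact h ⟨a, b, [], hs, hr, rfl, by simp, by simp⟩
  · rintro h ⟨a, b, t, hs, hr, ht, -⟩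
    have : t = [] := by simpa using ht
    subst this
    exact h hs hr

theorem S_lt {m n} : S (· < ·) 2 m n = {(List.range' m n).reverse} := by
  ext l
  rw [mem_S, notC2, Finset.mem_singleton]
  constructor
  · rintro ⟨hp, -, h⟩
    apply List.Perm.eq_of_pairwise (le := (· ≥ ·))
    · intros; omega
    · exact h.imp (fun h => by omega)
    · rw [List.pairwise_reverse]
      exact (List.pairwise_lt_range' (s := m) (n := n)).imp le_of_lt
    · exact hp.trans (List.reverse_perm _).symm
  · rintro rfl
    have h : (List.range' m n).reverse.Pairwise (fun a b => ¬ a < b) := by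
      rw [List.pairwise_reverse]
      exact (List.pairwise_lt_range' (s := m) (n := n)).imp (fun h => by omega)
    refine ⟨List.reverse_perm _, ?_, h⟩
    rintro ⟨a, c, b, hs, h1, h2⟩
    have := h.sublist hs
    simp at this
    omega

theorem S_gt {m n} : S (· > ·) 2 m n = {List.range' m n} := by
  ext l
  rw [mem_S, notC2, Finset.mem_singleton]
  constructor
  · rintro ⟨hp, -, h⟩
    apply List.Perm.eq_of_pairwise (le := (· ≤ ·))
    · intros; omega
    · exact h.imp (fun h => by omega)
    · exact (List.pairwise_lt_range' (s := m) (n := n)).imp le_of_lt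
    · exact hp
  · rintro rfl
    have h : (List.range' m n).Pairwise (fun a b => ¬ a > b) :=
      (List.pairwise_lt_range' (s := m) (n := n)).imp (fun h => by omega)
    refine ⟨List.Perm.refl _, ?_, h⟩
    rintro ⟨a, c, b, hs, h1, h2⟩
    have := h.sublist hs
    simp at this
    omega

theorem S_eq (k : ℕ) (hk : 2 ≤ k) : ∀ n m,
    (S (· < ·) k m n).card = (S (· > ·) k m n).card := by
  induction k, hk using Nat.le_induction with
  | base => intro n m; rw [S_lt, S_gt]; simp
  | succ k hk ih =>
    intro n
    induction n using Nat.strong_induction_on with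
    | _ n ih2 =>
      intro m
      rcases n with _ | n
      · rw [S_zero, S_zero]
      · rw [S_rec hk, S_rec hk]
        apply Finset.sum_congr rfl
        rintro ⟨i, j⟩ hij
        simp at hij
        rw [ih, ih2 j (by omega)]

theorem sub_ofFn {n : ℕ} (g : Fin n → ℕ) (s : List ℕ) : List.Sublist s (List.ofFn g) ↔
    ∃ f : Fin s.length → Fin n, StrictMono f ∧ ∀ i, s.get i = g (f i) := by
  rw [List.sublist_iff_exists_fin_orderEmbedding_get_eq]
  constructor
  · rintro ⟨f, hf⟩
    refine ⟨fun i => Fin.cast (by simp) (f i), ?_, ?_⟩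
    · intro a b h
      have := f.strictMono h
      exact this
    · intro i
      rw [hf]; simp; rfl
  · rintro ⟨f, hf, h⟩
    refine ⟨OrderEmbedding.ofStrictMono (fun i => Fin.cast (by simp) (f i)) ?_, ?_⟩
    · intro a b h
      have := hf h
      exact this
    · intro i
      rw [h]; simp; rfl

def toL {n : ℕ} (π : Equiv.Perm (Fin n)) : List ℕ := List.ofFn (fun i => (π i : ℕ))

theorem contains_iff {n k : ℕ} (π : Equiv.Perm (Fin n)) (τ : Equiv.Perm (Fin k)) :
    Contains π τ ↔ ∃ f : Fin k → Fin n, StrictMono f ∧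
      ∀ a b, τ a < τ b → π (f a) < π (f b) := by
  constructor
  · rintro ⟨f, h1, h2⟩
    exact ⟨f, fun a b h => h1 a b h, fun a b => (h2 a b).1⟩
  · rintro ⟨f, h1, h2⟩
    refine ⟨f, fun a b h => h1 h, fun a b => ⟨h2 a b, fun h => ?_⟩⟩
    rcases lt_trichotomy (τ a) (τ b) with h' | h' | h'
    · exact h'
    · rw [τ.injective h'] at h; exact absurd h (lt_irrefl _)
    · exact absurd h (h2 _ _ h').asymm

theorem c132 {n : ℕ} (π : Equiv.Perm (Fin n)) : Contains π pat132 ↔ C132 (toL π) := by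
  rw [contains_iff]
  constructor
  · rintro ⟨f, h1, h2⟩
    refine ⟨π (f 0), π (f 1), π (f 2), ?_, ?_, ?_⟩
    · rw [toL, sub_ofFn]
      refine ⟨f, h1, ?_⟩
      intro i
      fin_cases i <;> rfl
    · exact h2 0 2 (by decide)
    · exact h2 2 1 (by decide)
  · rintro ⟨a, c, b, hs, h1, h2⟩
    rw [toL, sub_ofFn] at hs
    obtain ⟨f, hf, hg⟩ := hs
    have g0 : a = π (f 0) := hg 0
    have g1 : c = π (f 1) := hg 1
    have g2 : b = π (f 2) := hg 2
    refine ⟨f, hf, ?_⟩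
    change ∀ x y : Fin 3, _
    intro x y hxy
    rw [Fin.lt_def]
    fin_cases x <;> fin_cases y <;> first
      | exact absurd hxy (by decide)
      | (show ((π (f _) : Fin n) : ℕ) < ((π (f _) : Fin n) : ℕ)
         simp
         omega)

theorem cgen {n k : ℕ} (r : ℕ → ℕ → Prop) (τ : Equiv.Perm (Fin (k+2)))
    (π : Equiv.Perm (Fin n))
    (hτ : ∀ h : Fin (k+2) → ℕ, (∀ a b, τ a < τ b → h a < h b) ↔
      (r (h 0) (h 1) ∧ (∀ i : Fin k, h 0 < h i.succ.succ) ∧ (∀ i : Fin k, h 1 < h i.succ.succ) ∧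
        ∀ i j : Fin k, i < j → h i.succ.succ < h j.succ.succ)) :
    Contains π τ ↔ C r (k+2) (toL π) := by
  rw [contains_iff]
  constructor
  · rintro ⟨f, h1, h2⟩
    have := (hτ (fun i => (π (f i) : ℕ))).1 h2
    obtain ⟨q1, q2, q3, q4⟩ := this
    refine ⟨π (f 0), π (f 1), List.ofFn (fun i : Fin k => (π (f i.succ.succ) : ℕ)), ?_, q1,
      by simp, ?_, ?_⟩
    · have : ((π (f 0) : ℕ) :: (π (f 1) : ℕ) :: List.ofFn (fun i : Fin k => (π (f i.succ.succ) : ℕ)))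
        = List.ofFn (fun i => (π (f i) : ℕ)) := by
        rw [List.ofFn_succ, List.ofFn_succ]; rfl
      rw [this, toL, sub_ofFn]
      clear this
      refine ⟨fun i => f (Fin.cast (by simp) i), ?_, ?_⟩
      · intro a b h; exact h1 h
      · intro i
        rw [List.get_ofFn]
    · rw [List.pairwise_cons, List.pairwise_ofFn]
      refine ⟨?_, fun i j h => q4 i j h⟩
      intro a ha
      rw [List.mem_ofFn] at ha
      obtain ⟨i, rfl⟩ := ha
      exact q2 i
    · rw [List.pairwise_cons, List.pairwise_ofFn]
      refine ⟨?_, fun i j h => q4 i j h⟩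
      intro a ha
      rw [List.mem_ofFn] at ha
      obtain ⟨i, rfl⟩ := ha
      exact q3 i
  · rintro ⟨a, b, t, hs, hr, ht, h1, h2⟩
    have ht : t.length = k := by omega
    subst ht
    rw [toL, sub_ofFn] at hs
    obtain ⟨f, hf, hg⟩ := hs
    refine ⟨f, hf, ?_⟩
    apply (hτ (fun i => (π (f i) : ℕ))).2
    have g0 : (π (f 0) : ℕ) = a := (hg 0).symm
    have g1 : (π (f 1) : ℕ) = b := (hg 1).symm
    have g2 : ∀ i : Fin t.length, (π (f i.succ.succ) : ℕ) = t.get i := fun i => (hg i.succ.succ).symm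
    rw [List.pairwise_cons] at h1 h2
    refine ⟨?_, ?_, ?_, ?_⟩
    · show r (π (f 0) : ℕ) (π (f 1) : ℕ)
      rw [g0, g1]; exact hr
    · intro i
      show (π (f 0) : ℕ) < (π (f i.succ.succ) : ℕ)
      rw [g0, g2]; exact h1.1 _ (List.get_mem _ _)
    · intro i
      show (π (f 1) : ℕ) < (π (f i.succ.succ) : ℕ)
      rw [g1, g2]; exact h2.1 _ (List.get_mem _ _)
    · intro i j hij
      show (π (f i.succ.succ) : ℕ) < (π (f j.succ.succ) : ℕ)
      rw [g2, g2]; exact List.pairwise_iff_get.1 h1.2 i j hij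

theorem cone {n k : ℕ} (π : Equiv.Perm (Fin n)) :
    Contains π (1 : Equiv.Perm (Fin (k+2))) ↔ C (· < ·) (k+2) (toL π) := by
  apply cgen
  intro h
  constructor
  · intro H
    refine ⟨H 0 1 ?_, fun i => H _ _ ?_, fun i => H _ _ ?_, fun i j hij => H _ _ ?_⟩
    · exact Fin.lt_def.2 (by simp [-Fin.val_fin_lt])
    · exact Fin.lt_def.2 (by simp [-Fin.val_fin_lt])
    · exact Fin.lt_def.2 (by simp [-Fin.val_fin_lt])
    · exact Fin.succ_lt_succ_iff.2 (Fin.succ_lt_succ_iff.2 hij)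
  · rintro ⟨q1, q2, q3, q4⟩ a b hab
    have hab : a < b := hab
    induction a using Fin.cases with
    | zero =>
      induction b using Fin.cases with
      | zero => exact absurd hab (lt_irrefl _)
      | succ b =>
        induction b using Fin.cases with
        | zero => exact q1
        | succ b => exact q2 b
    | succ a =>
      induction b using Fin.cases with
      | zero => simp [Fin.lt_def, -Fin.val_fin_lt] at hab
      | succ b =>
        induction a using Fin.cases with
        | zero =>
          induction b using Fin.cases with
          | zero => exact absurd hab (lt_irrefl _)
          | succ b => exact q3 b
        | succ a =>
          induction b using Fin.cases with
          | zero => simp [Fin.lt_def, -Fin.val_fin_lt] at hab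
          | succ b => exact q4 a b (Fin.succ_lt_succ_iff.1 (Fin.succ_lt_succ_iff.1 hab))

theorem cswap {n k : ℕ} (π : Equiv.Perm (Fin n)) :
    Contains π (Equiv.swap (0 : Fin (k+2)) 1) ↔ C (· > ·) (k+2) (toL π) := by
  apply cgen
  intro h
  have s0 : Equiv.swap (0 : Fin (k+2)) 1 0 = 1 := Equiv.swap_apply_left _ _
  have s1 : Equiv.swap (0 : Fin (k+2)) 1 1 = 0 := Equiv.swap_apply_right _ _
  have s2 : ∀ i : Fin k, Equiv.swap (0 : Fin (k+2)) 1 i.succ.succ = i.succ.succ := fun i =>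
    Equiv.swap_apply_of_ne_of_ne (by simp [Fin.ext_iff]) (by simp [Fin.ext_iff])
  constructor
  · intro H
    refine ⟨H 1 0 ?_, fun i => H _ _ ?_, fun i => H _ _ ?_, fun i j hij => H _ _ ?_⟩ <;> simp only [s0, s1, s2]
    · exact Fin.lt_def.2 (by simp [-Fin.val_fin_lt])
    · exact Fin.lt_def.2 (by simp [-Fin.val_fin_lt])
    · exact Fin.lt_def.2 (by simp [-Fin.val_fin_lt])
    · exact Fin.succ_lt_succ_iff.2 (Fin.succ_lt_succ_iff.2 hij)
  · rintro ⟨q1, q2, q3, q4⟩ a b hab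
    induction a using Fin.cases with
    | zero =>
      rw [s0] at hab
      induction b using Fin.cases with
      | zero => rw [s0] at hab; exact absurd hab (lt_irrefl _)
      | succ b =>
        induction b using Fin.cases with
        | zero =>
          have hab : (1 : Fin (k+2)) < Equiv.swap (0 : Fin (k+2)) 1 1 := hab
          rw [s1] at hab; simp [Fin.lt_def, -Fin.val_fin_lt] at hab
        | succ b => exact q2 b
    | succ a =>
      induction a using Fin.cases with
      | zero =>
        induction b using Fin.cases with
        | zero => exact q1
        | succ b =>
          induction b using Fin.cases with
          | zero => exact absurd hab (lt_irrefl _)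
          | succ b => exact q3 b
      | succ a =>
        rw [s2] at hab
        induction b using Fin.cases with
        | zero => rw [s0] at hab; simp [Fin.lt_def, -Fin.val_fin_lt] at hab
        | succ b =>
          induction b using Fin.cases with
          | zero =>
            have hab : a.succ.succ < Equiv.swap (0 : Fin (k+2)) 1 1 := hab
            rw [s1] at hab; simp [Fin.lt_def, -Fin.val_fin_lt] at hab
          | succ b => rw [s2] at hab; exact q4 a b (Fin.succ_lt_succ_iff.1 (Fin.succ_lt_succ_iff.1 hab))

theorem toL_inj {n : ℕ} : Function.Injective (toL (n := n)) := by
  intro π σ h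
  have := List.ofFn_injective h
  ext i
  exact congrFun this i

theorem toL_perm {n : ℕ} (π : Equiv.Perm (Fin n)) : (toL π).Perm (List.range' 0 n) := by
  rw [List.perm_ext_iff_of_nodup]
  · intro a
    rw [toL, List.mem_ofFn]
    simp
    constructor
    · rintro ⟨i, rfl⟩; exact (π i).2
    · intro h; exact ⟨π.symm ⟨a, h⟩, by simp⟩
  · rw [toL, List.nodup_ofFn]
    intro a b h
    exact π.injective (Fin.ext h)
  · exact List.nodup_range'

theorem toL_surj {n : ℕ} (l : List ℕ) (h : l.Perm (List.range' 0 n)) :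
    ∃ π : Equiv.Perm (Fin n), toL π = l := by
  have hl : l.length = n := by simpa using h.length_eq
  have hnd : l.Nodup := h.nodup_iff.2 List.nodup_range'
  subst hl
  have hlt : ∀ i, l.get i < l.length := fun i => by
    have := h.mem_iff.1 (List.get_mem l i)
    simpa using this
  let g : Fin l.length → Fin l.length := fun i => ⟨l.get i, hlt i⟩
  have hg : Function.Injective g := by
    intro a b hab
    exact List.nodup_iff_injective_get.1 hnd (congrArg Fin.val hab)
  refine ⟨Equiv.ofBijective g (Finite.injective_iff_bijective.1 hg), ?_⟩
  show List.ofFn (fun i => l.get i) = l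
  exact List.ofFn_get l

theorem card_eq {n k : ℕ} (r : ℕ → ℕ → Prop) (τ : Equiv.Perm (Fin k))
    (hτ : ∀ π : Equiv.Perm (Fin n), Contains π τ ↔ C r k (toL π)) :
    (Finset.univ.filter (fun π : Equiv.Perm (Fin n) =>
        Avoids π pat132 ∧ Avoids π τ)).card = (S r k 0 n).card := by
  apply Finset.card_bij (fun π _ => toL π)
  · intro π h
    rw [Finset.mem_filter, Avoids, Avoids, c132, hτ] at h
    rw [mem_S]
    exact ⟨toL_perm π, h.2⟩
  · intro a _ b _ h
    exact toL_inj h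
  · intro l hl
    rw [mem_S] at hl
    obtain ⟨π, rfl⟩ := toL_surj l hl.1
    refine ⟨π, ?_, rfl⟩
    rw [Finset.mem_filter, Avoids, Avoids, c132, hτ]
    exact ⟨Finset.mem_univ _, hl.2⟩

end P14

/-- |S_n(132, 12⋯k)| = |S_n(132, 213⋯k)| for all n ≥ 1 and k ≥ 3, where
213⋯k ∈ S_k swaps the first two values and fixes the rest. -/
theorem stmt14 (n k : ℕ) (hn : 1 ≤ n) (hk : 3 ≤ k) :
    (Finset.univ.filter (fun π : Equiv.Perm (Fin n) =>
        Avoids π pat132 ∧ Avoids π (1 : Equiv.Perm (Fin k)))).card =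
    (Finset.univ.filter (fun π : Equiv.Perm (Fin n) =>
        Avoids π pat132 ∧
        Avoids π (Equiv.swap (⟨0, by omega⟩ : Fin k) ⟨1, by omega⟩))).card := by
  obtain ⟨k, rfl⟩ : ∃ k', k = k' + 2 := ⟨k - 2, by omega⟩
  rw [P14.card_eq (· < ·) _ (fun π => P14.cone π), P14.S_eq _ (by omega)]
  exact (P14.card_eq (· > ·) _ (fun π => P14.cswap π)).symm
end

section
/- For all n ≥ 1 and k ≥ 3: |S_n(132, 12⋯k)| = |S_n(132, 23⋯k1)| = |S_n(132, k12⋯(k−1))|, where 23⋯k1 is the permutation of S_k sending i↦i+1 for i < k and k↦1, and k12⋯(k−1) is the permutation of S_k sending 1↦k and i↦i−1 for i ≥ 2. -/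
inductive BT15 : Type
  | nil : BT15
  | node : BT15 → BT15 → BT15

namespace BT15

def nodes : BT15 → ℕ
  | nil => 0
  | node L R => nodes L + nodes R + 1

def lst : BT15 → ℕ → List ℕ
  | nil, _ => []
  | node L R, m => lst L (m + nodes R) ++ (m + nodes L + nodes R) :: lst R m

def phi : BT15 → BT15
  | nil => nil
  | node L R => node (phi R) L

def psi : BT15 → BT15
  | nil => nil
  | node L R => node R (psi L)

theorem psi_phi (T : BT15) : psi (phi T) = T := by
  induction T with
  | nil => rfl
  | node L R _ ih => simp [phi, psi, ih]

theorem phi_psi (T : BT15) : phi (psi T) = T := by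
  induction T with
  | nil => rfl
  | node L R ih _ => simp [phi, psi, ih]

theorem nodes_phi (T : BT15) : nodes (phi T) = nodes T := by
  induction T with
  | nil => rfl
  | node L R _ ih => simp [phi, nodes, ih]; omega

theorem mem_lst (T : BT15) : ∀ m x, x ∈ lst T m ↔ m ≤ x ∧ x < m + nodes T := by
  induction T with
  | nil => intro m x; simp [lst, nodes]
  | node L R ihL ihR =>
    intro m x
    simp only [lst, nodes, List.mem_append, List.mem_cons, ihL, ihR]
    omega

theorem length_lst (T : BT15) : ∀ m, (lst T m).length = nodes T := by
  induction T with
  | nil => intro m; simp [lst, nodes]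
  | node L R ihL ihR =>
    intro m
    simp only [lst, nodes, List.length_append, List.length_cons, ihL, ihR]
    omega

theorem nodup_lst (T : BT15) : ∀ m, (lst T m).Nodup := by
  induction T with
  | nil => intro m; simp [lst]
  | node L R ihL ihR =>
    intro m
    simp only [lst, List.nodup_append, List.nodup_cons, ihL, ihR, mem_lst, List.mem_cons]
    refine ⟨trivial, ⟨by omega, trivial⟩, ?_⟩
    rintro a ha b (hb | hb) <;> omega

theorem lst_inj (T : BT15) : ∀ (U : BT15) m, lst T m = lst U m → T = U := by
  induction T with
  | nil =>
    intro U m h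
    cases U with
    | nil => rfl
    | node L R => simp [lst] at h
  | node L R ihL ihR =>
    intro U m h
    cases U with
    | nil => simp [lst] at h
    | node L' R' =>
      have hlen : nodes (node L R) = nodes (node L' R') := by
        rw [← length_lst _ m, h, length_lst]
      simp only [nodes] at hlen
      simp only [lst] at h
      have e : m + nodes L + nodes R = m + nodes L' + nodes R' := by omega
      rw [e] at h
      have h1 : (m + nodes L' + nodes R') ∉ lst L (m + nodes R) := by
        rw [mem_lst]; omega
      have h2 : (m + nodes L' + nodes R') ∉ lst L' (m + nodes R') := by
        rw [mem_lst]; omega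
      have h3 : (m + nodes L' + nodes R') ∉ lst R m := by
        rw [mem_lst]; omega
      have h4 : (m + nodes L' + nodes R') ∉ lst R' m := by
        rw [mem_lst]; omega
      obtain ⟨e1, -, e3⟩ := (List.append_cons_inj_of_notMem h1 h3).1 h
      have hR := ihR _ _ e3
      subst hR
      rw [ihL _ _ e1]

end BT15

open BT15

def C132 (l : List ℕ) : Prop := ∃ a b c, [a, c, b].Sublist l ∧ a < b ∧ b < c
def CInc (k : ℕ) (l : List ℕ) : Prop :=
  ∃ s : List ℕ, s.Sublist l ∧ s.length = k ∧ s.Pairwise (· < ·)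
def CRot (k : ℕ) (l : List ℕ) : Prop :=
  ∃ a, ∃ s : List ℕ, (a :: s).Sublist l ∧ s.length = k ∧ s.Pairwise (· < ·) ∧ ∀ x ∈ s, x < a

theorem C132_step (L R : List ℕ) (M : ℕ) (hL : ∀ x ∈ L, x < M) (hR : ∀ x ∈ R, x < M)
    (hLR : ∀ x ∈ L, ∀ y ∈ R, y < x) (h : C132 (L ++ M :: R)) : C132 L ∨ C132 R := by
  obtain ⟨a, b, c, hs, hab, hbc⟩ := h
  obtain ⟨s1, s2, e, h1, h2⟩ := List.sublist_append_iff.1 hs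
  have m1 := h1.subset
  have m2 := h2.subset
  match s1, e, h1, m1 with
  | [], e, h1, m1 =>
    simp only [List.nil_append] at e
    subst e
    rcases List.sublist_cons_iff.1 h2 with h | ⟨r, e, h⟩
    · exact Or.inr ⟨a, b, c, h, hab, hbc⟩
    · simp only [List.cons.injEq] at e
      obtain ⟨rfl, rfl⟩ := e
      have := hR c (h.subset (by simp))
      omega
  | [x], e, h1, m1 =>
    simp only [List.cons_append, List.nil_append, List.cons.injEq] at e
    obtain ⟨rfl, rfl⟩ := e
    have ha := m1 (List.mem_cons_self)
    have hb : b ∈ M :: R := m2 (by simp)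
    have hc : c ∈ M :: R := m2 (by simp)
    have := hL _ ha
    rcases List.mem_cons.1 hb with hb | hb
    · rcases List.mem_cons.1 hc with hc | hc
      · omega
      · have := hR _ hc; omega
    · have := hLR _ ha _ hb; omega
  | [x, y], e, h1, m1 =>
    simp only [List.cons_append, List.nil_append, List.cons.injEq] at e
    obtain ⟨rfl, rfl, rfl⟩ := e
    have ha : a ∈ L := m1 (by simp)
    have hc : c ∈ L := m1 (by simp)
    have hb : b ∈ M :: R := m2 (by simp)
    rcases List.mem_cons.1 hb with hb | hb
    · have := hL _ hc; omega
    · have := hLR _ ha _ hb; omega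
  | x :: y :: z :: t, e, h1, m1 =>
    simp only [List.cons_append, List.cons.injEq] at e
    obtain ⟨rfl, rfl, rfl, e⟩ := e
    have : t = [] := by
      have := congrArg List.length e
      simp only [List.length_nil, List.length_append] at this
      exact List.eq_nil_of_length_eq_zero (by omega)
    subst this
    exact Or.inl ⟨a, b, c, h1, hab, hbc⟩

theorem CInc_step (k : ℕ) (L R : List ℕ) (M : ℕ) (hL : ∀ x ∈ L, x < M) (hR : ∀ x ∈ R, x < M)
    (hLR : ∀ x ∈ L, ∀ y ∈ R, y < x) :
    CInc (k+1) (L ++ M :: R) ↔ CInc k L ∨ CInc (k+1) R := by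
  constructor
  · rintro ⟨s, hs, hlen, hp⟩
    obtain ⟨s1, s2, rfl, h1, h2⟩ := List.sublist_append_iff.1 hs
    rw [List.pairwise_append] at hp
    obtain ⟨p1, p2, p3⟩ := hp
    rw [List.length_append] at hlen
    have key : ∀ y ∈ R, y ∈ s2 → s1 = [] := by
      intro y hy hy2
      cases s1 with
      | nil => rfl
      | cons x t =>
        have := p3 x (by simp) y hy2
        have := hLR x (h1.subset (by simp)) y hy
        omega
    rcases List.sublist_cons_iff.1 h2 with h | ⟨r, rfl, h⟩
    · cases s2 with
      | nil =>
        left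
        exact ⟨s1.tail, (List.tail_sublist _).trans h1, by simp at hlen ⊢; omega, p1.tail⟩
      | cons y t =>
        right
        have := key y (h.subset (by simp)) (by simp)
        subst this
        exact ⟨_, h, by simpa using hlen, p2⟩
    · cases r with
      | nil => left; exact ⟨s1, h1, by simpa using hlen, p1⟩
      | cons y t =>
        have h5 := hR y (h.subset (by simp))
        have h6 := (List.pairwise_cons.1 p2).1 y (by simp)
        omega
  · rintro (⟨s, hs, hlen, hp⟩ | ⟨s, hs, hlen, hp⟩)
    · refine ⟨s ++ [M], hs.append (by simp), by simp [hlen], ?_⟩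
      rw [List.pairwise_append]
      refine ⟨hp, by simp, ?_⟩
      intro a ha b hb
      rw [List.mem_singleton] at hb
      subst hb
      exact hL a (hs.subset ha)
    · exact ⟨s, (hs.trans (List.sublist_cons_self _ _)).trans (List.sublist_append_right _ _), hlen, hp⟩

theorem CRot_step (k : ℕ) (hk : 1 ≤ k) (L R : List ℕ) (M : ℕ) (hL : ∀ x ∈ L, x < M)
    (hR : ∀ x ∈ R, x < M)
    (hLR : ∀ x ∈ L, ∀ y ∈ R, y < x) :
    CRot k (L ++ M :: R) ↔ CRot k L ∨ CInc k R := by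
  constructor
  · rintro ⟨a, s, hs, hlen, hp, ha⟩
    obtain ⟨s1, s2, e, h1, h2⟩ := List.sublist_append_iff.1 hs
    cases s1 with
    | nil =>
      simp only [List.nil_append] at e
      subst e
      right
      rcases List.sublist_cons_iff.1 h2 with h | ⟨r, e, h⟩
      · exact ⟨s, (List.sublist_cons_self _ _).trans h, hlen, hp⟩
      · simp only [List.cons.injEq] at e
        obtain ⟨rfl, rfl⟩ := e
        exact ⟨s, h, hlen, hp⟩
    | cons x t =>
      simp only [List.cons_append, List.cons.injEq] at e
      obtain ⟨rfl, rfl⟩ := e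
      have haL := hL a (h1.subset (by simp))
      have h3 : s2.Sublist R := by
        rcases List.sublist_cons_iff.1 h2 with h | ⟨r, rfl, h⟩
        · exact h
        · have := ha M (by simp)
          omega
      rw [List.pairwise_append] at hp
      obtain ⟨p1, p2, p3⟩ := hp
      cases t with
      | nil => right; exact ⟨s2, h3, by simpa using hlen, p2⟩
      | cons x t =>
        cases s2 with
        | nil => left; exact ⟨a, x :: t, h1, by simpa using hlen, p1, by simpa using ha⟩
        | cons y u =>
          have := p3 x (by simp) y (by simp)
          have := hLR x (h1.subset (by simp)) y (h3.subset (by simp))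
          omega
  · rintro (⟨a, s, hs, hlen, hp, ha⟩ | ⟨s, hs, hlen, hp⟩)
    · exact ⟨a, s, hs.trans (List.sublist_append_left _ _), hlen, hp, ha⟩
    · exact ⟨M, s, (hs.cons_cons M).trans (List.sublist_append_right _ _), hlen, hp,
        fun x hx => hR x (hs.subset hx)⟩

theorem not_C132_lst (T : BT15) : ∀ m, ¬ C132 (lst T m) := by
  induction T with
  | nil => rintro m ⟨a, b, c, h, -⟩; simp [lst] at h
  | node L R ihL ihR =>
    intro m h
    have := C132_step _ _ _ (fun x hx => by rw [mem_lst] at hx; omega)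
      (fun x hx => by rw [mem_lst] at hx; omega)
      (fun x hx y hy => by rw [mem_lst] at hx hy; omega) h
    rcases this with h | h
    · exact ihL _ h
    · exact ihR _ h

theorem CInc_node (k : ℕ) (L R : BT15) (m : ℕ) : CInc (k+1) (lst (node L R) m) ↔
    CInc k (lst L (m + nodes R)) ∨ CInc (k+1) (lst R m) := by
  apply CInc_step
  · intro x hx; rw [mem_lst] at hx; omega
  · intro x hx; rw [mem_lst] at hx; omega
  · intro x hx y hy; rw [mem_lst] at hx hy; omega

theorem CRot_node (k : ℕ) (hk : 1 ≤ k) (L R : BT15) (m : ℕ) : CRot k (lst (node L R) m) ↔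
    CRot k (lst L (m + nodes R)) ∨ CInc k (lst R m) := by
  apply CRot_step k hk
  · intro x hx; rw [mem_lst] at hx; omega
  · intro x hx; rw [mem_lst] at hx; omega
  · intro x hx y hy; rw [mem_lst] at hx hy; omega

theorem CInc_shift (T : BT15) : ∀ k m m', CInc k (lst T m) ↔ CInc k (lst T m') := by
  induction T with
  | nil => intro k m m'; rfl
  | node L R ihL ihR =>
    intro k m m'
    cases k with
    | zero => exact ⟨fun _ => ⟨[], by simp, rfl, by simp⟩, fun _ => ⟨[], by simp, rfl, by simp⟩⟩
    | succ k => rw [CInc_node, CInc_node, ihL _ _ (m' + nodes R), ihR _ m m']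

theorem CInc_phi (k : ℕ) (hk : 1 ≤ k) (T : BT15) :
    ∀ m m', CInc (k+1) (lst T m) ↔ CRot k (lst (phi T) m') := by
  induction T with
  | nil =>
    intro m m'
    constructor
    · rintro ⟨s, hs, hl, -⟩
      have : s = [] := by simpa [lst] using hs
      simp [this] at hl
    · rintro ⟨a, s, hs, -⟩
      simp [lst, phi] at hs
  | node L R ihL ihR =>
    intro m m'
    rw [phi, CInc_node, CRot_node k hk, ← ihR m, CInc_shift L k m' (m + nodes R)]
    tauto

theorem exists_lst (n : ℕ) : ∀ (m : ℕ) (l : List ℕ), l.Nodup →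
    (∀ x, x ∈ l ↔ m ≤ x ∧ x < m + n) → ¬ C132 l → ∃ T, nodes T = n ∧ lst T m = l := by
  induction n using Nat.strong_induction_on with
  | _ n ih =>
  intro m l hnd hmem hc
  cases n with
  | zero =>
    refine ⟨nil, rfl, ?_⟩
    rw [lst, eq_comm, List.eq_nil_iff_forall_not_mem]
    intro x hx
    have := (hmem x).1 hx
    omega
  | succ n =>
    obtain ⟨L, R, rfl⟩ := List.append_of_mem ((hmem (m+n)).2 (by omega))
    have hnd' := hnd
    rw [List.nodup_append, List.nodup_cons] at hnd
    obtain ⟨dL, ⟨dR, dR'⟩, dLR⟩ := hnd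
    have mL : ∀ x ∈ L, m ≤ x ∧ x < m + n := by
      intro x hx
      have := (hmem x).1 (by simp [hx])
      have := dLR x hx (m+n) (by simp)
      omega
    have mR : ∀ x ∈ R, m ≤ x ∧ x < m + n := by
      intro x hx
      have := (hmem x).1 (by simp [hx])
      have : x ≠ m + n := by rintro rfl; exact dR hx
      omega
    have mLR : ∀ x, m ≤ x → x < m + n → x ∈ L ∨ x ∈ R := by
      intro x h1 h2
      have := (hmem x).2 (by omega)
      simp only [List.mem_append, List.mem_cons] at this
      rcases this with h | h | h
      · exact Or.inl h
      · omega
      · exact Or.inr h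
    have hlt : ∀ x ∈ L, ∀ y ∈ R, y < x := by
      intro x hx y hy
      by_contra hh
      have := dLR x hx y (by simp [hy])
      refine hc ⟨x, y, m+n, ?_, by omega, (mR y hy).2⟩
      exact (List.singleton_sublist.2 hx).append ((List.singleton_sublist.2 hy).cons_cons _)
    have cR : R.toFinset.card = R.length := List.toFinset_card_of_nodup dR'
    have sub : R.toFinset ⊆ Finset.Ico m (m + R.length) := by
      intro x hx
      rw [List.mem_toFinset] at hx
      have : Finset.Ico m (x+1) ⊆ R.toFinset := by
        intro y hy
        rw [Finset.mem_Ico] at hy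
        rw [List.mem_toFinset]
        have := mR x hx
        rcases mLR y hy.1 (by omega) with h | h
        · have := hlt y h x hx; omega
        · exact h
      have := Finset.card_le_card this
      rw [Nat.card_Ico, cR] at this
      have := mR x hx
      rw [Finset.mem_Ico]
      omega
    have eR := Finset.eq_of_subset_of_card_le sub (by rw [Nat.card_Ico, cR]; omega)
    have memR : ∀ x, x ∈ R ↔ m ≤ x ∧ x < m + R.length := by
      intro x
      rw [← List.mem_toFinset, eR, Finset.mem_Ico]
    have hRn : R.length ≤ n := by
      by_contra hh
      have := mR (m+n) ((memR _).2 (by omega))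
      omega
    have memL : ∀ x, x ∈ L ↔ m + R.length ≤ x ∧ x < (m + R.length) + (n - R.length) := by
      intro x
      constructor
      · intro hx
        have h1 := mL x hx
        have h2 : ¬ x ∈ R := fun h => dLR x hx x (by simp [h]) rfl
        rw [memR] at h2
        omega
      · intro hx
        rcases mLR x (by omega) (by omega) with h | h
        · exact h
        · rw [memR] at h; omega
    obtain ⟨U, hU, hU'⟩ := ih _ (by omega) _ R dR' memR (by
      rintro ⟨a, b, c, h, h'⟩
      exact hc ⟨a, b, c, (h.trans (List.sublist_cons_self _ _)).trans
        (List.sublist_append_right _ _), h'⟩)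
    obtain ⟨T, hT, hT'⟩ := ih (n - R.length) (by omega) _ L dL memL (by
      rintro ⟨a, b, c, h, h'⟩
      exact hc ⟨a, b, c, h.trans (List.sublist_append_left _ _), h'⟩)
    refine ⟨node T U, by simp only [nodes]; omega, ?_⟩
    simp only [lst]
    rw [hU, hU', hT', hT]
    congr 2
    omega

/-- The word of a permutation. -/
def wd {n : ℕ} (π : Equiv.Perm (Fin n)) : List ℕ := List.ofFn (fun i => (π i : ℕ))

theorem sub_wd {n k : ℕ} (π : Equiv.Perm (Fin n)) (g : Fin k → ℕ) :
    (List.ofFn g).Sublist (wd π) ↔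
      ∃ f : Fin k → Fin n, (∀ a b : Fin k, a < b → f a < f b) ∧ ∀ a, g a = (π (f a) : ℕ) := by
  rw [List.sublist_iff_exists_fin_orderEmbedding_get_eq]
  constructor
  · rintro ⟨f, hf⟩
    refine ⟨fun a => Fin.cast (by simp [wd]) (f (Fin.cast (by simp) a)), ?_, ?_⟩
    · intro a b h
      have : f (Fin.cast (by simp) a) < f (Fin.cast (by simp) b) := f.lt_iff_lt.2 h
      exact this
    · intro a
      have := hf (Fin.cast (by simp) a)
      simp only [wd, List.get_ofFn] at this
      exact this
  · rintro ⟨f, hf, hg⟩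
    refine ⟨OrderEmbedding.ofStrictMono
      (fun a => Fin.cast (by simp [wd]) (f (Fin.cast (by simp) a))) ?_, ?_⟩
    · intro a b h
      exact hf _ _ h
    · intro a
      simp only [wd, List.get_ofFn]
      exact hg _

theorem contains132 {n : ℕ} (π : Equiv.Perm (Fin n)) : Contains π pat132 ↔ C132 (wd π) := by
  constructor
  · rintro ⟨f, hf, h⟩
    refine ⟨π (f 0), π (f 2), π (f 1), ?_, ?_, ?_⟩
    · have := (sub_wd π (fun a => (π (f a) : ℕ))).2 ⟨f, hf, fun _ => rfl⟩
      simpa [List.ofFn_succ] using this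
    · exact (h 0 2).1 (by decide)
    · exact (h 2 1).1 (by decide)
  · rintro ⟨a, b, c, hs, hab, hbc⟩
    obtain ⟨f, hf, hg⟩ := (sub_wd π ![a, c, b]).1 (by simpa [List.ofFn_succ] using hs)
    refine ⟨f, hf, ?_⟩
    have h0 : a = π (f 0) := hg 0
    have h1 : c = π (f 1) := hg 1
    have h2 : b = π (f 2) := hg 2
    intro x y
    rw [Fin.lt_def (a := π (f x))]
    have t : ∀ p q : Prop, p → q → (p ↔ q) := fun p q hp hq => ⟨fun _ => hq, fun _ => hp⟩
    have t' : ∀ p q : Prop, ¬ p → ¬ q → (p ↔ q) := fun p q hp hq =>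
      ⟨fun h => absurd h hp, fun h => absurd h hq⟩
    fin_cases x <;> fin_cases y <;>
      first
      | exact t _ _ (by decide) (by simp [← h0, ← h1, ← h2]; omega)
      | exact t' _ _ (by decide) (by simp [← h0, ← h1, ← h2]; try omega)
      | exact t' _ _ (by decide) (by simp)

theorem containsInc {n k : ℕ} (π : Equiv.Perm (Fin n)) :
    Contains π (1 : Equiv.Perm (Fin k)) ↔ CInc k (wd π) := by
  constructor
  · rintro ⟨f, hf, h⟩
    refine ⟨_, (sub_wd π (fun a => (π (f a) : ℕ))).2 ⟨f, hf, fun _ => rfl⟩, by simp, ?_⟩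
    rw [List.pairwise_ofFn]
    intro i j hij
    exact (h i j).1 hij
  · rintro ⟨s, hs, rfl, hp⟩
    rw [← List.ofFn_get s] at hs
    obtain ⟨f, hf, hg⟩ := (sub_wd π _).1 hs
    refine ⟨f, hf, ?_⟩
    have hm : StrictMono (fun a => π (f a)) := by
      intro a b hab
      show π (f a) < π (f b)
      rw [Fin.lt_def, ← hg, ← hg]
      exact List.pairwise_iff_get.1 hp a b hab
    intro a b
    exact (hm.lt_iff_lt (a := a) (b := b)).symm

theorem rot_inv_zero (k : ℕ) : (finRotate (k+1))⁻¹ 0 = Fin.last k := by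
  rw [Equiv.Perm.inv_eq_iff_eq]; simp

theorem rot_inv_succ (k : ℕ) (i : Fin k) : (finRotate (k+1))⁻¹ i.succ = i.castSucc := by
  rw [Equiv.Perm.inv_eq_iff_eq]; simp

theorem containsRot {n k : ℕ} (π : Equiv.Perm (Fin n)) :
    Contains π (finRotate (k+1))⁻¹ ↔ CRot k (wd π) := by
  constructor
  · rintro ⟨f, hf, h⟩
    refine ⟨π (f 0), List.ofFn (fun a : Fin k => (π (f a.succ) : ℕ)), ?_, by simp, ?_, ?_⟩
    · have := (sub_wd π (fun a => (π (f a) : ℕ))).2 ⟨f, hf, fun _ => rfl⟩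
      simpa [List.ofFn_succ] using this
    · rw [List.pairwise_ofFn]
      intro i j hij
      refine (h i.succ j.succ).1 ?_
      rw [rot_inv_succ, rot_inv_succ]
      exact hij
    · intro x hx
      rw [List.mem_ofFn] at hx
      obtain ⟨i, rfl⟩ := hx
      refine (h i.succ 0).1 ?_
      rw [rot_inv_succ, rot_inv_zero]
      exact Fin.castSucc_lt_last i
  · rintro ⟨a, s, hs, rfl, hp, ha⟩
    obtain ⟨f, hf, hg⟩ := (sub_wd π (Fin.cons a s.get)).1 (by
      rw [List.ofFn_succ]; simpa using hs)
    refine ⟨f, hf, ?_⟩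
    have hm : StrictMono (fun i : Fin (s.length) => π (f i.succ)) := by
      intro i j hij
      show π (f i.succ) < π (f j.succ)
      rw [Fin.lt_def, ← hg, ← hg]
      exact List.pairwise_iff_get.1 hp i j hij
    have hz : ∀ i : Fin s.length, π (f i.succ) < π (f 0) := by
      intro i
      rw [Fin.lt_def, ← hg, ← hg]
      exact ha _ (List.get_mem s i)
    intro x y
    induction x using Fin.cases with
    | zero =>
      induction y using Fin.cases with
      | zero => simp
      | succ j =>
        rw [rot_inv_zero, rot_inv_succ]
        exact ⟨fun h => absurd h (Fin.castSucc_lt_last j).not_gt, fun h => absurd h (hz j).not_gt⟩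
    | succ i =>
      induction y using Fin.cases with
      | zero =>
        rw [rot_inv_zero, rot_inv_succ]
        exact ⟨fun _ => hz i, fun _ => Fin.castSucc_lt_last i⟩
      | succ j =>
        rw [rot_inv_succ, rot_inv_succ]
        exact (hm.lt_iff_lt (a := i) (b := j)).symm

theorem exists_perm (n : ℕ) (T : BT15) (hT : nodes T = n) :
    ∃ π : Equiv.Perm (Fin n), wd π = lst T 0 := by
  subst hT
  have hlen := length_lst T 0
  let g : Fin (nodes T) → Fin (nodes T) := fun i =>
    ⟨(lst T 0).get (Fin.cast hlen.symm i), by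
      have := (mem_lst T 0 _).1 (List.get_mem (lst T 0) (Fin.cast hlen.symm i))
      omega⟩
  have hg : Function.Injective g := by
    intro i j hij
    have h1 := Fin.mk.inj_iff.1 hij
    have h2 := (nodup_lst T 0).injective_get h1
    simpa using h2
  refine ⟨Equiv.ofBijective g (Finite.injective_iff_bijective.1 hg), ?_⟩
  apply List.ext_get
  · simp [wd, hlen]
  · intro i h1 h2
    simp [wd, g]

theorem wd_inj {n : ℕ} {π σ : Equiv.Perm (Fin n)} (h : wd π = wd σ) : π = σ := by
  have := List.ofFn_injective h
  ext i
  exact congrFun this i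

theorem exists_tree {n : ℕ} (π : Equiv.Perm (Fin n)) (h : ¬ C132 (wd π)) :
    ∃ T, nodes T = n ∧ lst T 0 = wd π := by
  apply exists_lst n 0 _ _ _ h
  · rw [wd, List.nodup_ofFn]
    exact Fin.val_injective.comp π.injective
  · intro x
    rw [wd, List.mem_ofFn]
    constructor
    · rintro ⟨i, rfl⟩
      have := (π i).2
      simp
    · intro hx
      exact ⟨π.symm ⟨x, by omega⟩, by simp⟩

theorem count_trees (n : ℕ) (P : List ℕ → Prop) :
    {π : Equiv.Perm (Fin n) | ¬ C132 (wd π) ∧ ¬ P (wd π)}.ncard =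
      {T : BT15 | nodes T = n ∧ ¬ P (lst T 0)}.ncard := by
  symm
  choose! F hF using exists_perm n
  apply Set.ncard_congr (fun T _ => F T)
  · rintro T ⟨h1, h2⟩
    simp only [Set.mem_ofPred_eq, hF T h1]
    exact ⟨not_C132_lst T 0, h2⟩
  · rintro T U ⟨h1, -⟩ ⟨h2, -⟩ h
    apply lst_inj T U 0
    rw [← hF T h1, ← hF U h2, h]
  · rintro π ⟨h1, h2⟩
    obtain ⟨T, hT, e⟩ := exists_tree π h1
    refine ⟨T, ⟨hT, by rwa [e]⟩, wd_inj ?_⟩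
    rw [hF T hT, e]

theorem contains_inv {n k : ℕ} (π : Equiv.Perm (Fin n)) (τ : Equiv.Perm (Fin k))
    (h : Contains π τ) : Contains π⁻¹ τ⁻¹ := by
  obtain ⟨f, hf, h⟩ := h
  have hm : StrictMono f := fun a b => hf a b
  refine ⟨fun a => π (f (τ⁻¹ a)), ?_, ?_⟩
  · intro a b hab
    rw [← h]
    simpa using hab
  · intro a b
    have e : ∀ x, π⁻¹ (π x) = x := fun x => π.symm_apply_apply x
    rw [e, e]
    exact hm.lt_iff_lt.symm

theorem contains_inv_iff {n k : ℕ} (π : Equiv.Perm (Fin n)) (τ : Equiv.Perm (Fin k)) :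
    Contains π⁻¹ τ⁻¹ ↔ Contains π τ :=
  ⟨fun h => by simpa using contains_inv _ _ h, contains_inv π τ⟩

/-- |S_n(132, 12⋯k)| = |S_n(132, 23⋯k1)| = |S_n(132, k12⋯(k−1))| for n ≥ 1 and
k ≥ 3.  Here 23⋯k1 is the cyclic shift `finRotate k` (0-based: a ↦ a+1 mod k)
and k12⋯(k−1) is its inverse. -/
theorem stmt15 (n k : ℕ) (hn : 1 ≤ n) (hk : 3 ≤ k) :
    (Finset.univ.filter (fun π : Equiv.Perm (Fin n) =>
        Avoids π pat132 ∧ Avoids π (1 : Equiv.Perm (Fin k)))).card =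
      (Finset.univ.filter (fun π : Equiv.Perm (Fin n) =>
        Avoids π pat132 ∧ Avoids π (finRotate k))).card ∧
    (Finset.univ.filter (fun π : Equiv.Perm (Fin n) =>
        Avoids π pat132 ∧ Avoids π (finRotate k))).card =
      (Finset.univ.filter (fun π : Equiv.Perm (Fin n) =>
        Avoids π pat132 ∧ Avoids π (finRotate k)⁻¹)).card := by
  have hinv : (Finset.univ.filter (fun π : Equiv.Perm (Fin n) =>
        Avoids π pat132 ∧ Avoids π (finRotate k))).card =
      (Finset.univ.filter (fun π : Equiv.Perm (Fin n) =>
        Avoids π pat132 ∧ Avoids π (finRotate k)⁻¹)).card := by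
    have hp : pat132⁻¹ = pat132 := by simp [pat132]
    have h1 : ∀ π : Equiv.Perm (Fin n), Contains π⁻¹ pat132 ↔ Contains π pat132 := by
      intro π
      have := contains_inv_iff π pat132
      rwa [hp] at this
    apply Finset.card_bij (fun π _ => π⁻¹)
    · intro π hπ
      simp only [Finset.mem_filter, Finset.mem_univ, true_and] at hπ ⊢
      simp only [Avoids, h1, contains_inv_iff] at hπ ⊢
      exact hπ
    · intro a _ b _ h
      exact inv_injective h
    · intro π hπ
      refine ⟨π⁻¹, ?_, inv_inv π⟩
      have h2 := contains_inv_iff π⁻¹ (finRotate k)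
      rw [inv_inv] at h2
      simp only [Finset.mem_filter, Finset.mem_univ, true_and] at hπ ⊢
      simp only [Avoids, h1, ← h2] at hπ ⊢
      exact hπ
  refine ⟨?_, hinv⟩
  rw [hinv]
  obtain ⟨j, rfl⟩ : ∃ j, k = j + 1 := ⟨k - 1, by omega⟩
  have e1 := count_trees n (CInc (j+1))
  have e2 := count_trees n (CRot j)
  have e3 : {T : BT15 | nodes T = n ∧ ¬ CInc (j+1) (lst T 0)}.ncard =
      {T : BT15 | nodes T = n ∧ ¬ CRot j (lst T 0)}.ncard := by
    apply Set.ncard_congr (fun T _ => phi T)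
    · rintro T ⟨h1, h2⟩
      exact ⟨by rw [nodes_phi, h1], by rwa [← CInc_phi j (by omega) T 0 0]⟩
    · intro T U _ _ h
      rw [← psi_phi T, h, psi_phi]
    · rintro T ⟨h1, h2⟩
      refine ⟨psi T, ⟨?_, ?_⟩, phi_psi T⟩
      · rw [← nodes_phi, phi_psi, h1]
      · rwa [CInc_phi j (by omega) (psi T) 0 0, phi_psi]
  rw [← Set.ncard_coe_finset, ← Set.ncard_coe_finset]
  simp only [Finset.coe_filter, Finset.mem_univ, true_and]
  simp only [Avoids, contains132, containsInc, containsRot]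
  rw [e1, e2, e3]
end

section
/- For all n ≥ 1, k ≥ 3 and 2 ≤ s ≤ k: the number of permutations of {1,…,n} avoiding both 132 and the increasing pattern 1 2 ⋯ k equals the number of permutations of {1,…,n} avoiding both 132 and the shifted pattern s(s+1)⋯k 1 2⋯(s−1), i.e., the permutation of S_k sending i ↦ i+s−1 for 1 ≤ i ≤ k−s+1 and i ↦ i−(k−s+1) for k−s+1 < i ≤ k. -/
/-- Longest increasing subsequence length of the permutation coded by a tree. -/
def tInc : BinaryTree Unit → ℕ
  | .nil => 0
  | .node _ l r => max (tInc l + 1) (tInc r)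

/-- The permutation coded by the tree contains the shifted pattern. -/
def tT (a b : ℕ) : BinaryTree Unit → Prop
  | .nil => False
  | .node _ l r => tT a b l ∨ tT a b r ∨ (a ≤ tInc l ∧ b ≤ tInc r)

/-- Coding of 132-avoiding permutations (values starting at `c`) by trees. -/
def tList : BinaryTree Unit → ℕ → List ℕ
  | .nil, _ => []
  | .node _ l r, c => tList l (c + r.numNodes) ++ (c + r.numNodes + l.numNodes) :: tList r c

noncomputable def tGF (w : BinaryTree Unit → ℤ) : PowerSeries ℤ :=
  PowerSeries.mk fun n => ∑ t ∈ BinaryTree.treesOfNumNodesEq n, w t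

theorem sum_trees_succ (w : BinaryTree Unit → ℤ) (n : ℕ) :
    ∑ t ∈ BinaryTree.treesOfNumNodesEq (n+1), w t =
    ∑ ij ∈ Finset.HasAntidiagonal.antidiagonal n, ∑ l ∈ BinaryTree.treesOfNumNodesEq ij.1,
      ∑ r ∈ BinaryTree.treesOfNumNodesEq ij.2, w (.node () l r) := by
  rw [BinaryTree.treesOfNumNodesEq_succ, Finset.sum_biUnion]
  · apply Finset.sum_congr rfl
    rintro ⟨i, j⟩ _
    rw [Finset.sum_map, Finset.sum_product]
    rfl
  · simp_rw [Set.PairwiseDisjoint, Set.Pairwise, Finset.disjoint_left]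
    aesop

theorem coeff_tGF_mul (u v : BinaryTree Unit → ℤ) (n : ℕ) :
    PowerSeries.coeff n (tGF u * tGF v) =
    ∑ ij ∈ Finset.HasAntidiagonal.antidiagonal n, ∑ l ∈ BinaryTree.treesOfNumNodesEq ij.1,
      ∑ r ∈ BinaryTree.treesOfNumNodesEq ij.2, u l * v r := by
  rw [PowerSeries.coeff_mul]
  apply Finset.sum_congr rfl
  intro ij _
  simp only [tGF, PowerSeries.coeff_mk]
  rw [Finset.sum_mul_sum]

theorem tGF_eq (w : BinaryTree Unit → ℤ) (h0 : w .nil = 1) (u1 v1 u2 v2 u3 v3 : BinaryTree Unit → ℤ)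
    (h : ∀ l r, w (.node () l r) = u1 l * v1 r + u2 l * v2 r - u3 l * v3 r) :
    tGF w = 1 + PowerSeries.X * (tGF u1 * tGF v1 + tGF u2 * tGF v2 - tGF u3 * tGF v3) := by
  ext n
  cases n with
  | zero => simp [tGF, h0]
  | succ n =>
    rw [map_add, PowerSeries.coeff_succ_X_mul, map_sub, map_add, coeff_tGF_mul, coeff_tGF_mul,
      coeff_tGF_mul]
    simp only [tGF, PowerSeries.coeff_mk, sum_trees_succ, h, Finset.sum_add_distrib,
      Finset.sum_sub_distrib]
    simp [PowerSeries.coeff_one]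

open Classical in
noncomputable def tF (k : ℕ) : PowerSeries ℤ := tGF fun t => if tInc t < k then 1 else 0

open Classical in
noncomputable def tG (a b : ℕ) : PowerSeries ℤ := tGF fun t => if tT a b t then 0 else 1

theorem tF_zero : tF 0 = 0 := by
  ext n; simp [tF, tGF]

theorem tF_succ (k : ℕ) : tF (k+1) * (1 - PowerSeries.X * tF k) = 1 := by
  have := tGF_eq (fun t => if tInc t < k + 1 then 1 else 0) (by simp [tInc])
    (fun t => if tInc t < k then 1 else 0) (fun t => if tInc t < k + 1 then 1 else 0)
    (fun _ => 0) (fun _ => 0) (fun _ => 0) (fun _ => 0) (by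
      intro l r
      simp only [tInc]
      by_cases h1 : tInc l < k <;> by_cases h2 : tInc r < k + 1 <;> simp [h1, h2] <;> omega)
  have h0 : tGF (fun _ => 0) = 0 := by ext n; simp [tGF]
  rw [h0] at this
  have h2 : tF (k+1) = 1 + PowerSeries.X * (tF k * tF (k+1)) := by
    unfold tF
    simp only [mul_zero, add_zero, sub_zero] at this
    convert this
  linear_combination h2

theorem tT_inc (a b : ℕ) (t : BinaryTree Unit) (h : tT a b t) : a + 1 ≤ tInc t ∧ b ≤ tInc t := by
  induction t with
  | nil => exact h.elim
  | node v l r hl hr =>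
    simp only [tT] at h
    simp only [tInc]
    rcases h with h | h | h
    · have := hl h; omega
    · have := hr h; omega
    · omega

theorem tG_eq (a b : ℕ) : tG a b * (1 - PowerSeries.X * tF a - PowerSeries.X * tF b) =
    1 - PowerSeries.X * tF a * tF b := by
  classical
  have := tGF_eq (fun t => if tT a b t then 0 else 1) (by simp [tT])
    (fun t => if tInc t < a then 1 else 0) (fun t => if tT a b t then 0 else 1)
    (fun t => if tT a b t then 0 else 1) (fun t => if tInc t < b then 1 else 0)
    (fun t => if tInc t < a then 1 else 0) (fun t => if tInc t < b then 1 else 0) (by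
      intro l r
      have h1 := tT_inc a b l
      have h2 := tT_inc a b r
      simp only [tT]
      by_cases hl : tT a b l <;> by_cases hr : tT a b r <;> by_cases ha : tInc l < a <;>
        by_cases hb : tInc r < b <;> simp [hl, hr, ha, hb] <;> first | omega | (simp_all; try omega))
  have h2 : tG a b = 1 + PowerSeries.X * (tF a * tG a b + tG a b * tF b - tF a * tF b) := by
    unfold tF tG
    convert this
  linear_combination h2

theorem tF_id (b : ℕ) : ∀ a, tF (a + b + 1) * (1 - PowerSeries.X * tF a - PowerSeries.X * tF b) =
    1 - PowerSeries.X * tF a * tF b := by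
  induction b with
  | zero => intro a; simp [tF_zero, tF_succ]
  | succ b ih =>
    intro a
    have h := ih (a+1)
    rw [show a + 1 + b + 1 = a + (b+1) + 1 by ring] at h
    have hu := tF_succ a
    have hv := tF_succ b
    have hne : tF (a+1) ≠ 0 := by
      intro h0; rw [h0] at hu; simp at hu
    generalize tF (a + (b+1) + 1) = K at *
    generalize tF (a+1) = u' at *
    generalize tF (b+1) = v' at *
    generalize tF a = u at *
    generalize tF b = v at *
    apply mul_left_cancel₀ hne
    linear_combination v' * h + (K - v') * hu + (u' - K) * hv

theorem tG_eq_tF (a b : ℕ) : tG a b = tF (a + b + 1) := by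
  have h1 := tG_eq a b
  have h2 := tF_id b a
  have hne : (1 - PowerSeries.X * tF a - PowerSeries.X * tF b) ≠ 0 := by
    intro h0
    have := congrArg PowerSeries.constantCoeff h0
    simp at this
  exact mul_right_cancel₀ hne (h1.trans h2.symm)

open Classical in
theorem tree_count (a b n : ℕ) :
    ((BinaryTree.treesOfNumNodesEq n).filter (fun t => tInc t < a + b + 1)).card =
    ((BinaryTree.treesOfNumNodesEq n).filter (fun t => ¬ tT a b t)).card := by
  have := congrArg (PowerSeries.coeff n) (tG_eq_tF a b)
  simp only [tG, tF, tGF, PowerSeries.coeff_mk] at this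
  apply Nat.cast_injective (R := ℤ)
  rw [Finset.card_filter, Finset.card_filter]
  push_cast
  rw [← this]
  apply Finset.sum_congr rfl
  intro t _
  split_ifs <;> simp_all

theorem mem_tList (t : BinaryTree Unit) : ∀ (c x : ℕ), x ∈ tList t c ↔ c ≤ x ∧ x < c + t.numNodes := by
  induction t with
  | nil => intro c x; simp [tList, BinaryTree.numNodes]
  | node v l r hl hr =>
    intro c x
    simp only [tList, List.mem_append, List.mem_cons, hl, hr, BinaryTree.numNodes]
    omega

theorem length_tList (t : BinaryTree Unit) : ∀ (c : ℕ), (tList t c).length = t.numNodes := by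
  induction t with
  | nil => intro c; simp [tList, BinaryTree.numNodes]
  | node v l r hl hr =>
    intro c
    simp only [tList, List.length_append, List.length_cons, hl, hr, BinaryTree.numNodes]
    omega

theorem nodup_tList (t : BinaryTree Unit) : ∀ (c : ℕ), (tList t c).Nodup := by
  induction t with
  | nil => intro c; simp [tList]
  | node v l r hl hr =>
    intro c
    simp only [tList, List.nodup_append, List.nodup_cons, hl, hr, mem_tList, List.mem_cons, true_and,
      and_true]
    refine ⟨by omega, ?_⟩
    intro x hx y hy
    omega

theorem tList_inj (t : BinaryTree Unit) : ∀ (t' : BinaryTree Unit) (c : ℕ), tList t c = tList t' c → t = t' := by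
  induction t with
  | nil =>
    intro t' c h
    cases t' with
    | nil => rfl
    | node v l r => simp [tList] at h
  | node v l r hl hr =>
    intro t' c h
    cases t' with
    | nil => simp [tList] at h
    | node v' l' r' =>
      have hlen := congrArg List.length h
      rw [length_tList, length_tList] at hlen
      simp only [BinaryTree.numNodes] at hlen
      simp only [tList] at h
      rw [List.append_cons_inj_of_notMem] at h
      · obtain ⟨h1, h2, h3⟩ := h
        have e := hr _ _ h3
        subst e
        have e := hl _ _ h1
        subst e
        rfl
      · rw [mem_tList]; omega
      · rw [mem_tList]; omega

/-- list contains 132 -/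
def L132 (l : List ℕ) : Prop := ∃ x y z, [x, y, z].Sublist l ∧ x < z ∧ z < y

theorem tList_not132 (t : BinaryTree Unit) : ∀ c, ¬ L132 (tList t c) := by
  induction t with
  | nil => rintro c ⟨x, y, z, h, _⟩; simp [tList] at h
  | node v l r hl hr =>
    rintro c ⟨x, y, z, h, h1, h2⟩
    simp only [tList] at h
    rw [List.sublist_append_iff] at h
    obtain ⟨p, q, he, hp, hq⟩ := h
    have hpm : ∀ x ∈ p, _ := fun x hx => (mem_tList _ _ _).1 (hp.subset hx)
    rcases p with _ | ⟨p1, _ | ⟨p2, _ | ⟨p3, p⟩⟩⟩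
    · simp only [List.nil_append] at he
      subst he
      rw [List.sublist_cons_iff] at hq
      rcases hq with hq | ⟨w, he, hw⟩
      · exact hr _ ⟨x, y, z, hq, h1, h2⟩
      · simp only [List.cons.injEq] at he
        obtain ⟨rfl, rfl⟩ := he
        have := (mem_tList _ _ _).1 (hw.subset (List.mem_cons_self))
        have := (mem_tList _ _ _).1 (hw.subset (List.mem_cons_of_mem _ (List.mem_cons_self)))
        omega
    · simp only [List.cons_append, List.nil_append, List.cons.injEq] at he
      obtain ⟨rfl, rfl⟩ := he
      have a1 := hpm x (by simp)
      have a2 := hq.subset (List.mem_cons_self)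
      have a3 := hq.subset (List.mem_cons_of_mem _ (List.mem_cons_self))
      simp only [List.mem_cons, mem_tList] at a2 a3
      omega
    · simp only [List.cons_append, List.nil_append, List.cons.injEq] at he
      obtain ⟨rfl, rfl, rfl⟩ := he
      have a1 := hpm x (by simp)
      have a2 := hpm y (by simp)
      have a3 := hq.subset (List.mem_cons_self)
      simp only [List.mem_cons, mem_tList] at a3
      omega
    · simp only [List.cons_append, List.cons.injEq] at he
      obtain ⟨rfl, rfl, rfl, he⟩ := he
      have : p = [] := by
        cases p with
        | nil => rfl
        | cons => simp at he
      subst this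
      exact hl _ ⟨x, y, z, hp, h1, h2⟩

theorem tInc_le (t : BinaryTree Unit) : ∀ (c : ℕ) (u : List ℕ), u.Sublist (tList t c) →
    u.Pairwise (· < ·) → u.length ≤ tInc t := by
  induction t with
  | nil => intro c u h _; simp [tList] at h; simp [h]
  | node v l r hl hr =>
    intro c u h hs
    simp only [tList] at h
    simp only [tInc]
    rw [List.sublist_append_iff] at h
    obtain ⟨p, q, rfl, hp, hq⟩ := h
    rw [List.pairwise_append] at hs
    obtain ⟨s1, s2, s3⟩ := hs
    have b1 := hl _ _ hp s1
    rw [List.length_append]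
    rw [List.sublist_cons_iff] at hq
    rcases hq with hq | ⟨w, rfl, hw⟩
    · have b2 := hr _ _ hq s2
      rcases p with _ | ⟨p1, p⟩
      · simp; omega
      · rcases q with _ | ⟨q1, q⟩
        · simp at b1 ⊢; omega
        · have := (mem_tList _ _ _).1 (hp.subset (List.mem_cons_self))
          have := (mem_tList _ _ _).1 (hq.subset (List.mem_cons_self))
          have := s3 p1 (by simp) q1 (by simp)
          omega
    · rcases w with _ | ⟨q1, q⟩
      · simp; omega
      · have := (mem_tList _ _ _).1 (hw.subset (List.mem_cons_self))
        have := (List.pairwise_cons.1 s2).1 q1 (by simp)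
        omega

theorem tInc_ex (t : BinaryTree Unit) : ∀ (c : ℕ), ∃ u : List ℕ, u.Sublist (tList t c) ∧
    u.Pairwise (· < ·) ∧ u.length = tInc t := by
  induction t with
  | nil => intro c; exact ⟨[], by simp, by simp, by simp [tInc]⟩
  | node v l r hl hr =>
    intro c
    simp only [tList, tInc]
    by_cases h : tInc l + 1 ≤ tInc r
    · obtain ⟨u, h1, h2, h3⟩ := hr c
      refine ⟨u, ?_, h2, by omega⟩
      exact (h1.cons _).trans (List.sublist_append_right _ _)
    · obtain ⟨u, h1, h2, h3⟩ := hl (c + r.numNodes)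
      refine ⟨u ++ [c + r.numNodes + l.numNodes], ?_, ?_, by simp; omega⟩
      · exact h1.append (by simp)
      · rw [List.pairwise_append]
        refine ⟨h2, by simp, ?_⟩
        intro x hx y hy
        have := (mem_tList _ _ _).1 (h1.subset hx)
        simp at hy
        omega

/-- list contains an increasing subsequence -/
def LInc (k : ℕ) (l : List ℕ) : Prop := ∃ u : List ℕ, u.Sublist l ∧ u.Pairwise (· < ·) ∧ u.length = k

theorem LInc_iff (t : BinaryTree Unit) (c k : ℕ) : LInc k (tList t c) ↔ k ≤ tInc t := by
  constructor
  · rintro ⟨u, h1, h2, rfl⟩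
    exact tInc_le _ _ _ h1 h2
  · intro h
    obtain ⟨u, h1, h2, h3⟩ := tInc_ex t c
    exact ⟨u.take k, (List.take_sublist _ _).trans h1, h2.sublist (List.take_sublist _ _), by simp; omega⟩

/-- list contains the shifted pattern -/
def LShift (a b : ℕ) (l : List ℕ) : Prop := ∃ u v : List ℕ, (u ++ v).Sublist l ∧ u.Pairwise (· < ·) ∧
  v.Pairwise (· < ·) ∧ u.length = a + 1 ∧ v.length = b ∧ ∀ x ∈ u, ∀ y ∈ v, y < x

theorem LShift_mono {a b : ℕ} {l l' : List ℕ} (h : l.Sublist l') : LShift a b l → LShift a b l' := by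
  rintro ⟨u, v, h1, h2⟩
  exact ⟨u, v, h1.trans h, h2⟩

theorem LShift_iff (a b : ℕ) (hb : 1 ≤ b) (t : BinaryTree Unit) : ∀ c, LShift a b (tList t c) ↔ tT a b t := by
  induction t with
  | nil =>
    intro c
    simp only [tT, iff_false]
    rintro ⟨u, v, h, h1, h2, h3, h4, h5⟩
    simp [tList] at h
    simp [h] at h3
  | node _ l r hl hr =>
    intro c
    simp only [tT]
    constructor
    · rintro ⟨u, v, h, su, sv, lu, lv, huv⟩
      simp only [tList] at h
      have hune : u ≠ [] := by rintro rfl; simp at lu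
      have hvne : v ≠ [] := by rintro rfl; simp at lv; omega
      have hM : ∀ x ∈ u ++ v, x ≤ c + r.numNodes + l.numNodes := by
        intro x hx
        have := h.subset hx
        simp only [List.mem_append, List.mem_cons, mem_tList] at this
        omega
      obtain ⟨u0, hu0⟩ := List.exists_mem_of_ne_nil _ hune
      obtain ⟨v0, hv0⟩ := List.exists_mem_of_ne_nil _ hvne
      have hMv : ∀ y ∈ v, y < c + r.numNodes + l.numNodes := by
        intro y hy
        have := huv u0 hu0 y hy
        have := hM u0 (by simp [hu0])
        omega
      have key : u.Sublist (tList l (c + r.numNodes)) → v.Sublist (tList r c) →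
          a ≤ tInc l ∧ b ≤ tInc r := by
        intro h1 h2
        have := tInc_le _ _ _ h1 su
        have := tInc_le _ _ _ h2 sv
        omega
      rw [List.sublist_append_iff] at h
      obtain ⟨p, q, he, hp, hq⟩ := h
      rw [List.append_eq_append_iff] at he
      rcases he with ⟨x, rfl, rfl⟩ | ⟨x, rfl, rfl⟩
      · by_cases hqn : q = []
        · subst hqn
          left
          rw [← hl (c + r.numNodes)]
          exact ⟨u, x, hp, su, by simpa using sv, lu, by simpa using lv, by simpa using huv⟩
        · right; right
          have hq' : q.Sublist (tList r c) := by
            rw [List.sublist_cons_iff] at hq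
            rcases hq with hq | ⟨w, rfl, hw⟩
            · exact hq
            · have := hMv (c + r.numNodes + l.numNodes) (by simp)
              omega
          obtain ⟨q0, hq0⟩ := List.exists_mem_of_ne_nil _ hqn
          have hx : x = [] := by
            by_contra hx
            obtain ⟨x0, hx0⟩ := List.exists_mem_of_ne_nil _ hx
            have := (List.pairwise_append.1 sv).2.2 x0 hx0 q0 hq0
            have := (mem_tList _ _ _).1 (hq'.subset hq0)
            have := (mem_tList _ _ _).1 (hp.subset (List.mem_append_right _ hx0))
            omega
          subst hx
          exact key (by simpa using hp) (by simpa using hq')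
      · rw [List.sublist_cons_iff] at hq
        rcases hq with hq | ⟨w, he, hw⟩
        · by_cases hpn : p = []
          · subst hpn
            right; left
            rw [← hr c]
            exact ⟨x, v, hq, by simpa using su, sv, by simpa using lu, lv, by simpa using huv⟩
          · right; right
            obtain ⟨p0, hp0⟩ := List.exists_mem_of_ne_nil _ hpn
            have hx : x = [] := by
              by_contra hx
              obtain ⟨x0, hx0⟩ := List.exists_mem_of_ne_nil _ hx
              have := (List.pairwise_append.1 su).2.2 p0 hp0 x0 hx0
              have := (mem_tList _ _ _).1 (hp.subset hp0)
              have := (mem_tList _ _ _).1 (hq.subset (List.mem_append_left _ hx0))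
              omega
            subst hx
            exact key (by simpa using hp) (by simpa using hq)
        · rcases x with _ | ⟨x1, x⟩
          · simp only [List.nil_append] at he
            subst he
            have := hMv (c + r.numNodes + l.numNodes) (by simp)
            omega
          · simp only [List.cons_append, List.cons.injEq] at he
            obtain ⟨rfl, rfl⟩ := he
            have hx : x = [] := by
              by_contra hx
              obtain ⟨x0, hx0⟩ := List.exists_mem_of_ne_nil _ hx
              have := (List.pairwise_cons.1 (List.pairwise_append.1 su).2.1).1 x0 hx0
              have := (mem_tList _ _ _).1 (hw.subset (List.mem_append_left _ hx0))
              omega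
            subst hx
            right; right
            have := tInc_le _ _ _ hp (List.pairwise_append.1 su).1
            have := tInc_le _ _ _ hw (by simpa using sv)
            simp at *
            omega
    · rintro (h | h | ⟨h1, h2⟩)
      · rw [← hl (c + r.numNodes)] at h
        exact LShift_mono (by simp [tList]) h
      · rw [← hr c] at h
        exact LShift_mono ((List.sublist_cons_self _ _).trans (List.sublist_append_right _ _)) h
      · obtain ⟨u, u1, u2, u3⟩ := (LInc_iff l (c + r.numNodes) a).2 h1
        obtain ⟨v, v1, v2, v3⟩ := (LInc_iff r c b).2 h2
        refine ⟨u ++ [c + r.numNodes + l.numNodes], v, ?_, ?_, v2, by simp [u3], v3, ?_⟩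
        · simp only [tList, List.append_assoc]
          exact u1.append (v1.cons_cons _)
        · rw [List.pairwise_append]
          refine ⟨u2, by simp, ?_⟩
          intro x hx y hy
          have := (mem_tList _ _ _).1 (u1.subset hx)
          simp at hy
          omega
        · intro x hx y hy
          have := (mem_tList _ _ _).1 (v1.subset hy)
          rw [List.mem_append] at hx
          rcases hx with hx | hx
          · have := (mem_tList _ _ _).1 (u1.subset hx)
            omega
          · simp at hx
            omega

theorem tList_surj (n : ℕ) : ∀ (c : ℕ) (w : List ℕ), w.Nodup → (∀ x, x ∈ w ↔ c ≤ x ∧ x < c + n) →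
    ¬ L132 w → ∃ t, tList t c = w := by
  induction n using Nat.strong_induction_on with
  | _ n ih =>
  intro c w hnd hmem h132
  rcases n with _ | n
  · have : w = [] := by
      rw [List.eq_nil_iff_forall_not_mem]
      intro x hx
      have := (hmem x).1 hx
      omega
    exact ⟨.nil, by simp [tList, this]⟩
  · have hM : c + n ∈ w := (hmem _).2 (by omega)
    obtain ⟨L, R, rfl⟩ := List.append_of_mem hM
    have hgt : ∀ x ∈ L, ∀ y ∈ R, y < x := by
      intro x hx y hy
      by_contra hlt
      apply h132
      rw [List.nodup_append] at hnd
      have h1 := hnd.2.2 x hx y (by simp [hy])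
      have h2 := (hmem y).1 (by simp [hy])
      have h3 : y ≠ c + n := by
        rintro rfl
        exact (List.nodup_cons.1 hnd.2.1).1 hy
      refine ⟨x, c + n, y, ?_, by omega, by omega⟩
      exact (List.singleton_sublist.2 hx).append ((List.singleton_sublist.2 hy).cons_cons _)
    rw [List.nodup_append, List.nodup_cons] at hnd
    obtain ⟨ndL, ⟨hMR, ndR⟩, hd⟩ := hnd
    have hL : ∀ x ∈ L, c ≤ x ∧ x < c + n := by
      intro x hx
      have := (hmem x).1 (by simp [hx])
      have := hd x hx (c + n) (by simp)
      omega
    have hR : ∀ x ∈ R, c ≤ x ∧ x < c + n := by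
      intro x hx
      have := (hmem x).1 (by simp [hx])
      have : x ≠ c + n := by rintro rfl; exact hMR hx
      omega
    have hLR : ∀ x, c ≤ x → x < c + n → x ∈ L ∨ x ∈ R := by
      intro x h1 h2
      have := (hmem x).2 ⟨h1, by omega⟩
      simp only [List.mem_append, List.mem_cons] at this
      rcases this with h | h | h
      · exact Or.inl h
      · omega
      · exact Or.inr h
    have hR2 : ∀ y ∈ R, y < c + R.length := by
      intro y hy
      have hsub : Finset.Ico c (y + 1) ⊆ R.toFinset := by
        intro z hz
        rw [Finset.mem_Ico] at hz
        rw [List.mem_toFinset]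
        rcases hLR z hz.1 (by have := hR y hy; omega) with h | h
        · have := hgt z h y hy
          omega
        · exact h
      have := Finset.card_le_card hsub
      rw [List.toFinset_card_of_nodup ndR, Nat.card_Ico] at this
      have := hR y hy
      omega
    have hRf : R.toFinset = Finset.Ico c (c + R.length) := by
      apply Finset.eq_of_subset_of_card_le
      · intro z hz
        rw [List.mem_toFinset] at hz
        rw [Finset.mem_Ico]
        exact ⟨(hR z hz).1, hR2 z hz⟩
      · rw [List.toFinset_card_of_nodup ndR, Nat.card_Ico]; omega
    have hRm : ∀ x, x ∈ R ↔ c ≤ x ∧ x < c + R.length := by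
      intro x
      rw [← List.mem_toFinset, hRf, Finset.mem_Ico]
    have hRn : R.length ≤ n := by
      by_contra hlt
      have := hR (c + n) ((hRm _).2 (by omega))
      omega
    have hLm : ∀ x, x ∈ L ↔ c + R.length ≤ x ∧ x < c + R.length + (n - R.length) := by
      intro x
      constructor
      · intro hx
        have h1 := hL x hx
        refine ⟨?_, by omega⟩
        by_contra hlt
        have := hgt x hx x ((hRm x).2 (by omega))
        omega
      · intro hx
        rcases hLR x (by omega) (by omega) with h | h
        · exact h
        · have := (hRm x).1 h
          omega
    obtain ⟨tr, htr⟩ := ih R.length (by omega) c R ndR hRm (by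
      rintro ⟨x, y, z, h, h'⟩
      exact h132 ⟨x, y, z, (h.cons _).trans (List.sublist_append_right _ _), h'⟩)
    obtain ⟨tl, htl⟩ := ih (n - R.length) (by omega) (c + R.length) L ndL hLm (by
      rintro ⟨x, y, z, h, h'⟩
      exact h132 ⟨x, y, z, h.trans (List.sublist_append_left _ _), h'⟩)
    have h1 : tr.numNodes = R.length := by rw [← htr, length_tList]
    have h2 : tl.numNodes = n - R.length := by
      have hf : L.toFinset = Finset.Ico (c + R.length) (c + R.length + (n - R.length)) := by
        ext x; rw [List.mem_toFinset, hLm, Finset.mem_Ico]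
      have := congrArg Finset.card hf
      rw [List.toFinset_card_of_nodup ndL, Nat.card_Ico] at this
      rw [← length_tList tl (c + R.length), htl]; omega
    refine ⟨.node () tl tr, ?_⟩
    simp only [tList, h1, h2, htr, htl]
    congr 2
    omega

/-- one-line notation -/
def pL {n : ℕ} (π : Equiv.Perm (Fin n)) : List ℕ := List.ofFn fun i => (π i : ℕ)

theorem ofFn_sublist_iff {k n : ℕ} (g : Fin k → ℕ) (h : Fin n → ℕ) :
    (List.ofFn g).Sublist (List.ofFn h) ↔
    ∃ f : Fin k → Fin n, (∀ a b : Fin k, a < b → f a < f b) ∧ ∀ a, g a = h (f a) := by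
  rw [List.sublist_iff_exists_fin_orderEmbedding_get_eq]
  constructor
  · rintro ⟨f, hf⟩
    refine ⟨fun a => (f (a.cast (by simp))).cast (by simp), ?_, ?_⟩
    · intro a b hab
      have : f (a.cast (by simp)) < f (b.cast (by simp)) := f.lt_iff_lt.2 hab
      exact this
    · intro a
      have := hf (a.cast (by simp))
      simp only [List.get_eq_getElem, List.getElem_ofFn] at this
      exact this
  · rintro ⟨f, hf, hg⟩
    refine ⟨OrderEmbedding.ofStrictMono
      (fun a => (f (a.cast (by simp))).cast (by simp)) ?_, ?_⟩
    · intro a b hab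
      have := hf (a.cast (by simp)) (b.cast (by simp)) hab
      exact this
    · intro a
      simp only [List.get_eq_getElem, List.getElem_ofFn, hg]
      rfl

theorem contains_iff {n k : ℕ} (π : Equiv.Perm (Fin n)) (τ : Equiv.Perm (Fin k)) :
    Contains π τ ↔ ∃ g : Fin k → ℕ, (List.ofFn g).Sublist (pL π) ∧ ∀ a b, τ a < τ b ↔ g a < g b := by
  unfold pL Contains
  constructor
  · rintro ⟨f, h1, h2⟩
    exact ⟨fun a => (π (f a) : ℕ), (ofFn_sublist_iff _ _).2 ⟨f, h1, fun _ => rfl⟩, h2⟩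
  · rintro ⟨g, h1, h2⟩
    obtain ⟨f, h3, h4⟩ := (ofFn_sublist_iff _ _).1 h1
    refine ⟨f, h3, fun a b => ?_⟩
    rw [h2, h4, h4, Fin.lt_def]

theorem contains_inc {n : ℕ} (k : ℕ) (π : Equiv.Perm (Fin n)) :
    Contains π (1 : Equiv.Perm (Fin k)) ↔ LInc k (pL π) := by
  rw [contains_iff]
  constructor
  · rintro ⟨g, h1, h2⟩
    refine ⟨_, h1, ?_, by simp⟩
    rw [List.pairwise_ofFn]
    intro a b hab
    exact (h2 a b).1 hab
  · rintro ⟨u, h1, h2, rfl⟩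
    refine ⟨u.get, by rwa [List.ofFn_get], ?_⟩
    have hm : StrictMono u.get := by
      rw [← List.ofFn_get u, List.pairwise_ofFn] at h2
      exact fun a b hab => h2 hab
    intro a b
    exact (hm.lt_iff_lt).symm

theorem contains_132 {n : ℕ} (π : Equiv.Perm (Fin n)) :
    Contains π pat132 ↔ L132 (pL π) := by
  rw [contains_iff]
  have e0 : pat132 0 = 0 := by decide
  have e1 : pat132 1 = 2 := by decide
  have e2 : pat132 2 = 1 := by decide
  constructor
  · rintro ⟨g, h1, h2⟩
    refine ⟨g 0, g 1, g 2, by simpa [List.ofFn_succ] using h1, ?_, ?_⟩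
    · rw [← h2, e0, e2]; decide
    · rw [← h2, e1, e2]; decide
  · rintro ⟨x, y, z, h1, h2, h3⟩
    refine ⟨![x, y, z], by simpa [List.ofFn_succ] using h1, ?_⟩
    intro a b
    fin_cases a <;> fin_cases b <;> simp [e0, e1, e2] <;> omega

theorem contains_shift {n : ℕ} (a b : ℕ) (τ : Equiv.Perm (Fin (a + 1 + b)))
    (h1 : ∀ i : Fin (a + 1), (τ (Fin.castAdd b i) : ℕ) = i + b)
    (h2 : ∀ j : Fin b, (τ (Fin.natAdd (a + 1) j) : ℕ) = j) (π : Equiv.Perm (Fin n)) :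
    Contains π τ ↔ LShift a b (pL π) := by
  rw [contains_iff]
  constructor
  · rintro ⟨g, hg, hp⟩
    refine ⟨List.ofFn fun i => g (Fin.castAdd b i), List.ofFn fun j => g (Fin.natAdd (a + 1) j),
      ?_, ?_, ?_, by simp, by simp, ?_⟩
    · rw [← List.ofFn_fin_append, Fin.append_castAdd_natAdd]
      exact hg
    · rw [List.pairwise_ofFn]
      intro i j hij
      rw [← hp, Fin.lt_def, h1, h1]
      omega
    · rw [List.pairwise_ofFn]
      intro i j hij
      rw [← hp, Fin.lt_def, h2, h2]
      omega
    · intro x hx y hy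
      rw [List.mem_ofFn] at hx hy
      obtain ⟨i, rfl⟩ := hx
      obtain ⟨j, rfl⟩ := hy
      rw [← hp, Fin.lt_def, h1, h2]
      omega
  · rintro ⟨u, v, hs, su, sv, lu, lv, huv⟩
    obtain ⟨gu, rfl⟩ : ∃ gu : Fin (a + 1) → ℕ, u = List.ofFn gu := by
      rw [← lu]; exact ⟨u.get, by rw [List.ofFn_get]⟩
    obtain ⟨gv, rfl⟩ : ∃ gv : Fin b → ℕ, v = List.ofFn gv := by
      rw [← lv]; exact ⟨v.get, by rw [List.ofFn_get]⟩
    rw [List.pairwise_ofFn] at su sv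
    have mu : StrictMono gu := fun _ _ h => su h
    have mv : StrictMono gv := fun _ _ h => sv h
    have hlt : ∀ i j, gv j < gu i := fun i j => huv _ (List.mem_ofFn.2 ⟨i, rfl⟩) _ (List.mem_ofFn.2 ⟨j, rfl⟩)
    refine ⟨Fin.append gu gv, by rwa [List.ofFn_fin_append], ?_⟩
    intro i j
    rw [Fin.lt_def]
    refine Fin.addCases (fun i => ?_) (fun i => ?_) i <;>
      refine Fin.addCases (fun j => ?_) (fun j => ?_) j <;>
      simp only [h1, h2, Fin.append_left, Fin.append_right]
    · rw [mu.lt_iff_lt, Fin.lt_def]; omega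
    · have := hlt i j; have := j.2; omega
    · have := hlt j i; have := i.2; omega
    · rw [mv.lt_iff_lt, Fin.lt_def]

theorem pL_nodup {n : ℕ} (π : Equiv.Perm (Fin n)) : (pL π).Nodup := by
  unfold pL
  rw [List.nodup_ofFn]
  exact Fin.val_injective.comp π.injective

theorem pL_mem {n : ℕ} (π : Equiv.Perm (Fin n)) (x : ℕ) : x ∈ pL π ↔ x < n := by
  unfold pL
  rw [List.mem_ofFn]
  constructor
  · rintro ⟨i, rfl⟩; exact (π i).2
  · intro h; exact ⟨π.symm ⟨x, h⟩, by simp⟩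

theorem pL_inj {n : ℕ} : Function.Injective (pL (n := n)) := by
  intro π σ h
  have := List.ofFn_injective h
  ext i
  exact congrFun this i

theorem pL_surj {n : ℕ} (w : List ℕ) (h1 : w.Nodup) (h2 : ∀ x ∈ w, x < n) (h3 : w.length = n) :
    ∃ π : Equiv.Perm (Fin n), pL π = w := by
  subst h3
  let f : Fin w.length → Fin w.length := fun i => ⟨w.get i, h2 _ (List.get_mem _ _)⟩
  have hf : Function.Injective f := by
    intro i j hij
    exact (List.nodup_iff_injective_get.1 h1) (congrArg Fin.val hij)
  refine ⟨Equiv.ofBijective f (Finite.injective_iff_bijective.1 hf), ?_⟩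
  unfold pL
  exact List.ofFn_get w

open Classical in
theorem perm_count (n : ℕ) (P : Equiv.Perm (Fin n) → Prop) (Q : BinaryTree Unit → Prop)
    (hPQ : ∀ π t, pL π = tList t 0 → (P π ↔ Q t)) :
    (Finset.univ.filter (fun π : Equiv.Perm (Fin n) => Avoids π pat132 ∧ P π)).card =
    ((BinaryTree.treesOfNumNodesEq n).filter Q).card := by
  rw [← Finset.card_image_of_injective _ (pL_inj (n := n)),
    ← Finset.card_image_of_injective (f := fun t => tList t 0) _ (fun t t' h => tList_inj t t' 0 h)]
  congr 1
  ext w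
  simp only [Finset.mem_image, Finset.mem_filter, Finset.mem_univ, true_and,
    BinaryTree.mem_treesOfNumNodesEq, Avoids, contains_132]
  constructor
  · rintro ⟨π, ⟨h1, h2⟩, rfl⟩
    obtain ⟨t, ht⟩ := tList_surj n 0 (pL π) (pL_nodup π) (by simp [pL_mem]) h1
    refine ⟨t, ⟨?_, (hPQ _ _ ht.symm).1 h2⟩, ht⟩
    rw [← length_tList t 0, ht]
    simp [pL]
  · rintro ⟨t, ⟨rfl, h2⟩, rfl⟩
    obtain ⟨π, hπ⟩ := pL_surj (tList t 0) (nodup_tList t 0) (by simp [mem_tList]) (length_tList t 0)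
    exact ⟨π, ⟨by rw [hπ]; exact tList_not132 t 0, (hPQ _ _ hπ).2 h2⟩, hπ⟩

theorem finRotate_pow_val (m j : ℕ) (i : Fin (m + 1)) :
    (((finRotate (m + 1)) ^ j) i : ℕ) = (i + j) % (m + 1) := by
  induction j with
  | zero => simp [Nat.mod_eq_of_lt i.2]
  | succ j ih =>
    rw [pow_succ', Equiv.Perm.mul_apply, finRotate_apply, Fin.val_add, ih, Fin.val_one', ← Nat.add_mod, add_assoc]

/-- For n ≥ 1, k ≥ 3 and 2 ≤ s ≤ k, the number of permutations of {1,…,n}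
avoiding both 132 and 12⋯k equals the number avoiding both 132 and the shifted
pattern s(s+1)⋯k12⋯(s−1), which (0-based) is the cyclic shift a ↦ a + (s−1)
mod k, i.e. `(finRotate k) ^ (s - 1)`. -/
theorem stmt16 (n k s : ℕ) (hn : 1 ≤ n) (hk : 3 ≤ k) (hs : 2 ≤ s) (hsk : s ≤ k) :
    (Finset.univ.filter (fun π : Equiv.Perm (Fin n) =>
        Avoids π pat132 ∧ Avoids π (1 : Equiv.Perm (Fin k)))).card =
    (Finset.univ.filter (fun π : Equiv.Perm (Fin n) =>
        Avoids π pat132 ∧ Avoids π ((finRotate k) ^ (s - 1)))).card := by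
  obtain ⟨a, rfl⟩ := Nat.exists_eq_add_of_le hsk
  obtain ⟨b, rfl⟩ := Nat.exists_eq_add_of_le (show 1 ≤ s by omega)
  obtain ⟨k, hk'⟩ : ∃ k, k = 1 + b + a := ⟨_, rfl⟩
  rw [← hk', show 1 + b - 1 = b by omega]
  obtain rfl : k = a + 1 + b := by omega
  have e1 := perm_count n (fun π => Avoids π (1 : Equiv.Perm (Fin (a + 1 + b))))
    (fun t => tInc t < a + b + 1) (by
      intro π t h
      simp only [Avoids]
      rw [contains_inc, h, LInc_iff]
      omega)
  have hval : ∀ i : Fin (a + 1 + b), (((finRotate (a + 1 + b)) ^ b) i : ℕ) = (i + b) % (a + 1 + b) := by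
    obtain ⟨m, hm⟩ : ∃ m, a + 1 + b = m + 1 := ⟨a + b, by omega⟩
    rw [hm]
    exact fun i => finRotate_pow_val m b i
  have e2 := perm_count n (fun π => Avoids π ((finRotate (a + 1 + b)) ^ b))
    (fun t => ¬ tT a b t) (by
      intro π t h
      simp only [Avoids]
      rw [contains_shift a b, h, LShift_iff a b (by omega)]
      · intro i
        rw [hval, Fin.val_castAdd, Nat.mod_eq_of_lt]
        have := i.2
        omega
      · intro j
        rw [hval, Fin.val_natAdd, show a + 1 + (j : ℕ) + b = j + (a + 1 + b) by omega,
          Nat.add_mod_right, Nat.mod_eq_of_lt]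
        have := j.2
        omega)
  have e3 := tree_count a b n
  refine Eq.trans ?_ (Eq.trans e3 ?_)
  · convert e1
  · convert e2.symm
end

section
/- For every n ≥ 1 and every l with 1 ≤ l ≤ n, the number of 132-avoiding permutations of {1,…,n} whose longest increasing subsequence has length exactly l equals the number of 132-avoiding permutations σ of {1,…,n} with l_2(σ) = l, i.e., such that σ contains the pattern 2 3 ⋯ l 1 (the permutation of S_l sending i↦i+1 for i < l and l↦1; for l = 1 this is the trivial pattern 1) but does not contain the pattern 2 3 ⋯ (l+1) 1 of S_{l+1}. -/
namespace P17
open List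

def T (w : List ℕ) : Prop := w.Triplewise (fun a b c => ¬ (a < c ∧ c < b))

def inc (k : ℕ) (w : List ℕ) : Prop := ∃ s, s <+ w ∧ s.length = k ∧ s.Pairwise (· < ·)

def rot (k : ℕ) (w : List ℕ) : Prop :=
  ∃ s x, s ++ [x] <+ w ∧ s.length = k ∧ s.Pairwise (· < ·) ∧ ∀ y ∈ s, x < y

def IsP (n : ℕ) (w : List ℕ) : Prop := w.Nodup ∧ (∀ x ∈ w, x < n) ∧ w.length = n

lemma IsP.mem {n : ℕ} {w : List ℕ} (h : IsP n w) {x : ℕ} (hx : x < n) : x ∈ w := by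
  obtain ⟨h1, h2, h3⟩ := h
  have : w.toFinset = Finset.range n := by
    apply Finset.eq_of_subset_of_card_le
    · intro y hy
      simp at hy ⊢
      exact h2 y hy
    · rw [List.toFinset_card_of_nodup h1, h3]; simp
  have h4 : x ∈ w.toFinset := by rw [this]; simpa using hx
  simpa using h4

lemma isP_lower {w : List ℕ} (h : w.Nodup) (hl : ∀ y ∈ w, ∀ z, z < y → z ∈ w) :
    IsP w.length w := by
  refine ⟨h, ?_, rfl⟩
  intro y hy
  have : Finset.range (y+1) ⊆ w.toFinset := by
    intro z hz
    simp at hz ⊢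
    rcases Nat.lt_or_ge z y with h1 | h1
    · exact hl y hy z h1
    · have : z = y := by omega
      exact this ▸ hy
  have := Finset.card_le_card this
  rw [List.toFinset_card_of_nodup h] at this
  simpa using this

lemma T_shift (j : ℕ) (w : List ℕ) : T (w.map (· + j)) ↔ T w := by
  unfold T
  rw [triplewise_map]
  simp

lemma inc_shift (j k : ℕ) (w : List ℕ) : inc k (w.map (· + j)) ↔ inc k w := by
  constructor
  · rintro ⟨s, hs, hk, hp⟩
    obtain ⟨t, ht, rfl⟩ := sublist_map_iff.1 hs
    refine ⟨t, ht, by simpa using hk, ?_⟩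
    simpa [pairwise_map] using hp
  · rintro ⟨s, hs, hk, hp⟩
    refine ⟨s.map (· + j), hs.map _, by simpa using hk, ?_⟩
    simpa [pairwise_map] using hp

lemma inc_pred {k : ℕ} {w : List ℕ} (h : inc (k+1) w) : inc k w := by
  obtain ⟨s, hs, hk, hp⟩ := h
  exact ⟨s.tail, (tail_sublist s).trans hs, by simp [hk], hp.tail⟩

lemma rot_pred {k : ℕ} {w : List ℕ} (h : rot (k+1) w) : rot k w := by
  obtain ⟨s, x, hs, hk, hp, hx⟩ := h
  exact ⟨s.tail, x, ((tail_sublist s).append (Sublist.refl _)).trans hs, by simp [hk], hp.tail,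
    fun y hy => hx y (mem_of_mem_tail hy)⟩

lemma inc_F1 {n k : ℕ} {L R : List ℕ} (hL : ∀ x ∈ L, x < n) (hR : ∀ x ∈ R, x < n)
    (hLR : ∀ x ∈ L, ∀ y ∈ R, y < x) :
    inc (k+1) (L ++ n :: R) ↔ inc k L ∨ inc (k+1) R := by
  constructor
  · rintro ⟨s, hs, hk, hp⟩
    obtain ⟨s1, s2, rfl, h1, h2⟩ := sublist_append_iff.1 hs
    rw [pairwise_append] at hp
    obtain ⟨p1, p2, p3⟩ := hp
    rcases sublist_cons_iff.1 h2 with h | ⟨r, rfl, h⟩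
    · rcases s1 with _ | ⟨a, s1⟩
      · right; exact ⟨s2, h, by simpa using hk, p2⟩
      · rcases s2 with _ | ⟨b, s2⟩
        · left; exact inc_pred ⟨_, h1, by simpa using hk, p1⟩
        · have e1 := p3 a (by simp) b (by simp)
          have e2 := hLR a (h1.subset (by simp)) b (h.subset (by simp))
          omega
    · rcases r with _ | ⟨b, r⟩
      · left; exact ⟨s1, h1, by simpa using hk, p1⟩
      · have e1 := hR b (h.subset (by simp))
        have e2 := (pairwise_cons.1 p2).1 b (by simp)
        omega
  · rintro (⟨s, hs, hk, hp⟩ | ⟨s, hs, hk, hp⟩)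
    · refine ⟨s ++ [n], hs.append (by simp), by simp [hk], ?_⟩
      rw [pairwise_append]
      refine ⟨hp, by simp, ?_⟩
      intro a ha b hb
      simp at hb
      subst hb
      exact hL a (hs.subset ha)
    · exact ⟨s, (hs.trans (sublist_cons_self _ _)).trans (sublist_append_right _ _), hk, hp⟩

lemma rot_F2 {a k : ℕ} {B S : List ℕ} (hB : ∀ x ∈ B, a < x) (hS : ∀ x ∈ S, x < a) :
    rot (k+1) (B ++ (S ++ [a])) ↔ inc (k+1) B ∨ rot (k+1) S := by
  constructor
  · rintro ⟨s, x, hs, hk, hp, hx⟩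
    obtain ⟨t1, t2, ht, h1, h2⟩ := sublist_append_iff.1 hs
    rcases t2.eq_nil_or_concat with rfl | ⟨s2, x', rfl⟩
    · left
      rw [append_nil] at ht
      exact ⟨s, (sublist_append_left _ _).trans (ht ▸ h1), hk, hp⟩
    · rw [concat_eq_append] at ht h2
      rw [← append_assoc] at ht
      obtain ⟨rfl, ht⟩ := append_inj' ht rfl
      obtain rfl : x = x' := by simpa using ht
      rw [pairwise_append] at hp
      obtain ⟨p1, p2, p3⟩ := hp
      have h2' : s2 <+ S ∧ (s2 ++ [x] <+ S ∨ x = a) := by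
        obtain ⟨u1, u2, hu, g1, g2⟩ := sublist_append_iff.1 h2
        rcases sublist_singleton.1 g2 with rfl | rfl
        · rw [append_nil] at hu
          subst hu
          exact ⟨(sublist_append_left _ _).trans g1, Or.inl g1⟩
        · obtain ⟨rfl, hu⟩ := append_inj' hu rfl
          exact ⟨g1, Or.inr (by simpa using hu)⟩
      obtain ⟨g1, g2⟩ := h2'
      rcases s2 with _ | ⟨b, s2⟩
      · left
        exact ⟨t1, h1, by simpa using hk, p1⟩
      · have e2 := hS b (g1.subset (by simp))
        rcases t1 with _ | ⟨c, t1⟩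
        · rcases g2 with g2 | rfl
          · right
            exact ⟨_, x, g2, by simpa using hk, p2, by simpa using hx⟩
          · have e1 := hx b (by simp)
            omega
        · have e1 := p3 c (by simp) b (by simp)
          have e3 := hB c (h1.subset (by simp))
          omega
  · rintro (⟨s, hs, hk, hp⟩ | ⟨s, x, hs, hk, hp, hx⟩)
    · exact ⟨s, a, hs.append (sublist_append_right _ _), hk, hp, fun y hy => hB y (hs.subset hy)⟩
    · exact ⟨s, x, (hs.trans (sublist_append_left _ _)).trans (sublist_append_right _ _), hk, hp, hx⟩

lemma pairwise_of_all {α : Type*} {r : α → α → Prop} {l : List α}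
    (h : ∀ x ∈ l, ∀ y ∈ l, r x y) : l.Pairwise r :=
  List.pairwise_of_forall_mem_list h

lemma T_F1 {n : ℕ} {L R : List ℕ} (hL : ∀ x ∈ L, x < n) (hR : ∀ x ∈ R, x < n)
    (hLR : ∀ x ∈ L, ∀ y ∈ R, y < x) : T (L ++ n :: R) ↔ T L ∧ T R := by
  unfold T
  rw [triplewise_append, triplewise_cons]
  constructor
  · rintro ⟨h1, ⟨_, h2⟩, _⟩
    exact ⟨h1, h2⟩
  · rintro ⟨h1, h2⟩
    refine ⟨h1, ⟨?_, h2⟩, ?_, ?_⟩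
    · apply pairwise_of_all
      intro x hx y hy
      have := hR y hy
      omega
    · intro a ha
      rw [pairwise_cons]
      refine ⟨fun y hy => ?_, pairwise_of_all fun x hx y hy => ?_⟩
      · have := hLR a ha y hy
        omega
      · have := hLR a ha y hy
        omega
    · intro a ha
      refine pairwise_of_all fun x hx y hy => ?_
      rcases mem_cons.1 ha with rfl | ha
      · have := hL y hy
        omega
      · have := hLR x hx a ha
        omega

lemma T_F2 {a : ℕ} {B S : List ℕ} (hB : ∀ x ∈ B, a < x) (hS : ∀ x ∈ S, x < a) :
    T (B ++ (S ++ [a])) ↔ T B ∧ T S := by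
  unfold T
  rw [triplewise_append, triplewise_append]
  have hSa : ∀ y ∈ S ++ [a], y ≤ a := by
    intro y hy
    rcases mem_append.1 hy with h | h
    · exact (hS y h).le
    · simp at h; omega
  constructor
  · rintro ⟨h1, ⟨h2, _⟩, _⟩
    exact ⟨h1, h2⟩
  · rintro ⟨h1, h2⟩
    refine ⟨h1, ⟨h2, by simp, by simp, ?_⟩, ?_, ?_⟩
    · intro y hy
      refine pairwise_of_all fun x hx z hz => ?_
      have := hS z hz
      simp at hy
      omega
    · intro x hx
      refine pairwise_of_all fun y hy z hz => ?_
      have := hSa z hz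
      have := hB x hx
      omega
    · intro x hx
      refine pairwise_of_all fun y hy z hz => ?_
      have := hSa x hx
      have := hB y hy
      omega

def F1 (i j : ℕ) (L R : List ℕ) : List ℕ := L.map (· + j) ++ (i + j) :: R
def F2 (_ j : ℕ) (B S : List ℕ) : List ℕ := B.map (· + (j + 1)) ++ (S ++ [j])

lemma isP_F1 {i j : ℕ} {L R : List ℕ} (hL : IsP i L) (hR : IsP j R) : IsP (i+j+1) (F1 i j L R) := by
  obtain ⟨l1, l2, l3⟩ := hL
  obtain ⟨r1, r2, r3⟩ := hR
  refine ⟨?_, ?_, ?_⟩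
  · unfold F1
    rw [nodup_append, nodup_cons]
    refine ⟨l1.map (fun a b h => by simpa using h), ⟨fun h => ?_, r1⟩, ?_⟩
    · have := r2 _ h; omega
    · intro a ha b hb
      obtain ⟨x, hx, rfl⟩ := mem_map.1 ha
      have := l2 x hx
      rcases mem_cons.1 hb with rfl | hb
      · omega
      · have := r2 b hb
        omega
  · intro x hx
    rcases mem_append.1 hx with h | h
    · obtain ⟨x, hx', rfl⟩ := mem_map.1 h
      have := l2 x hx'
      omega
    · rcases mem_cons.1 h with rfl | hb
      · omega
      · have := r2 x hb
        omega
  · simp [F1, l3, r3]; omega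

lemma isP_F2 {i j : ℕ} {L R : List ℕ} (hL : IsP i L) (hR : IsP j R) : IsP (i+j+1) (F2 i j L R) := by
  obtain ⟨l1, l2, l3⟩ := hL
  obtain ⟨r1, r2, r3⟩ := hR
  refine ⟨?_, ?_, ?_⟩
  · unfold F2
    rw [nodup_append, nodup_append]
    refine ⟨l1.map (fun a b h => by simpa using h), ⟨r1, by simp, ?_⟩, ?_⟩
    · intro x hx y hy
      have := r2 _ hx
      simp at hy
      omega
    · intro a ha b hb
      obtain ⟨x, hx, rfl⟩ := mem_map.1 ha
      have := l2 x hx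
      rcases mem_append.1 hb with hb | hb
      · have := r2 b hb
        omega
      · simp at hb
        omega
  · intro x hx
    rcases mem_append.1 hx with h | h
    · obtain ⟨x, hx', rfl⟩ := mem_map.1 h
      have := l2 x hx'
      omega
    · rcases mem_append.1 h with h | hb
      · have := r2 x h
        omega
      · simp at hb
        omega
  · simp [F2, l3, r3]; omega

lemma shift_inj (j : ℕ) {L L' : List ℕ} (h : L.map (· + j) = L'.map (· + j)) : L = L' :=
  (List.map_inj_right (by simp)).1 h

lemma isP_unshift {i m : ℕ} {L : List ℕ} (h1 : L.Nodup) (h2 : ∀ x ∈ L, m ≤ x ∧ x < i + m)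
    (h3 : L.length = i) : ∃ L', IsP i L' ∧ L = L'.map (· + m) := by
  refine ⟨L.map (· - m), ⟨?_, ?_, by simpa using h3⟩, ?_⟩
  · apply Nodup.map_on _ h1
    intro x hx y hy h
    have := h2 x hx
    have := h2 y hy
    omega
  · intro x hx
    obtain ⟨x, hx', rfl⟩ := mem_map.1 hx
    have := h2 x hx'
    omega
  · rw [map_map]
    symm
    conv_rhs => rw [← map_id L]
    apply map_congr_left
    intro x hx
    have := h2 x hx
    simp; omega

lemma surj_F1 {n : ℕ} {w : List ℕ} (hw : IsP (n+1) w) (hT : T w) :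
    ∃ i j L R, i + j = n ∧ IsP i L ∧ IsP j R ∧ w = F1 i j L R := by
  obtain ⟨L, R, rfl⟩ := append_of_mem (hw.mem (Nat.lt_succ_self n))
  have hm := fun x => hw.mem (x := x)
  obtain ⟨h1, h2, h3⟩ := hw
  rw [nodup_append, nodup_cons] at h1
  obtain ⟨n1, ⟨n2, n3⟩, n4⟩ := h1
  have hRn : ∀ y ∈ R, y < n := by
    intro y hy
    have := h2 y (by simp [hy])
    have : y ≠ n := by rintro rfl; exact n2 hy
    omega
  have hLn : ∀ y ∈ L, y < n := by
    intro y hy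
    have := h2 y (by simp [hy])
    have := n4 y hy n (by simp)
    omega
  have hLR : ∀ x ∈ L, ∀ y ∈ R, y < x := by
    intro x hx y hy
    have e := (triplewise_append.1 hT).2.2.1 x hx
    have e := (pairwise_cons.1 e).1 y hy
    have := n4 x hx y (by simp [hy])
    have := hRn y hy
    omega
  have hR : IsP R.length R := by
    apply isP_lower n3
    intro y hy z hz
    have := hRn y hy
    have := hm z (by omega)
    rcases mem_append.1 this with h | h
    · have := hLR z h y hy
      omega
    · rcases mem_cons.1 h with rfl | h
      · omega
      · exact h
  simp at h3
  obtain ⟨L', hL', e⟩ := isP_unshift (i := L.length) (m := R.length) n1 (by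
    intro x hx
    refine ⟨?_, by have := hLn x hx; omega⟩
    by_contra hc
    have := hR.mem (x := x) (by omega)
    exact n4 x hx x (by simp [this]) rfl) rfl
  refine ⟨L.length, R.length, L', R, by omega, hL', hR, ?_⟩
  unfold F1
  rw [← e]
  congr 2
  omega

lemma split_aux (a : ℕ) (w : List ℕ) (hw : a ∉ w) (h : w.Pairwise (fun x y => ¬ (x < a ∧ a < y))) :
    ∃ B S, w = B ++ S ∧ (∀ x ∈ B, a < x) ∧ ∀ x ∈ S, x < a := by
  induction w with
  | nil => exact ⟨[], [], by simp⟩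
  | cons x t ih =>
    rw [pairwise_cons] at h
    simp at hw
    rcases Nat.lt_or_ge x a with hx | hx
    · refine ⟨[], x :: t, by simp, by simp, ?_⟩
      intro y hy
      rcases mem_cons.1 hy with rfl | hy
      · exact hx
      · have := h.1 y hy
        have : y ≠ a := by rintro rfl; exact hw.2 hy
        omega
    · obtain ⟨B, S, rfl, hB, hS⟩ := ih hw.2 h.2
      refine ⟨x :: B, S, by simp, ?_, hS⟩
      intro y hy
      rcases mem_cons.1 hy with rfl | hy
      · omega
      · exact hB y hy

lemma surj_F2 {n : ℕ} {w : List ℕ} (hw : IsP (n+1) w) (hT : T w) :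
    ∃ i j L R, i + j = n ∧ IsP i L ∧ IsP j R ∧ w = F2 i j L R := by
  have hm := fun x => hw.mem (x := x)
  obtain ⟨h1, h2, h3⟩ := hw
  rcases w.eq_nil_or_concat with rfl | ⟨v, a, rfl⟩
  · simp at h3
  rw [concat_eq_append] at *
  have n1 := nodup_append.1 h1
  obtain ⟨B, S, rfl, hB, hS⟩ := split_aux a v (fun h => n1.2.2 a h a (by simp) rfl)
    ((triplewise_append.1 hT).2.2.2 a (by simp))
  have n2 := nodup_append.1 n1.1
  have ha : a < n + 1 := h2 a (by simp)
  have hlow : ∀ z, z < a → z ∈ S := by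
    intro z hz
    have := hm z (by omega)
    simp at this
    rcases this with h | h | h
    · have := hB z h; omega
    · exact h
    · omega
  have hSP : IsP S.length S := by
    apply isP_lower n2.2.1
    intro y hy z hz
    have := hS y hy
    exact hlow z (by omega)
  have hSa : S.length = a := by
    rcases Nat.lt_trichotomy S.length a with h | h | h
    · have := hSP.2.1 _ (hlow _ h)
      omega
    · exact h
    · have := hS _ (hSP.mem h)
      omega
  simp at h3
  obtain ⟨L', hL', e⟩ := isP_unshift (i := B.length) (m := S.length + 1) n2.1 (by
    intro x hx
    have := hB x hx
    have := h2 x (by simp [hx])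
    omega) rfl
  refine ⟨B.length, S.length, L', S, by omega, hL', hSP, ?_⟩
  unfold F2
  rw [← e, hSa, append_assoc]

lemma inj_F1 {n i j i' j' : ℕ} {L R L' R' : List ℕ} (h : i + j = n) (h' : i' + j' = n)
    (hL : IsP i L) (hR : IsP j R) (hL' : IsP i' L') (hR' : IsP j' R')
    (e : F1 i j L R = F1 i' j' L' R') : i = i' ∧ j = j' ∧ L = L' ∧ R = R' := by
  unfold F1 at e
  rw [h, h'] at e
  have a1 : n ∉ L.map (· + j) := by
    intro hx
    obtain ⟨x, hx, hh⟩ := mem_map.1 hx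
    have := hL.2.1 x hx
    omega
  have a2 : n ∉ L'.map (· + j') := by
    intro hx
    obtain ⟨x, hx, hh⟩ := mem_map.1 hx
    have := hL'.2.1 x hx
    omega
  have key : L.map (· + j) = L'.map (· + j') ∧ n :: R = n :: R' := by
    rcases append_eq_append_iff.1 e with ⟨as, e1, e2⟩ | ⟨as, e1, e2⟩
    · rcases as with _ | ⟨b, as⟩
      · simp at e1 e2
        exact ⟨e1.symm, by rw [e2]⟩
      · simp at e2
        exact (a2 (by rw [e1, e2.1]; simp)).elim
    · rcases as with _ | ⟨b, as⟩
      · simp at e1 e2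
        exact ⟨e1, by rw [e2]⟩
      · simp at e2
        exact (a1 (by rw [e1, e2.1]; simp)).elim
  obtain ⟨k1, k2⟩ := key
  have k2 : R = R' := by simpa using k2
  have hj : j = j' := by rw [← hR.2.2, ← hR'.2.2, k2]
  subst hj
  exact ⟨by omega, rfl, shift_inj _ k1, k2⟩

lemma inj_F2 {n i j i' j' : ℕ} {L R L' R' : List ℕ} (h : i + j = n) (h' : i' + j' = n)
    (hL : IsP i L) (_hR : IsP j R) (hL' : IsP i' L') (_hR' : IsP j' R')
    (e : F2 i j L R = F2 i' j' L' R') : i = i' ∧ j = j' ∧ L = L' ∧ R = R' := by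
  unfold F2 at e
  rw [← append_assoc, ← append_assoc] at e
  obtain ⟨e1, e2⟩ := append_inj' e rfl
  obtain rfl : j = j' := by simpa using e2
  obtain rfl : i = i' := by omega
  obtain ⟨e3, e4⟩ := append_inj e1 (by simp [hL.2.2, hL'.2.2])
  exact ⟨rfl, rfl, shift_inj _ e3, e4⟩

def toL {n : ℕ} (π : Equiv.Perm (Fin n)) : List ℕ := List.ofFn (fun i => (π i : ℕ))

lemma toL_inj {n : ℕ} : Function.Injective (toL (n := n)) := by
  intro π σ h
  have := List.ofFn_injective h
  ext i
  exact congrFun this i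

lemma isP_toL {n : ℕ} (π : Equiv.Perm (Fin n)) : IsP n (toL π) := by
  refine ⟨?_, ?_, by simp [toL]⟩
  · unfold toL
    rw [List.nodup_ofFn]
    exact Fin.val_injective.comp π.injective
  · intro x hx
    simp [toL, List.mem_ofFn] at hx
    obtain ⟨i, rfl⟩ := hx
    exact (π i).2

lemma exists_toL {n : ℕ} {w : List ℕ} (hw : IsP n w) : ∃ π : Equiv.Perm (Fin n), toL π = w := by
  obtain ⟨h1, h2, h3⟩ := hw
  subst h3
  let f : Fin w.length → Fin w.length := fun i => ⟨w.get i, h2 _ (List.get_mem _ _)⟩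
  have hf : Function.Injective f := by
    intro i j h
    have : w.get i = w.get j := by simpa [f] using h
    exact List.nodup_iff_injective_get.1 h1 this
  refine ⟨Equiv.ofBijective f (Finite.injective_iff_bijective.1 hf), ?_⟩
  unfold toL
  simp only [Equiv.ofBijective_apply, f]
  exact List.ofFn_get w

open Classical in
noncomputable def A (n : ℕ) (Q : List ℕ → Prop) : Finset (List ℕ) :=
  ((Finset.univ : Finset (Equiv.Perm (Fin n))).image toL).filter Q

lemma mem_A {n : ℕ} {Q : List ℕ → Prop} {w : List ℕ} : w ∈ A n Q ↔ IsP n w ∧ Q w := by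
  unfold A
  simp only [Finset.mem_filter, Finset.mem_image, Finset.mem_univ, true_and]
  refine and_congr_left fun _ => ⟨?_, exists_toL⟩
  rintro ⟨π, rfl⟩
  exact isP_toL π

lemma card_A {n : ℕ} (Q : List ℕ → Prop) (P : Equiv.Perm (Fin n) → Prop) [DecidablePred P]
    (h : ∀ π, P π ↔ Q (toL π)) : (Finset.univ.filter P).card = (A n Q).card := by
  rw [← Finset.card_image_of_injective _ toL_inj]
  congr 1
  ext w
  rw [mem_A]
  simp only [Finset.mem_filter, Finset.mem_image, Finset.mem_univ, true_and]
  constructor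
  · rintro ⟨π, hp, rfl⟩
    exact ⟨isP_toL π, (h π).1 hp⟩
  · rintro ⟨h1, h2⟩
    obtain ⟨π, rfl⟩ := exists_toL h1
    exact ⟨π, (h π).2 h2, rfl⟩

lemma card_rec (n : ℕ) (F : ℕ → ℕ → List ℕ → List ℕ → List ℕ) (Q Q1 Q2 : List ℕ → Prop)
    (hP : ∀ {i j L R}, IsP i L → IsP j R → IsP (i+j+1) (F i j L R))
    (hinj : ∀ {i j i' j' L R L' R'}, i + j = n → i' + j' = n → IsP i L → IsP j R → IsP i' L' →
      IsP j' R' → F i j L R = F i' j' L' R' → i = i' ∧ j = j' ∧ L = L' ∧ R = R')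
    (hsurj : ∀ {w}, IsP (n+1) w → Q w → ∃ i j L R, i + j = n ∧ IsP i L ∧ IsP j R ∧ w = F i j L R)
    (hQ : ∀ {i j L R}, IsP i L → IsP j R → (Q (F i j L R) ↔ Q1 L ∧ Q2 R)) :
    (A (n+1) Q).card = ∑ p ∈ Finset.HasAntidiagonal.antidiagonal n, (A p.1 Q1).card * (A p.2 Q2).card := by
  simp_rw [← Finset.card_product]
  rw [← Finset.card_sigma]
  symm
  apply Finset.card_bij (fun x _ => F x.1.1 x.1.2 x.2.1 x.2.2)
  · rintro ⟨⟨i, j⟩, L, R⟩ h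
    simp only [Finset.mem_sigma, Finset.HasAntidiagonal.mem_antidiagonal, Finset.mem_product, mem_A] at h ⊢
    obtain ⟨rfl, ⟨h1, h2⟩, h3, h4⟩ := h
    exact ⟨hP h1 h3, (hQ h1 h3).2 ⟨h2, h4⟩⟩
  · rintro ⟨⟨i, j⟩, L, R⟩ h ⟨⟨i', j'⟩, L', R'⟩ h' e
    simp only [Finset.mem_sigma, Finset.HasAntidiagonal.mem_antidiagonal, Finset.mem_product, mem_A] at h h' e
    obtain ⟨rfl, rfl, rfl, rfl⟩ := hinj h.1 h'.1 h.2.1.1 h.2.2.1 h'.2.1.1 h'.2.2.1 e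
    rfl
  · intro w hw
    rw [mem_A] at hw
    obtain ⟨i, j, L, R, h, hL, hR, rfl⟩ := hsurj hw.1 hw.2
    refine ⟨⟨(i, j), (L, R)⟩, ?_, rfl⟩
    simp only [Finset.mem_sigma, Finset.HasAntidiagonal.mem_antidiagonal, Finset.mem_product, mem_A]
    have := (hQ hL hR).1 hw.2
    exact ⟨h, ⟨hL, this.1⟩, hR, this.2⟩

lemma recA (n l : ℕ) : (A (n+1) (fun w => T w ∧ ¬ inc (l+2) w)).card =
    ∑ p ∈ Finset.HasAntidiagonal.antidiagonal n, (A p.1 (fun w => T w ∧ ¬ inc (l+1) w)).card *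
      (A p.2 (fun w => T w ∧ ¬ inc (l+2) w)).card := by
  apply card_rec n F1 _ _ _ isP_F1 inj_F1 (fun h1 h2 => surj_F1 h1 h2.1)
  intro i j L R hL hR
  have c1 : ∀ x ∈ L.map (· + j), x < i + j := by
    intro x hx
    obtain ⟨x, hx2, rfl⟩ := mem_map.1 hx
    have := hL.2.1 x hx2
    omega
  have c2 : ∀ x ∈ R, x < i + j := fun x hx => by have := hR.2.1 x hx; omega
  have c3 : ∀ x ∈ L.map (· + j), ∀ y ∈ R, y < x := by
    intro x hx y hy
    obtain ⟨x, hx, rfl⟩ := mem_map.1 hx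
    have := hR.2.1 y hy
    omega
  unfold F1
  rw [T_F1 c1 c2 c3, inc_F1 c1 c2 c3, T_shift, inc_shift]
  tauto

lemma recK (n l : ℕ) : (A (n+1) (fun w => T w ∧ ¬ rot (l+1) w)).card =
    ∑ p ∈ Finset.HasAntidiagonal.antidiagonal n, (A p.1 (fun w => T w ∧ ¬ inc (l+1) w)).card *
      (A p.2 (fun w => T w ∧ ¬ rot (l+1) w)).card := by
  apply card_rec n F2 _ _ _ isP_F2 inj_F2 (fun h1 h2 => surj_F2 h1 h2.1)
  intro i j L R hL hR
  have c1 : ∀ x ∈ L.map (· + (j + 1)), j < x := by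
    intro x hx
    obtain ⟨x, hx, rfl⟩ := mem_map.1 hx
    omega
  have c2 : ∀ x ∈ R, x < j := hR.2.1
  unfold F2
  rw [T_F2 c1 c2, rot_F2 c1 c2, T_shift, inc_shift]
  tauto

lemma main_eq (l n : ℕ) : (A n (fun w => T w ∧ ¬ inc (l+1) w)).card =
    (A n (fun w => T w ∧ ¬ rot l w)).card := by
  rcases l with _ | l
  · congr 1
    ext w
    rw [mem_A, mem_A]
    have : inc (0+1) w ↔ rot 0 w := by
      constructor
      · rintro ⟨s, hs, hk, hp⟩
        obtain ⟨x, rfl⟩ := List.length_eq_one_iff.1 hk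
        exact ⟨[], x, by simpa using hs, rfl, by simp, by simp⟩
      · rintro ⟨s, x, hs, hk, -, -⟩
        obtain rfl := List.length_eq_zero_iff.1 hk
        exact ⟨[x], by simpa using hs, rfl, by simp⟩
    rw [this]
  · induction n using Nat.strong_induction_on with
    | _ n ih =>
      rcases n with _ | n
      · congr 1
        ext w
        rw [mem_A, mem_A]
        apply and_congr_right
        intro hw
        obtain rfl := List.length_eq_zero_iff.1 hw.2.2
        simp [inc, rot]
      · rw [recA, recK]
        apply Finset.sum_congr rfl
        intro p hp
        rw [Finset.HasAntidiagonal.mem_antidiagonal] at hp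
        rw [ih p.2 (by omega)]

lemma card_diff (n : ℕ) (P Q : List ℕ → Prop) (h : ∀ w, Q w → P w) :
    (A n (fun w => T w ∧ P w ∧ ¬ Q w)).card + (A n (fun w => T w ∧ ¬ P w)).card =
    (A n (fun w => T w ∧ ¬ Q w)).card := by
  rw [← Finset.card_union_of_disjoint]
  · congr 1
    ext w
    simp only [Finset.mem_union, mem_A]
    have := h w
    tauto
  · rw [Finset.disjoint_left]
    intro w
    simp only [mem_A]
    tauto

lemma T_iff {n : ℕ} (π : Equiv.Perm (Fin n)) : Avoids π pat132 ↔ T (toL π) := by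
  unfold Avoids Contains T
  rw [triplewise_iff_getElem]
  constructor
  · intro h i j k hij hjk hk hc
    simp [toL] at hk hc
    apply h
    refine ⟨![⟨i, by omega⟩, ⟨j, by omega⟩, ⟨k, hk⟩], ?_, ?_⟩
    · intro a b hab
      fin_cases a <;> fin_cases b <;> simp at hab ⊢ <;> omega
    · have e0 : pat132 0 = 0 := by decide
      have e1 : pat132 1 = 2 := by decide
      have e2 : pat132 2 = 1 := by decide
      intro a b
      fin_cases a <;> fin_cases b <;> simp [e0, e1, e2] <;> omega
  · rintro h ⟨f, hf, hp⟩
    have := h (f 0) (f 1) (f 2) (hf 0 1 (by decide)) (hf 1 2 (by decide)) (by simp [toL])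
    simp only [toL, List.getElem_ofFn] at this
    exact this ⟨(hp 0 2).1 (by decide), (hp 2 1).1 (by decide)⟩

lemma sub_ofFn {n k : ℕ} (g : Fin n → ℕ) (h : Fin k → ℕ) : List.ofFn h <+ List.ofFn g ↔
    ∃ f : Fin k → Fin n, (∀ a b, a < b → f a < f b) ∧ ∀ a, h a = g (f a) := by
  rw [List.sublist_iff_exists_fin_orderEmbedding_get_eq]
  constructor
  · rintro ⟨f, hf⟩
    refine ⟨fun a => Fin.cast (by simp) (f (Fin.cast (by simp) a)), ?_, ?_⟩
    · intro a b hab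
      have : f (Fin.cast (by simp) a) < f (Fin.cast (by simp) b) := f.strictMono (by simpa using hab)
      simpa using this
    · intro a
      have := hf (Fin.cast (by simp) a)
      simp at this
      exact this
  · rintro ⟨f, hf, hh⟩
    refine ⟨OrderEmbedding.ofStrictMono
      (fun a => Fin.cast (by simp) (f (Fin.cast (by simp) a))) ?_, ?_⟩
    · intro a b hab
      have := hf (Fin.cast (by simp) a) (Fin.cast (by simp) b) (by simpa using hab)
      simpa using this
    · intro a
      simp [hh]
      rfl

lemma inc_iff {n : ℕ} (k : ℕ) (π : Equiv.Perm (Fin n)) :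
    Contains π (1 : Equiv.Perm (Fin k)) ↔ inc k (toL π) := by
  constructor
  · rintro ⟨f, hf, hp⟩
    refine ⟨List.ofFn (fun a => (π (f a) : ℕ)), (sub_ofFn _ _).2 ⟨f, hf, fun _ => rfl⟩, by simp, ?_⟩
    rw [List.pairwise_ofFn]
    intro i j hij
    exact (hp i j).1 hij
  · rintro ⟨s, hs, rfl, hp⟩
    rw [← List.ofFn_get s] at hs hp
    obtain ⟨f, hf, hh⟩ := (sub_ofFn _ _).1 hs
    rw [List.pairwise_ofFn] at hp
    have hm : StrictMono (fun a => π (f a)) := by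
      intro a b hab
      have := hp hab
      rw [hh, hh] at this
      exact this
    exact ⟨f, hf, fun a b => hm.lt_iff_lt.symm⟩

lemma rot_iff {n : ℕ} (k : ℕ) (π : Equiv.Perm (Fin n)) :
    Contains π (finRotate (k+1)) ↔ rot k (toL π) := by
  have hr : ∀ i : Fin k, finRotate (k+1) i.castSucc = i.succ := by
    intro i
    rw [finRotate_apply]; simp
  constructor
  · rintro ⟨f, hf, hp⟩
    refine ⟨List.ofFn (fun a : Fin k => (π (f a.castSucc) : ℕ)), π (f (Fin.last k)), ?_, by simp, ?_, ?_⟩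
    · have := (sub_ofFn (fun i => (π i : ℕ)) (fun a => (π (f a) : ℕ))).2 ⟨f, hf, fun _ => rfl⟩
      rw [List.ofFn_succ' (fun a => (π (f a) : ℕ)), List.concat_eq_append] at this
      exact this
    · rw [List.pairwise_ofFn]
      intro i j hij
      apply (hp _ _).1
      rw [hr, hr]
      simpa using hij
    · intro y hy
      obtain ⟨i, rfl⟩ := (List.mem_ofFn).1 hy
      apply (hp _ _).1
      rw [hr, finRotate_last]
      exact Fin.succ_pos i
  · rintro ⟨s, x, hs, rfl, hp, hx⟩
    have e : s ++ [x] = List.ofFn (Fin.snoc (α := fun _ => ℕ) s.get x) := by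
      rw [List.ofFn_succ', List.concat_eq_append]
      simp
    rw [e] at hs
    obtain ⟨f, hf, hh⟩ := (sub_ofFn _ _).1 hs
    rw [← List.ofFn_get s, List.pairwise_ofFn] at hp
    have h1 : ∀ i : Fin s.length, (π (f i.castSucc) : ℕ) = s.get i := by
      intro i; rw [← hh]; simp
    have h2 : (π (f (Fin.last _)) : ℕ) = x := by
      rw [← hh]; simp
    have hm : StrictMono s.get := fun i j hij => hp hij
    refine ⟨f, hf, ?_⟩
    intro a b
    rw [Fin.lt_def (a := π (f a))]
    refine Fin.lastCases ?_ (fun i => ?_) a <;> refine Fin.lastCases ?_ (fun j => ?_) b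
    · simp
    · rw [hr, finRotate_last, h1, h2]
      exact iff_of_true (Fin.succ_pos j) (hx _ (List.get_mem _ _))
    · rw [hr, finRotate_last, h1, h2]
      exact iff_of_false (by simp) (not_lt.2 (hx _ (List.get_mem _ _)).le)
    · rw [hr, hr, h1, h1, hm.lt_iff_lt]
      simp

end P17

/-- The number of 132-avoiding permutations of {1,…,n} whose longest increasing
subsequence has length exactly l (they contain the pattern 12⋯l but not
12⋯(l+1)) equals the number of 132-avoiding permutations σ with l₂(σ) = l,
i.e. containing the pattern 23⋯l1 (= `finRotate l`) but not 23⋯(l+1)1. -/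
theorem stmt17 (n l : ℕ) (hn : 1 ≤ n) (hl1 : 1 ≤ l) (hln : l ≤ n) :
    (Finset.univ.filter (fun π : Equiv.Perm (Fin n) =>
        Avoids π pat132 ∧ Contains π (1 : Equiv.Perm (Fin l)) ∧
        ¬ Contains π (1 : Equiv.Perm (Fin (l + 1))))).card =
    (Finset.univ.filter (fun σ : Equiv.Perm (Fin n) =>
        Avoids σ pat132 ∧ Contains σ (finRotate l) ∧
        ¬ Contains σ (finRotate (l + 1)))).card := by
  obtain ⟨m, rfl⟩ : ∃ m, l = m + 1 := ⟨l - 1, by omega⟩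
  rw [P17.card_A (fun w => P17.T w ∧ P17.inc (m+1) w ∧ ¬ P17.inc (m+1+1) w) _
      (fun π => by rw [P17.T_iff, P17.inc_iff, P17.inc_iff]),
    P17.card_A (fun w => P17.T w ∧ P17.rot m w ∧ ¬ P17.rot (m+1) w) _
      (fun π => by rw [P17.T_iff, P17.rot_iff, P17.rot_iff])]
  have h1 := P17.card_diff n (P17.inc (m+1)) (P17.inc (m+1+1)) (fun _ => P17.inc_pred)
  have h2 := P17.card_diff n (P17.rot m) (P17.rot (m+1)) (fun _ => P17.rot_pred)
  have h3 := P17.main_eq m n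
  have h4 := P17.main_eq (m+1) n
  omega
end

section
/- Fix s ≥ 2. For every n ≥ 1 and every l with s−1 ≤ l ≤ n, the number of 132-avoiding permutations of {1,…,n} whose longest increasing subsequence has length exactly l equals the number of 132-avoiding permutations σ of {1,…,n} with l_s(σ) = l, i.e., such that σ contains the shifted pattern p(s,l) but not p(s,l+1), where p(s,l) ∈ S_l is the permutation sending i ↦ i+s−1 for 1 ≤ i ≤ l−s+1 and i ↦ i−(l−s+1) for l−s+1 < i ≤ l (so p(s,l) = s(s+1)⋯l 1 2⋯(s−1); for l = s−1, p(s,l) is the identity of S_{s−1}). -/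
namespace St18
open BinaryTree Finset

abbrev BT := BinaryTree Unit

def lis : BT → ℕ
  | .nil => 0
  | .node _ L R => max (lis L + 1) (lis R)

def qq (a b : ℕ) : BT → Prop
  | .nil => False
  | .node _ L R => qq a b L ∨ qq a b R ∨ (a ≤ lis L ∧ b ≤ lis R)

lemma qq_of_succ (a b : ℕ) : ∀ t, qq (a+1) b t → qq a b t
  | .nil => fun h => h
  | .node _ L R => by
    intro h
    rcases h with h | h | h
    · exact Or.inl (qq_of_succ a b L h)
    · exact Or.inr (Or.inl (qq_of_succ a b R h))
    · exact Or.inr (Or.inr ⟨by omega, h.2⟩)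

lemma lis_of_qq (a b : ℕ) : ∀ t, qq a b t → a + 1 ≤ lis t ∧ b ≤ lis t
  | .nil => fun h => h.elim
  | .node _ L R => by
    intro h
    simp only [lis]
    rcases h with h | h | h
    · have := lis_of_qq a b L h; omega
    · have := lis_of_qq a b R h; omega
    · omega

noncomputable def gf (u : BT → ℤ) : PowerSeries ℤ :=
  PowerSeries.mk fun n => ∑ t ∈ treesOfNumNodesEq n, u t

lemma sum_succ (u : BT → ℤ) (n : ℕ) :
    ∑ t ∈ treesOfNumNodesEq (n+1), u t =
      ∑ ij ∈ antidiagonal n, ∑ L ∈ treesOfNumNodesEq ij.1, ∑ R ∈ treesOfNumNodesEq ij.2,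
        u (.node () L R) := by
  rw [treesOfNumNodesEq_succ, sum_biUnion]
  · apply sum_congr rfl
    rintro ⟨i, j⟩ _
    rw [pairwiseNode, sum_map, sum_product]
    rfl
  · simp_rw [Set.PairwiseDisjoint, Set.Pairwise, disjoint_left]
    aesop

lemma gf_mul (v w : BT → ℤ) (n : ℕ) : PowerSeries.coeff n (gf v * gf w) =
    ∑ ij ∈ antidiagonal n, ∑ L ∈ treesOfNumNodesEq ij.1, ∑ R ∈ treesOfNumNodesEq ij.2,
        v L * w R := by
  rw [PowerSeries.coeff_mul]
  apply sum_congr rfl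
  rintro ⟨i, j⟩ _
  simp only [gf, PowerSeries.coeff_mk]
  rw [sum_mul_sum]

open Classical in
noncomputable def ind (P : BT → Prop) (t : BT) : ℤ := if P t then 1 else 0

noncomputable def F (k : ℕ) : PowerSeries ℤ := gf (ind fun t => lis t < k)
noncomputable def G (a b : ℕ) : PowerSeries ℤ := gf (ind fun t => ¬ qq a b t)

lemma F_zero : F 0 = 0 := by
  ext n; simp [F, gf, ind]

open PowerSeries in
lemma F_succ (k : ℕ) : F (k+1) = 1 + X * (F k * F (k+1)) := by
  ext n
  rcases n with _ | n
  · simp [F, gf, ind, lis, filter_singleton]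
  · rw [map_add, coeff_succ_X_mul]
    unfold F
    rw [gf_mul]
    simp only [gf, coeff_mk]
    rw [sum_succ]
    simp only [coeff_one, Nat.succ_ne_zero, if_false, zero_add]
    refine sum_congr rfl fun ij _ => sum_congr rfl fun L _ => sum_congr rfl fun R _ => ?_
    simp only [ind, lis]
    by_cases c3 : lis L < k <;> by_cases c4 : lis R < k + 1 <;> simp [c3, c4] <;> omega

open PowerSeries in
lemma G_eq (a b : ℕ) : G a b = 1 + X * (F a * G a b + G a b * F b - F a * F b) := by
  ext n
  rcases n with _ | n
  · simp [G, gf, ind, qq]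
  · rw [map_add, coeff_succ_X_mul, map_sub, map_add]
    unfold F G
    rw [gf_mul, gf_mul, gf_mul]
    simp only [gf, coeff_mk]
    rw [sum_succ]
    simp only [coeff_one, Nat.succ_ne_zero, if_false, zero_add]
    simp only [← sum_add_distrib, ← sum_sub_distrib]
    refine sum_congr rfl fun ij _ => sum_congr rfl fun L _ => sum_congr rfl fun R _ => ?_
    have h1 := lis_of_qq a b L
    have h2 := lis_of_qq a b R
    simp only [ind, qq]
    by_cases c1 : qq a b L <;> by_cases c2 : qq a b R <;> by_cases c3 : lis L < a <;>
      by_cases c4 : lis R < b <;> simp [c1, c2, c3, c4] at h1 h2 ⊢ <;> omega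

open PowerSeries in
lemma F_E (a : ℕ) : ∀ b, F (a+b+1) * (1 - X * F a - X * F b) = 1 - X * F a * F b := by
  induction a with
  | zero =>
    intro b
    rw [F_zero, zero_add]
    linear_combination F_succ b
  | succ a ih =>
    intro b
    have h := ih (b+1)
    rw [show a + (b+1) + 1 = a + 1 + b + 1 by ring] at h
    have hA := F_succ a
    have hB := F_succ b
    have hne : (1 - X * F a : PowerSeries ℤ) ≠ 0 := by
      intro h0
      have := congrArg (constantCoeff) h0
      simp at this
    apply mul_left_cancel₀ hne
    generalize F (a+1+b+1) = H at *
    generalize F (a+1) = A' at *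
    generalize F (b+1) = B' at *
    generalize F a = A at *
    generalize F b = B at *
    linear_combination (1 - X * B) * h + (-H*X + X * B) * hA + (H * X - X * A) * hB

open PowerSeries in
lemma G_eq_F (a b : ℕ) : G a b = F (a+b+1) := by
  have hne : (1 - X * F a - X * F b : PowerSeries ℤ) ≠ 0 := by
    intro h0
    have := congrArg (constantCoeff) h0
    simp at this
  apply mul_right_cancel₀ hne
  rw [F_E]
  linear_combination G_eq a b

open Classical in
noncomputable def cnt (n : ℕ) (Q : BT → Prop) : ℕ := ((treesOfNumNodesEq n).filter Q).card

lemma cnt_cast (n : ℕ) (Q : BT → Prop) :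
    (cnt n Q : ℤ) = ∑ t ∈ treesOfNumNodesEq n, ind Q t := by
  classical
  rw [cnt, card_filter, Nat.cast_sum]
  refine sum_congr rfl fun t _ => ?_
  simp [ind]

lemma card_eq (a b n : ℕ) : cnt n (fun t => ¬ qq a b t) = cnt n (fun t => ¬ a + b + 1 ≤ lis t) := by
  have h := congrArg (PowerSeries.coeff n) (G_eq_F a b)
  simp only [G, F, gf, PowerSeries.coeff_mk] at h
  apply Nat.cast_injective (R := ℤ)
  rw [cnt_cast, cnt_cast, h]
  simp only [not_le]

inductive Rel : BT → List ℕ → Prop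
  | nil : Rel .nil []
  | node {L R : BT} {A B : List ℕ} {m : ℕ} : Rel L A → Rel R B → (∀ a ∈ A, a < m) →
      (∀ b ∈ B, b < m) → (∀ a ∈ A, ∀ b ∈ B, b < a) → Rel (.node () L R) (A ++ m :: B)

def incr (k : ℕ) (w : List ℕ) : Prop :=
  ∃ u : List ℕ, u.Sublist w ∧ u.Pairwise (· < ·) ∧ u.length = k

def shp (a b : ℕ) (w : List ℕ) : Prop :=
  ∃ u v : List ℕ, (u ++ v).Sublist w ∧ u.Pairwise (· < ·) ∧ v.Pairwise (· < ·) ∧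
    u.length = a ∧ v.length = b ∧ ∀ x ∈ u, ∀ y ∈ v, y < x

def av (w : List ℕ) : Prop := ∀ a b c, [a, b, c].Sublist w → a < c → ¬ c < b

lemma Rel.length {t : BT} {w : List ℕ} (h : Rel t w) : w.length = t.numNodes := by
  induction h with
  | nil => rfl
  | node _ _ _ _ _ h1 h2 => simp [BinaryTree.numNodes, h1, h2]; omega

lemma Rel.le_lis {t : BT} {w : List ℕ} (h : Rel t w) :
    ∀ u : List ℕ, u.Sublist w → u.Pairwise (· < ·) → u.length ≤ lis t := by
  induction h with
  | nil => intro u hu _; simp at hu; simp [hu, lis]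
  | @node L R A B m hL hR hA hB hAB h1 h2 =>
    intro u hu hp
    obtain ⟨u1, u2, rfl, s1, s2⟩ := List.sublist_append_iff.1 hu
    rw [List.pairwise_append] at hp
    obtain ⟨p1, p2, p3⟩ := hp
    simp only [lis, List.length_append]
    rcases List.sublist_cons_iff.1 s2 with s2 | ⟨r, rfl, s3⟩
    · have i1 := h1 _ s1 p1
      have i2 := h2 _ s2 p2
      rcases u1 with _ | ⟨x, u1⟩
      · simp; omega
      rcases u2 with _ | ⟨y, u2⟩
      · simp at i1 ⊢; omega
      exfalso
      have := p3 x (by simp) y (by simp)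
      have := hAB x (s1.subset (by simp)) y (s2.subset (by simp))
      omega
    · have i1 := h1 _ s1 p1
      rcases r with _ | ⟨y, r⟩
      · simp; omega
      exfalso
      simp at p2
      have := hB y (s3.subset (by simp))
      omega

lemma Rel.exists_lis {t : BT} {w : List ℕ} (h : Rel t w) : incr (lis t) w := by
  induction h with
  | nil => exact ⟨[], by simp [lis]⟩
  | @node L R A B m hL hR hA hB hAB h1 h2 =>
    obtain ⟨u, u1, u2, u3⟩ := h1
    obtain ⟨v, v1, v2, v3⟩ := h2
    rcases le_total (lis L + 1) (lis R) with c | c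
    · refine ⟨v, v1.trans ?_, v2, by simp [lis, c, v3]⟩
      exact (List.sublist_cons_self _ _).trans (List.sublist_append_right _ _)
    · refine ⟨u ++ [m], u1.append (by simp), ?_, by simp [lis, c, u3]⟩
      simp only [List.pairwise_append, u2, List.pairwise_singleton, true_and]
      intro a ha b hb
      simp at hb
      subst hb
      exact hA a (u1.subset ha)

lemma Rel.incr_of_le {t : BT} {w : List ℕ} (h : Rel t w) {k : ℕ} (hk : k ≤ lis t) :
    incr k w := by
  obtain ⟨u, u1, u2, u3⟩ := h.exists_lis
  exact ⟨u.take k, (List.take_sublist _ _).trans u1, u2.sublist (List.take_sublist _ _),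
    by simp; omega⟩

lemma Rel.incr_iff {t : BT} {w : List ℕ} (h : Rel t w) (k : ℕ) : incr k w ↔ k ≤ lis t := by
  constructor
  · rintro ⟨u, u1, u2, rfl⟩
    exact h.le_lis u u1 u2
  · exact h.incr_of_le

lemma shp_mono {a b : ℕ} {w w' : List ℕ} (h : shp a b w) (hw : w.Sublist w') : shp a b w' := by
  obtain ⟨u, v, h1, h2⟩ := h
  exact ⟨u, v, h1.trans hw, h2⟩

lemma Rel.shp_iff {t : BT} {w : List ℕ} (h : Rel t w) (a b : ℕ) (hb : 1 ≤ b) :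
    shp (a + 1) b w ↔ qq a b t := by
  induction h with
  | nil =>
    simp only [qq, iff_false]
    rintro ⟨u, v, h1, h2, h3, h4, h5, h6⟩
    simp at h1
    simp [h1] at h4
  | @node L R A B m hL hR hA hB hAB i1 i2 =>
    simp only [qq]
    constructor
    · rintro ⟨u, v, hs, hu, hv, hlu, hlv, huv⟩
      obtain ⟨l1, l2, e, s1, s2⟩ := List.sublist_append_iff.1 hs
      obtain ⟨x0, hx0⟩ : ∃ x, x ∈ u := List.exists_mem_of_length_pos (by omega)
      obtain ⟨y0, hy0⟩ : ∃ x, x ∈ v := List.exists_mem_of_length_pos (by omega)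
      rcases List.append_eq_append_iff.1 e with ⟨c, rfl, rfl⟩ | ⟨c, rfl, rfl⟩
      · rcases List.sublist_cons_iff.1 s2 with s2 | ⟨r, rfl, s2⟩
        · rcases l2 with _ | ⟨y, l2⟩
          · left
            rw [← i1]
            exact ⟨u, c, s1, hu, by simpa using hv, hlu, by simpa using hlv, by simpa using huv⟩
          · rcases c with _ | ⟨z, c⟩
            · right; right
              have := hL.le_lis u (by simpa using s1) hu
              have := hR.le_lis (y :: l2) s2 (by simpa using hv)
              simp at hlv this
              omega
            · exfalso
              rw [List.pairwise_append] at hv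
              have := hv.2.2 z (by simp) y (by simp)
              have := hAB z (s1.subset (by simp)) y (s2.subset (by simp))
              omega
        · exfalso
          have := huv x0 hx0 m (by simp)
          have := hA x0 (s1.subset (by simp [hx0]))
          omega
      · rcases List.sublist_cons_iff.1 s2 with s2 | ⟨r, e2, s2⟩
        · rcases l1 with _ | ⟨x, l1⟩
          · right; left
            rw [← i2]
            exact ⟨c, v, s2, by simpa using hu, hv, by simpa using hlu, hlv, by simpa using huv⟩
          · rcases c with _ | ⟨z, c⟩
            · right; right
              have := hL.le_lis (x :: l1) s1 (by simpa using hu)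
              have := hR.le_lis v (by simpa using s2) hv
              simp at *
              omega
            · exfalso
              rw [List.pairwise_append] at hu
              have := hu.2.2 x (by simp) z (by simp)
              have := hAB x (s1.subset (by simp)) z (s2.subset (by simp))
              omega
        · rcases c with _ | ⟨z, c⟩
          · exfalso
            simp at e2 hx0
            subst e2
            have := huv x0 (by simp [hx0]) m (by simp)
            have := hA x0 (s1.subset (by simp [hx0]))
            omega
          · simp at e2
            obtain ⟨rfl, rfl⟩ := e2
            rw [List.pairwise_append] at hu
            rcases c with _ | ⟨y, c⟩
            · right; right
              have := hL.le_lis l1 s1 hu.1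
              have := hR.le_lis v (by simpa using s2) hv
              simp at hlu
              omega
            · exfalso
              have h1 := hu.2.1
              simp at h1
              have := hB y (s2.subset (by simp))
              omega
    · rintro (h | h | ⟨h1, h2⟩)
      · exact shp_mono (i1.2 h) (List.sublist_append_left _ _)
      · exact shp_mono (i2.2 h)
          ((List.sublist_cons_self _ _).trans (List.sublist_append_right _ _))
      · obtain ⟨u, u1, u2, u3⟩ := hL.incr_of_le h1
        obtain ⟨v, v1, v2, v3⟩ := hR.incr_of_le h2
        refine ⟨u ++ [m], v, ?_, ?_, v2, by simp [u3], v3, ?_⟩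
        · simpa using u1.append (v1.cons_cons m)
        · simp only [List.pairwise_append, u2, List.pairwise_singleton, true_and]
          intro a ha b hb
          simp at hb
          subst hb
          exact hA a (u1.subset ha)
        · intro x hx y hy
          simp at hx
          rcases hx with hx | rfl
          · exact hAB x (u1.subset hx) y (v1.subset hy)
          · exact hB y (v1.subset hy)

lemma Rel.av {t : BT} {w : List ℕ} (h : Rel t w) : av w := by
  induction h with
  | nil => intro a b c h; simp at h
  | @node L R A B m hL hR hA hB hAB i1 i2 =>
    intro a b c hs hac hcb
    obtain ⟨l1, l2, e, s1, s2⟩ := List.sublist_append_iff.1 hs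
    rcases List.sublist_cons_iff.1 s2 with s2 | ⟨r, rfl, s3⟩
    · rcases l1 with _ | ⟨x, _ | ⟨y, _ | ⟨z, l1⟩⟩⟩
      · simp at e; subst e; exact i2 _ _ _ s2 hac hcb
      · simp at e
        obtain ⟨rfl, rfl⟩ := e
        have := hAB a (s1.subset (by simp)) c (s2.subset (by simp))
        omega
      · simp at e
        obtain ⟨rfl, rfl, rfl⟩ := e
        have := hAB a (s1.subset (by simp)) c (s2.subset (by simp))
        omega
      · simp at e
        obtain ⟨rfl, rfl, rfl, rfl, rfl⟩ := e
        exact i1 _ _ _ s1 hac hcb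
    · rcases l1 with _ | ⟨x, _ | ⟨y, _ | ⟨z, l1⟩⟩⟩
      · simp at e
        obtain ⟨rfl, rfl⟩ := e
        have := hB c (s3.subset (by simp))
        omega
      · simp at e
        obtain ⟨rfl, rfl, rfl⟩ := e
        have := hAB a (s1.subset (by simp)) c (s3.subset (by simp))
        omega
      · simp at e
        obtain ⟨rfl, rfl, rfl, rfl⟩ := e
        have := hA b (s1.subset (by simp))
        omega
      · simp at e

lemma av_mono {w w' : List ℕ} (h : St18.av w') (hs : w.Sublist w') : St18.av w :=
  fun a b c h1 => h a b c (h1.trans hs)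

lemma exists_rel (N : ℕ) : ∀ w : List ℕ, w.length ≤ N → w.Nodup → St18.av w → ∃ t, Rel t w := by
  induction N with
  | zero =>
    intro w hw _ _
    simp at hw
    subst hw
    exact ⟨_, Rel.nil⟩
  | succ N ih =>
    intro w hw hnd hav
    rcases Nat.eq_zero_or_pos w.length with h0 | h0
    · simp at h0
      subst h0
      exact ⟨_, Rel.nil⟩
    obtain ⟨x, hx⟩ := List.exists_mem_of_length_pos h0
    obtain ⟨m, hm, hmax⟩ := Finset.exists_max_image w.toFinset id ⟨x, by simpa using hx⟩
    simp at hm hmax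
    obtain ⟨A, B, rfl⟩ := List.append_of_mem hm
    have sA : A.Sublist (A ++ m :: B) := List.sublist_append_left _ _
    have sB : B.Sublist (A ++ m :: B) :=
      (List.sublist_cons_self _ _).trans (List.sublist_append_right _ _)
    simp at hw
    obtain ⟨tA, hA⟩ := ih A (by omega) (hnd.sublist sA) (av_mono hav sA)
    obtain ⟨tB, hB⟩ := ih B (by omega) (hnd.sublist sB) (av_mono hav sB)
    have hnd' := hnd
    rw [List.nodup_append] at hnd'
    obtain ⟨n1, n2, n3⟩ := hnd'
    have n4 := (List.nodup_cons.1 n2).1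
    have bB : ∀ b ∈ B, b < m := by
      intro b hb
      have := hmax b (by simp [hb])
      have : b ≠ m := fun e => n4 (e ▸ hb)
      omega
    refine ⟨_, Rel.node hA hB (m := m) ?_ bB ?_⟩
    · intro a ha
      have := hmax a (by simp [ha])
      have := n3 a ha m (by simp)
      omega
    · intro a ha b hb
      have h1 := n3 a ha b (by simp [hb])
      have h2 := hav a m b ?_
      · have := bB b hb
        by_contra h
        exact h2 (by omega) this
      · have := (List.singleton_sublist.2 ha).append
          ((List.singleton_sublist.2 hb).cons_cons m)
        simpa using this

lemma split_perm {A B A' B' : List ℕ} (h : (A ++ B).Perm (A' ++ B')) (hl : B.length = B'.length)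
    (h1 : ∀ a ∈ A, ∀ b ∈ B, b < a) (h2 : ∀ a ∈ A', ∀ b ∈ B', b < a) :
    A.Perm A' ∧ B.Perm B' := by
  have key : ∀ C D : List ℕ, (∀ a ∈ C, ∀ b ∈ D, b < a) →
      (D.mergeSort ++ C.mergeSort).SortedLE ∧ (D.mergeSort ++ C.mergeSort).Perm (C ++ D) := by
    intro C D hCD
    constructor
    · rw [List.sortedLE_iff_pairwise, List.pairwise_append]
      refine ⟨List.sortedLE_iff_pairwise.1 List.sortedLE_mergeSort,
        List.sortedLE_iff_pairwise.1 List.sortedLE_mergeSort, ?_⟩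
      intro a ha b hb
      simp at ha hb
      exact (hCD b hb a ha).le
    · exact ((List.mergeSort_perm _ _).append (List.mergeSort_perm _ _)).trans
        List.perm_append_comm
  obtain ⟨s1, p1⟩ := key A B h1
  obtain ⟨s2, p2⟩ := key A' B' h2
  have e := ((p1.trans h).trans p2.symm).eq_of_sortedLE s1 s2
  obtain ⟨e1, e2⟩ := List.append_inj e (by simp [hl])
  constructor
  · exact ((List.mergeSort_perm A _).symm.trans (List.Perm.of_eq e2)).trans
      (List.mergeSort_perm A' _)
  · exact ((List.mergeSort_perm B _).symm.trans (List.Perm.of_eq e1)).trans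
      (List.mergeSort_perm B' _)

lemma Rel.eq_of_perm {t : BT} {w : List ℕ} (h : Rel t w) :
    ∀ w', Rel t w' → w.Perm w' → w = w' := by
  induction h with
  | nil => intro w' _ hp; exact hp.symm.eq_nil.symm
  | @node L R A B m hL hR hA hB hAB i1 i2 =>
    intro w' h' hp
    cases h' with
    | @node _ _ A' B' m' hL' hR' hA' hB' hAB' =>
    have e : m = m' := by
      have h1 : m ∈ A' ++ m' :: B' := hp.subset (by simp)
      have h2 : m' ∈ A ++ m :: B := hp.symm.subset (by simp)
      simp at h1 h2
      rcases h1 with h1 | h1 | h1 <;> rcases h2 with h2 | h2 | h2 <;> try omega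
      · have := hA' _ h1; have := hA _ h2; omega
      · have := hA' _ h1; have := hB _ h2; omega
      · have := hB' _ h1; have := hA _ h2; omega
      · have := hB' _ h1; have := hB _ h2; omega
    subst e
    have hp2 : (A ++ B).Perm (A' ++ B') := by
      have := (List.perm_middle.symm.trans hp).trans List.perm_middle
      exact (List.perm_cons m).1 this
    obtain ⟨p1, p2⟩ := split_perm hp2 (by rw [hR.length, hR'.length]) hAB hAB'
    rw [i1 _ hL' p1, i2 _ hR' p2]

lemma Rel.tree_inj {t : BT} {w : List ℕ} (h : Rel t w) : ∀ t', Rel t' w → t = t' := by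
  induction h with
  | nil =>
    intro t' h'
    have := h'.length
    cases t' with
    | nil => rfl
    | node _ _ _ => simp [BinaryTree.numNodes] at this
  | @node L R A B m hL hR hA hB hAB i1 i2 =>
    intro t' h'
    generalize hw : A ++ m :: B = w' at h'
    cases h' with
    | nil => simp at hw
    | @node L' R' A' B' m' hL' hR' hA' hB' hAB' =>
    have e : m = m' := by
      have h1 : m ∈ A' ++ m' :: B' := by rw [← hw]; simp
      have h2 : m' ∈ A ++ m :: B := by rw [hw]; simp
      simp at h1 h2
      rcases h1 with h1 | h1 | h1 <;> rcases h2 with h2 | h2 | h2 <;> try omega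
      · have := hA' _ h1; have := hA _ h2; omega
      · have := hA' _ h1; have := hB _ h2; omega
      · have := hB' _ h1; have := hA _ h2; omega
      · have := hB' _ h1; have := hB _ h2; omega
    subst e
    rw [List.append_cons_inj_of_notMem (fun h => (hA _ h).ne rfl) (fun h => (hB _ h).ne rfl)] at hw
    obtain ⟨rfl, _, rfl⟩ := hw
    rw [i1 _ hL', i2 _ hR']

lemma Rel.shift {t : BT} {w : List ℕ} (h : Rel t w) (c : ℕ) : Rel t (w.map (c + ·)) := by
  induction h with
  | nil => exact Rel.nil
  | @node L R A B m hL hR hA hB hAB i1 i2 =>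
    rw [List.map_append, List.map_cons]
    refine Rel.node i1 i2 ?_ ?_ ?_
    · simpa using hA
    · simpa using hB
    · simpa using hAB

lemma exists_word : ∀ t : BT, ∃ w, Rel t w ∧ w.Perm (List.range t.numNodes)
  | .nil => ⟨[], Rel.nil, by simp [BinaryTree.numNodes]⟩
  | .node () L R => by
    obtain ⟨A, hA, pA⟩ := exists_word L
    obtain ⟨B, hB, pB⟩ := exists_word R
    have mA : ∀ a ∈ A, a < L.numNodes := fun a ha => by simpa using pA.subset ha
    have mB : ∀ a ∈ B, a < R.numNodes := fun a ha => by simpa using pB.subset ha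
    refine ⟨A.map (R.numNodes + ·) ++ (R.numNodes + L.numNodes) :: B,
      Rel.node (hA.shift _) hB ?_ ?_ ?_, ?_⟩
    · simpa using mA
    · intro b hb; have := mB b hb; omega
    · intro a ha b hb
      simp at ha
      obtain ⟨a, _, rfl⟩ := ha
      have := mB b hb; omega
    · have e : (BinaryTree.node () L R).numNodes = (R.numNodes + L.numNodes) + 1 := by
        simp [BinaryTree.numNodes]; omega
      rw [e, List.range_succ, List.range_add]
      refine List.perm_middle.trans ?_
      refine List.Perm.trans ?_ (List.perm_append_singleton _ _).symm
      refine List.Perm.cons _ ?_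
      exact List.perm_append_comm.trans (pB.append (pA.map _))

def word {n : ℕ} (π : Equiv.Perm (Fin n)) : List ℕ := List.ofFn fun i => (π i : ℕ)

lemma word_nodup {n : ℕ} (π : Equiv.Perm (Fin n)) : (word π).Nodup := by
  rw [word, List.nodup_ofFn]
  intro i j h
  exact π.injective (Fin.ext h)

lemma word_perm {n : ℕ} (π : Equiv.Perm (Fin n)) : (word π).Perm (List.range n) := by
  rw [List.perm_ext_iff_of_nodup (word_nodup π) List.nodup_range]
  intro a
  simp only [word, List.mem_ofFn, List.mem_range]
  constructor
  · rintro ⟨i, rfl⟩; exact (π i).2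
  · intro h; exact ⟨π.symm ⟨a, h⟩, by simp⟩

lemma word_inj {n : ℕ} : Function.Injective (word (n := n)) := by
  intro π σ h
  have := List.ofFn_injective h
  ext i
  exact congrFun this i

lemma word_surj {n : ℕ} (w : List ℕ) (h : w.Perm (List.range n)) :
    ∃ π : Equiv.Perm (Fin n), word π = w := by
  have hl : w.length = n := by simpa using h.length_eq
  have hnd : w.Nodup := h.nodup_iff.2 List.nodup_range
  have hlt : ∀ i : Fin n, w[i] < n := fun i => by
    simpa using h.subset (List.getElem_mem (l := w) (n := i) (by omega))
  let f : Fin n → Fin n := fun i => ⟨w[i], hlt i⟩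
  have hf : Function.Injective f := by
    intro i j hij
    have : w[i] = w[j] := congrArg Fin.val hij
    exact Fin.ext ((hnd.getElem_inj_iff).1 this)
  refine ⟨Equiv.ofBijective f (Finite.injective_iff_bijective.1 hf), ?_⟩
  apply List.ext_getElem
  · simp [word, hl]
  · intro i h1 h2
    simp [word, f]

lemma cont_iff {n k : ℕ} (π : Equiv.Perm (Fin n)) (τ : Equiv.Perm (Fin k)) :
    Contains π τ ↔ ∃ u : List ℕ, u.Sublist (word π) ∧ ∃ h : u.length = k,
      ∀ a b : Fin k, τ a < τ b → u[a] < u[b] := by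
  constructor
  · rintro ⟨f, hf, hτ⟩
    refine ⟨List.ofFn fun a => (π (f a) : ℕ), ?_, by simp, ?_⟩
    · rw [List.sublist_iff_exists_fin_orderEmbedding_get_eq]
      refine ⟨OrderEmbedding.ofStrictMono (fun i => Fin.cast (by simp [word]) (f (Fin.cast (by simp) i))) ?_, ?_⟩
      · intro i j hij
        have := hf (Fin.cast (by simp) i) (Fin.cast (by simp) j) (by simpa using hij)
        simpa using this
      · intro i
        simp [word]
        rfl
    · intro a b h
      have := (hτ a b).1 h
      simpa using this
  · rintro ⟨u, hu, hl, h⟩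
    subst hl
    obtain ⟨f, hf⟩ := List.sublist_iff_exists_fin_orderEmbedding_get_eq.1 hu
    have hw : (word π).length = n := by simp [word]
    have key : ∀ a, ((π (Fin.cast hw (f a)) : Fin n) : ℕ) = u[a] := by
      intro a
      have := hf a
      simp [word] at this
      simp [this]
      rfl
    refine ⟨fun a => Fin.cast hw (f a), ?_, ?_⟩
    · intro a b hab
      simpa using hab
    · intro a b
      rw [Fin.lt_def (a := π _), key, key]
      constructor
      · exact h a b
      · intro h1
        by_contra h2
        rcases (not_lt.1 h2).lt_or_eq with h3 | h3
        · have := h b a h3; omega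
        · have := τ.injective h3
          subst this
          omega

lemma cont_one {n k : ℕ} (π : Equiv.Perm (Fin n)) :
    Contains π (1 : Equiv.Perm (Fin k)) ↔ incr k (word π) := by
  rw [cont_iff]
  constructor
  · rintro ⟨u, hu, rfl, h⟩
    refine ⟨u, hu, ?_, rfl⟩
    rw [List.pairwise_iff_getElem]
    intro i j hi hj hij
    exact h ⟨i, hi⟩ ⟨j, hj⟩ hij
  · rintro ⟨u, hu, hp, rfl⟩
    refine ⟨u, hu, rfl, ?_⟩
    intro a b hab
    rw [List.pairwise_iff_getElem] at hp
    exact hp a b a.2 b.2 hab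

lemma avoids_iff {n : ℕ} (π : Equiv.Perm (Fin n)) : Avoids π pat132 ↔ av (word π) := by
  rw [Avoids, cont_iff]
  constructor
  · intro h a b c hs h1 h2
    refine h ⟨[a, b, c], hs, rfl, ?_⟩
    intro i j
    fin_cases i <;> fin_cases j <;> simp [pat132, Equiv.swap_apply_def] <;> omega
  · rintro h ⟨u, hs, hl, h1⟩
    obtain ⟨a, b, c, rfl⟩ := List.length_eq_three.1 hl
    exact h a b c hs (h1 0 2 (by decide)) (h1 2 1 (by decide))

lemma rot_pow (k b : ℕ) (i : Fin k) : (((finRotate k) ^ b) i : ℕ) = (i + b) % k := by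
  induction b with
  | zero => simp [Nat.mod_eq_of_lt i.2]
  | succ b ih =>
    rw [pow_succ', Equiv.Perm.mul_apply]
    obtain ⟨k, rfl⟩ : ∃ k', k = k' + 1 := ⟨k - 1, by have := i.2; omega⟩
    rw [finRotate_apply, Fin.val_add, ih]
    rw [Fin.val_one', ← Nat.add_mod, add_assoc]

lemma cont_rot {n a b : ℕ} (hb : 1 ≤ b) (π : Equiv.Perm (Fin n)) :
    Contains π ((finRotate (a + 1 + b)) ^ b) ↔ shp (a + 1) b (word π) := by
  have e : ∀ i : Fin (a + 1 + b), (((finRotate (a + 1 + b)) ^ b) i : ℕ) =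
      if (i : ℕ) < a + 1 then (i : ℕ) + b else i - (a + 1) := by
    intro i
    rw [rot_pow]
    have := i.2
    split_ifs with h
    · exact Nat.mod_eq_of_lt (by omega)
    · rw [show (i : ℕ) + b = (i - (a + 1)) + (a + 1 + b) by omega, Nat.add_mod_right]
      exact Nat.mod_eq_of_lt (by omega)
  rw [cont_iff]
  constructor
  · rintro ⟨u, hu, hl, h⟩
    have h' : ∀ i j (hi : i < u.length) (hj : j < u.length),
        (if i < a + 1 then i + b else i - (a + 1)) < (if j < a + 1 then j + b else j - (a + 1)) →
        u[i] < u[j] := by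
      intro i j hi hj hh
      apply h ⟨i, by omega⟩ ⟨j, by omega⟩
      rw [Fin.lt_def, e, e]
      exact hh
    refine ⟨u.take (a + 1), u.drop (a + 1), by simpa using hu, ?_, ?_, by simp; omega,
      by simp; omega, ?_⟩
    · rw [List.pairwise_iff_getElem]
      intro i j hi hj hij
      simp at hi hj
      simp only [List.getElem_take]
      apply h'
      split_ifs <;> omega
    · rw [List.pairwise_iff_getElem]
      intro i j hi hj hij
      simp at hi hj
      simp only [List.getElem_drop]
      apply h'
      split_ifs <;> omega
    · intro x hx y hy
      obtain ⟨i, hi, rfl⟩ := List.getElem_of_mem hx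
      obtain ⟨j, hj, rfl⟩ := List.getElem_of_mem hy
      simp at hi hj
      simp only [List.getElem_take, List.getElem_drop]
      apply h'
      split_ifs <;> omega
  · rintro ⟨u, v, hs, hu, hv, hlu, hlv, huv⟩
    refine ⟨u ++ v, hs, by simp [hlu, hlv], ?_⟩
    rw [List.pairwise_iff_getElem] at hu hv
    rintro ⟨i, hi⟩ ⟨j, hj⟩ hij
    rw [Fin.lt_def, e, e] at hij
    simp only at hij
    simp only [Fin.getElem_fin, List.getElem_append]
    split_ifs at hij ⊢ <;> try omega
    · exact hu _ _ _ _ (by omega)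
    · exact huv _ (List.getElem_mem _) _ (List.getElem_mem _)
    · exact hv _ _ _ _ (by omega)

open Classical in
lemma transfer (n : ℕ) (P : Equiv.Perm (Fin n) → Prop) (Q : BT → Prop)
    (h : ∀ π t, Rel t (word π) → (P π ↔ Q t)) :
    (Finset.univ.filter fun π => Avoids π pat132 ∧ P π).card =
      cnt n Q := by
  have ex : ∀ π : Equiv.Perm (Fin n), Avoids π pat132 → ∃ t, Rel t (word π) := fun π hπ =>
    exists_rel _ _ le_rfl (word_nodup π) ((avoids_iff π).1 hπ)
  refine Finset.card_bij (fun π hπ => (ex π (Finset.mem_filter.1 hπ).2.1).choose) ?_ ?_ ?_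
  · intro π hπ
    have hs := (ex π (Finset.mem_filter.1 hπ).2.1).choose_spec
    rw [Finset.mem_filter, mem_treesOfNumNodesEq]
    refine ⟨?_, (h _ _ hs).1 (Finset.mem_filter.1 hπ).2.2⟩
    rw [← hs.length]
    simp [word]
  · intro π hπ σ hσ e
    have hs := (ex π (Finset.mem_filter.1 hπ).2.1).choose_spec
    have hs' := (ex σ (Finset.mem_filter.1 hσ).2.1).choose_spec
    rw [e] at hs
    exact word_inj (hs.eq_of_perm _ hs' ((word_perm π).trans (word_perm σ).symm))
  · intro t ht
    rw [Finset.mem_filter, mem_treesOfNumNodesEq] at ht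
    obtain ⟨w, hw, hp⟩ := exists_word t
    rw [ht.1] at hp
    obtain ⟨π, rfl⟩ := word_surj w hp
    have hπ : π ∈ Finset.univ.filter fun π => Avoids π pat132 ∧ P π :=
      Finset.mem_filter.2 ⟨Finset.mem_univ _, (avoids_iff π).2 hw.av, (h _ _ hw).2 ht.2⟩
    exact ⟨π, hπ, (ex π (Finset.mem_filter.1 hπ).2.1).choose_spec.tree_inj _ hw⟩

lemma card_diff (n : ℕ) (P Q : BT → Prop) (h : ∀ t, Q t → P t) :
    cnt n (fun t => P t ∧ ¬ Q t) + cnt n (fun t => ¬ P t) = cnt n (fun t => ¬ Q t) := by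
  classical
  unfold cnt
  rw [← Finset.card_union_of_disjoint]
  · congr 1
    ext t
    have := h t
    simp only [Finset.mem_union, Finset.mem_filter]
    tauto
  · rw [Finset.disjoint_left]
    intro t
    simp only [Finset.mem_filter]
    tauto

end St18

/-- Fix s ≥ 2.  For s−1 ≤ l ≤ n, the number of 132-avoiding permutations of
{1,…,n} whose longest increasing subsequence has length exactly l equals the
number of 132-avoiding permutations σ with l_s(σ) = l, i.e. containing the
shifted pattern p(s,l) = s(s+1)⋯l12⋯(s−1) ∈ S_l (which, 0-based, is the cyclic
shift `(finRotate l) ^ (s−1)`) but not p(s,l+1). -/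
theorem stmt18 (n s l : ℕ) (hn : 1 ≤ n) (hs : 2 ≤ s) (hl1 : s - 1 ≤ l)
    (hln : l ≤ n) :
    (Finset.univ.filter (fun π : Equiv.Perm (Fin n) =>
        Avoids π pat132 ∧ Contains π (1 : Equiv.Perm (Fin l)) ∧
        ¬ Contains π (1 : Equiv.Perm (Fin (l + 1))))).card =
    (Finset.univ.filter (fun σ : Equiv.Perm (Fin n) =>
        Avoids σ pat132 ∧ Contains σ ((finRotate l) ^ (s - 1)) ∧
        ¬ Contains σ ((finRotate (l + 1)) ^ (s - 1)))).card := by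
  classical
  obtain ⟨b, rfl⟩ : ∃ b, s = b + 1 := ⟨s - 1, by omega⟩
  have hb : 1 ≤ b := by omega
  simp only [Nat.add_sub_cancel] at hl1 ⊢
  -- left-hand side
  have hL := St18.transfer n (fun π => Contains π (1 : Equiv.Perm (Fin l)) ∧
        ¬ Contains π (1 : Equiv.Perm (Fin (l + 1))))
        (fun t => l ≤ St18.lis t ∧ ¬ (l + 1 ≤ St18.lis t)) (by
          intro π t h
          rw [St18.cont_one, St18.cont_one, h.incr_iff, h.incr_iff])
  have dL := St18.card_diff n (fun t => l ≤ St18.lis t)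
    (fun t => l + 1 ≤ St18.lis t) (fun t h => by omega)
  obtain ⟨d, rfl⟩ : ∃ d, l = d + b := ⟨l - b, by omega⟩
  have e2 := St18.card_eq d b n
  rcases d with _ | a
  · have hR := St18.transfer n (fun σ => Contains σ ((finRotate (0 + b)) ^ b) ∧
        ¬ Contains σ ((finRotate (0 + b + 1)) ^ b))
        (fun t => 0 + b ≤ St18.lis t ∧ ¬ St18.qq 0 b t) (by
          intro π t h
          have e1 : (finRotate (0 + b)) ^ b = 1 := by
            ext i
            rw [St18.rot_pow]
            simp [Nat.mod_eq_of_lt (show (i : ℕ) < b by omega)]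
          rw [e1, St18.cont_one, h.incr_iff, show 0 + b + 1 = 0 + 1 + b by ring,
            St18.cont_rot hb, h.shp_iff _ _ hb])
    have dR := St18.card_diff n (fun t => 0 + b ≤ St18.lis t)
      (St18.qq 0 b) (fun t h => by have := St18.lis_of_qq 0 b t h; omega)
    convert hL.trans (Eq.trans ?_ hR.symm)
    omega
  · have hR := St18.transfer n (fun σ => Contains σ ((finRotate (a + 1 + b)) ^ b) ∧
        ¬ Contains σ ((finRotate (a + 1 + b + 1)) ^ b))
        (fun t => St18.qq a b t ∧ ¬ St18.qq (a + 1) b t) (by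
          intro π t h
          rw [St18.cont_rot hb, h.shp_iff _ _ hb, show a + 1 + b + 1 = (a + 1) + 1 + b by ring,
            St18.cont_rot hb, h.shp_iff _ _ hb])
    have dR := St18.card_diff n (St18.qq a b)
      (St18.qq (a + 1) b) (St18.qq_of_succ a b)
    have e1 := St18.card_eq a b n
    rw [show a + b + 1 = a + 1 + b by ring] at e1
    convert hL.trans (Eq.trans ?_ hR.symm)
    omega
end

section
/- For every permutation π ∈ S_n, the number of occurrences of the pattern 132 in π (i.e., the number of triples of indices a < b < c with π(a) < π(c) < π(b)) is equal to Σ_{(i,j) ∈ D(π)} ρ(i,j), where ρ(i,j) = |{k : k < i and π(k) < j}| is the number of dots of π strictly northwest of the cell (i,j). -/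
/-- The diagram of a permutation: cells (i,j) (0-indexed) with j < π i and i < π⁻¹ j. -/
def DiagramF {n : ℕ} (π : Equiv.Perm (Fin n)) : Finset (Fin n × Fin n) :=
  Finset.univ.filter (fun p => p.2 < π p.1 ∧ p.1 < π.symm p.2)

/-- The rank ρ(i,j) of a cell: the number of dots of π strictly northwest of
(i,j), i.e. indices k with k < i and π(k) < j. -/
def rho {n : ℕ} (π : Equiv.Perm (Fin n)) (p : Fin n × Fin n) : ℕ :=
  (Finset.univ.filter (fun k : Fin n => k < p.1 ∧ π k < p.2)).card

/-- The number of occurrences of the pattern 132 in π, i.e. of triples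
a < b < c with π(a) < π(c) < π(b), equals the sum of the ranks ρ(i,j) over all
cells (i,j) of the diagram D(π). -/
theorem stmt19 (n : ℕ) (π : Equiv.Perm (Fin n)) :
    (Finset.univ.filter (fun t : Fin n × Fin n × Fin n =>
        t.1 < t.2.1 ∧ t.2.1 < t.2.2 ∧ π t.1 < π t.2.2 ∧ π t.2.2 < π t.2.1)).card
      = ∑ p ∈ DiagramF π, rho π p := by
  unfold rho
  rw [← Finset.card_sigma]
  refine Finset.card_bij'
    (fun t _ => (⟨(t.2.1, π t.2.2), t.1⟩ : (_ : Fin n × Fin n) × Fin n))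
    (fun s _ => (s.2, s.1.1, π.symm s.1.2)) ?_ ?_ ?_ ?_
  · rintro ⟨a, b, c⟩ h
    simp only [Finset.mem_filter, Finset.mem_univ, true_and] at h
    simp [DiagramF, h]
  · rintro ⟨⟨i, j⟩, k⟩ h
    simp only [DiagramF, Finset.mem_sigma, Finset.mem_filter, Finset.mem_univ, true_and] at h
    simp [h]
  · rintro ⟨a, b, c⟩ h
    simp
  · rintro ⟨⟨i, j⟩, k⟩ h
    simp
end
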